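/- Let U be a nonnegative solution of the extension problem on the punctured half-ball 𝔅_2^+, with trace u(x) = U(x,0). Then limsup_{|x| → 0} |x|^{(n−2σ)/2} u(x) < ∞; that is, there exist constants C > 0 and r₀ ∈ (0,1) such that u(x) ≤ C |x|^{−(n−2σ)/2} for all x with 0 < |x| < r₀. -/

import Mathlib

open scoped Topology MeasureTheory RealInnerProductSpace
open Filter MeasureTheory

noncomputable section

/-- Points of `ℝ^{n+1}`, written `X = (x, t)` with `x ∈ ℝⁿ` and `t ∈ ℝ`. -/
abbrev Pt (n : ℕ) := EuclideanSpace ℝ (Fin n) × ℝ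

/-- The Euclidean norm on `ℝ^{n+1} = ℝⁿ × ℝ`. -/
def enorm' {n : ℕ} (X : Pt n) : ℝ := Real.sqrt (‖X.1‖ ^ 2 + X.2 ^ 2)

/-- Partial derivative in the last (`t`) direction. -/
def dt {n : ℕ} (U : Pt n → ℝ) (X : Pt n) : ℝ := fderiv ℝ U X (0, 1)

/-- Second derivative in the direction `v`. -/
def d2 {n : ℕ} (U : Pt n → ℝ) (X v : Pt n) : ℝ :=
  fderiv ℝ (fun Y => fderiv ℝ U Y v) X v

/-- The Laplacian on `ℝ^{n+1}`. -/
def lapl {n : ℕ} (U : Pt n → ℝ) (X : Pt n) : ℝ :=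
  (∑ i : Fin n, d2 U X (EuclideanSpace.single i (1 : ℝ), (0 : ℝ))) + d2 U X (0, 1)

/-- `U` is a nonnegative solution of the extension problem on the punctured half-ball
`𝔅_R^+`: it is nonnegative and continuous on `{|X| ≤ R, t ≥ 0} \ {0}`, `C²` on `𝔅_R^+`,
satisfies `ΔU + ((1-2σ)/t) ∂_t U = 0` there, and satisfies the nonlinear Neumann condition
`lim_{t→0⁺} t^{1-2σ} ∂_t U(x,t) = -u(x)^{(n+2σ)/(n-2σ)}` for `x ∈ B_R \ {0}`. -/
def ExtSol (n : ℕ) (σ R : ℝ) (U : Pt n → ℝ) : Prop :=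
  (∀ X : Pt n, enorm' X ≤ R → 0 ≤ X.2 → X ≠ 0 → 0 ≤ U X) ∧
  ContinuousOn U ({X : Pt n | enorm' X ≤ R ∧ 0 ≤ X.2} \ {0}) ∧
  ContDiffOn ℝ 2 U {X : Pt n | enorm' X < R ∧ 0 < X.2} ∧
  (∀ X : Pt n, enorm' X < R → 0 < X.2 →
    lapl U X + ((1 - 2 * σ) / X.2) * dt U X = 0) ∧
  (∀ x : EuclideanSpace ℝ (Fin n), ‖x‖ < R → x ≠ 0 →
    Tendsto (fun t : ℝ => t ^ (1 - 2 * σ) * dt U (x, t)) (𝓝[>] 0)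
      (𝓝 (-(U (x, 0) ^ (((n : ℝ) + 2 * σ) / ((n : ℝ) - 2 * σ))))))

namespace FracExt

/-- The squared Euclidean norm on `ℝ^{n+1}`. -/
def nsq {n : ℕ} (X : Pt n) : ℝ := ‖X.1‖ ^ 2 + X.2 ^ 2

/-- The degenerate elliptic operator `Δ + ((1-2σ)/t) ∂_t`. -/
def Lop {n : ℕ} (σ : ℝ) (U : Pt n → ℝ) (X : Pt n) : ℝ :=
  lapl U X + ((1 - 2 * σ) / X.2) * dt U X

/-- `f` is `C²` at `X` and the operator `Lop σ` takes the value `c` on `f` at `X`. -/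
def HasL {n : ℕ} (σ : ℝ) (f : Pt n → ℝ) (X : Pt n) (c : ℝ) : Prop :=
  ContDiffAt ℝ 2 f X ∧ Lop σ f X = c

/-- The weighted vertical difference quotients of `f` at the trace point `x` converge to `l`. -/
def HasQ {n : ℕ} (σ : ℝ) (f : Pt n → ℝ) (x : EuclideanSpace ℝ (Fin n)) (l : ℝ) : Prop :=
  Tendsto (fun t : ℝ => (f (x, t) - f (x, 0)) / t ^ (2 * σ)) (𝓝[>] 0) (𝓝 l)

section Calculus

variable {n : ℕ} {σ : ℝ} {f g : Pt n → ℝ} {X : Pt n} {c d : ℝ}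

lemma differentiableAt_fderiv (hf : ContDiffAt ℝ 2 f X) :
    DifferentiableAt ℝ (fderiv ℝ f) X :=
  (hf.fderiv_right (m := 1) (by norm_num)).differentiableAt (by norm_num)

lemma eventually_differentiableAt (hf : ContDiffAt ℝ 2 f X) :
    ∀ᶠ Y in 𝓝 X, DifferentiableAt ℝ f Y :=
  (hf.eventually (by norm_num)).mono fun _ h => h.differentiableAt (by norm_num)

lemma hasFDerivAt_fderiv_apply (hf : ContDiffAt ℝ 2 f X) (v : Pt n) :
    HasFDerivAt (fun Y => fderiv ℝ f Y v) ((fderiv ℝ (fderiv ℝ f) X).flip v) X := by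
  have h := (differentiableAt_fderiv hf).hasFDerivAt.clm_apply (hasFDerivAt_const v X)
  exact h.congr_fderiv (by ext w <;> simp)

lemma d2_eq (hf : ContDiffAt ℝ 2 f X) (v : Pt n) :
    d2 f X v = fderiv ℝ (fderiv ℝ f) X v v := by
  rw [d2, (hasFDerivAt_fderiv_apply hf v).fderiv]; rfl

lemma hasDerivAt_line (Y v : Pt n) (s : ℝ) : HasDerivAt (fun s : ℝ => Y + s • v) v s := by
  simpa using ((hasDerivAt_id s).smul_const v).const_add Y

lemma eventually_line {P : Pt n → Prop} (h : ∀ᶠ Y in 𝓝 X, P Y) (v : Pt n) :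
    ∀ᶠ s : ℝ in 𝓝 0, P (X + s • v) := by
  have : Tendsto (fun s : ℝ => X + s • v) (𝓝 0) (𝓝 X) := by
    have := (hasDerivAt_line X v 0).continuousAt.tendsto
    simpa using this
  exact this.eventually h

lemma eventually_hasDerivAt_line (hf : ContDiffAt ℝ 2 f X) (v : Pt n) :
    ∀ᶠ s : ℝ in 𝓝 0, HasDerivAt (fun s : ℝ => f (X + s • v)) (fderiv ℝ f (X + s • v) v) s :=
  (eventually_line (eventually_differentiableAt hf) v).mono fun s hs =>
    hs.hasFDerivAt.comp_hasDerivAt s (hasDerivAt_line X v s)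

lemma hasDerivAt_fderiv_line (hf : ContDiffAt ℝ 2 f X) (v : Pt n) :
    HasDerivAt (fun s : ℝ => fderiv ℝ f (X + s • v) v) (d2 f X v) 0 := by
  have h1 : HasFDerivAt (fun Y => fderiv ℝ f Y v) ((fderiv ℝ (fderiv ℝ f) X).flip v)
      (X + (0 : ℝ) • v) := by simpa using hasFDerivAt_fderiv_apply hf v
  have := h1.comp_hasDerivAt (0 : ℝ) (hasDerivAt_line X v 0)
  rw [d2_eq hf]; exact this

lemma d2_of_line (hf : ContDiffAt ℝ 2 f X) {v : Pt n} {g' : ℝ → ℝ}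
    (h1 : ∀ᶠ s in 𝓝 (0 : ℝ), HasDerivAt (fun s => f (X + s • v)) (g' s) s)
    (h2 : HasDerivAt g' c 0) : d2 f X v = c := by
  have he : (fun s : ℝ => fderiv ℝ f (X + s • v) v) =ᶠ[𝓝 0] g' := by
    filter_upwards [h1, eventually_hasDerivAt_line hf v] with s a b using b.unique a
  exact ((hasDerivAt_fderiv_line hf v).congr_of_eventuallyEq he.symm).unique h2

lemma dt_of_line (hf : ContDiffAt ℝ 2 f X)
    (h1 : HasDerivAt (fun s : ℝ => f (X + s • ((0, 1) : Pt n))) c 0) : dt f X = c := by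
  have := (eventually_hasDerivAt_line hf (0, 1)).self_of_nhds.unique h1
  simpa [dt] using this

lemma HasL.of_eq (h : HasL σ f X c) (e : c = d) : HasL σ f X d := e ▸ h

lemma HasL.congr (h : HasL σ f X c) (e : g =ᶠ[𝓝 X] f) : HasL σ g X c := by
  have e1 : fderiv ℝ g =ᶠ[𝓝 X] fderiv ℝ f := e.fderiv
  refine ⟨h.1.congr_of_eventuallyEq e, ?_⟩
  have e2 : ∀ v, d2 g X v = d2 f X v := fun v => by
    have : (fun Y => fderiv ℝ g Y v) =ᶠ[𝓝 X] fun Y => fderiv ℝ f Y v :=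
      e1.mono fun Y hY => by simp only [hY]
    rw [d2, d2, this.fderiv_eq]
  have e3 : dt g X = dt f X := by rw [dt, dt, e.fderiv_eq]
  rw [← h.2]; simp only [Lop, lapl, e2, e3]

lemma HasL.const (r : ℝ) : HasL σ (fun _ : Pt n => r) X 0 := by
  refine ⟨contDiffAt_const, ?_⟩
  have : ∀ v, d2 (fun _ : Pt n => r) X v = 0 := fun v => by simp [d2]
  simp [Lop, lapl, this, dt]

lemma HasL.add (hf : HasL σ f X c) (hg : HasL σ g X d) :
    HasL σ (fun Y => f Y + g Y) X (c + d) := by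
  have hfg : ContDiffAt ℝ 2 (fun Y => f Y + g Y) X := hf.1.add hg.1
  refine ⟨hfg, ?_⟩
  have h2 : ∀ v, d2 (fun Y => f Y + g Y) X v = d2 f X v + d2 g X v := fun v =>
    d2_of_line hfg (g' := fun s => fderiv ℝ f (X + s • v) v + fderiv ℝ g (X + s • v) v)
      ((eventually_hasDerivAt_line hf.1 v).and (eventually_hasDerivAt_line hg.1 v) |>.mono
        fun s hs => hs.1.add hs.2)
      ((hasDerivAt_fderiv_line hf.1 v).add (hasDerivAt_fderiv_line hg.1 v))
  have h1 : dt (fun Y => f Y + g Y) X = dt f X + dt g X := by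
    refine dt_of_line hfg ?_
    have h := (eventually_hasDerivAt_line hf.1 (0, 1)).self_of_nhds.fun_add
      (eventually_hasDerivAt_line hg.1 (0, 1)).self_of_nhds
    rwa [zero_smul, add_zero] at h
  rw [← hf.2, ← hg.2]
  simp only [Lop, lapl, h2, h1, Finset.sum_add_distrib]; ring

lemma HasL.const_mul (r : ℝ) (hf : HasL σ f X c) :
    HasL σ (fun Y => r * f Y) X (r * c) := by
  have hfg : ContDiffAt ℝ 2 (fun Y => r * f Y) X := contDiffAt_const.mul hf.1
  refine ⟨hfg, ?_⟩
  have h2 : ∀ v, d2 (fun Y => r * f Y) X v = r * d2 f X v := fun v =>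
    d2_of_line hfg (g' := fun s => r * fderiv ℝ f (X + s • v) v)
      ((eventually_hasDerivAt_line hf.1 v).mono fun s hs => hs.const_mul r)
      ((hasDerivAt_fderiv_line hf.1 v).const_mul r)
  have h1 : dt (fun Y => r * f Y) X = r * dt f X := by
    refine dt_of_line hfg ?_
    simpa [dt] using (eventually_hasDerivAt_line hf.1 (0, 1)).self_of_nhds.const_mul r
  rw [← hf.2]
  simp only [Lop, lapl, h2, h1, ← Finset.mul_sum]; ring

lemma HasL.sub (hf : HasL σ f X c) (hg : HasL σ g X d) :
    HasL σ (fun Y => f Y - g Y) X (c - d) := by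
  have := hf.add (hg.const_mul (-1))
  simpa [sub_eq_add_neg] using this

lemma nonneg_of_isLocalMin_line {k k' : ℝ → ℝ} {c : ℝ} (hmin : IsLocalMin k 0)
    (h1 : ∀ᶠ s in 𝓝 (0 : ℝ), HasDerivAt k (k' s) s) (h2 : HasDerivAt k' c 0) : 0 ≤ c := by
  by_contra hc
  push Not at hc
  have h0 : k' 0 = 0 := hmin.hasDerivAt_eq_zero h1.self_of_nhds
  have hd : deriv k =ᶠ[𝓝 0] k' := h1.mono fun s hs => hs.deriv
  have hd2 : deriv (deriv k) 0 = c := by rw [hd.deriv_eq, h2.deriv]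
  have hmax : IsLocalMin (fun s => -k s) 0 := by
    refine isLocalMin_of_deriv_deriv_pos ?_ ?_ ?_
    · have : deriv (fun s => -k s) = fun s => -deriv k s := by ext s; exact deriv.fun_neg
      rw [this, deriv.fun_neg, hd2]; linarith
    · rw [deriv.fun_neg, hd.self_of_nhds, h0, neg_zero]
    · exact h1.self_of_nhds.continuousAt.neg
  have hconst : k =ᶠ[𝓝 0] fun _ => k 0 := by
    filter_upwards [hmin, hmax] with s a b
    have := neg_le_neg_iff.mp b
    exact le_antisymm this a
  have : k' =ᶠ[𝓝 0] fun _ => (0 : ℝ) := by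
    filter_upwards [h1, hconst.eventuallyEq_nhds] with s a b
    have := a.congr_of_eventuallyEq b.symm
    exact this.unique (hasDerivAt_const s (k 0))
  have := (h2.congr_of_eventuallyEq this.symm).unique (hasDerivAt_const (0 : ℝ) (0 : ℝ))
  linarith

/-- At an interior local minimum the operator takes a nonnegative value. -/
lemma HasL.nonneg_of_isLocalMin (hf : HasL σ f X c) (hmin : IsLocalMin f X) : 0 ≤ c := by
  have hline : ∀ v : Pt n, IsLocalMin (fun s : ℝ => f (X + s • v)) 0 := fun v => by
    have := eventually_line hmin v
    simpa [IsLocalMin, IsMinFilter] using this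
  have h2 : ∀ v, 0 ≤ d2 f X v := fun v =>
    nonneg_of_isLocalMin_line (hline v) (eventually_hasDerivAt_line hf.1 v)
      (hasDerivAt_fderiv_line hf.1 v)
  have h1 : dt f X = 0 := by simp [dt, hmin.fderiv_eq_zero]
  rw [← hf.2, Lop, lapl, h1, mul_zero, add_zero]
  exact add_nonneg (Finset.sum_nonneg fun i _ => h2 _) (h2 _)

lemma HasQ.of_eq {x : EuclideanSpace ℝ (Fin n)} (h : HasQ σ f x c) (e : c = d) : HasQ σ f x d :=
  e ▸ h

lemma HasQ.add {x : EuclideanSpace ℝ (Fin n)} (hf : HasQ σ f x c) (hg : HasQ σ g x d) :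
    HasQ σ (fun Y => f Y + g Y) x (c + d) := by
  refine (Tendsto.add hf hg).congr fun t => ?_
  ring

lemma HasQ.const_mul {x : EuclideanSpace ℝ (Fin n)} (r : ℝ) (hf : HasQ σ f x c) :
    HasQ σ (fun Y => r * f Y) x (r * c) := by
  refine (Tendsto.const_mul r hf).congr fun t => ?_
  ring

lemma HasQ.sub {x : EuclideanSpace ℝ (Fin n)} (hf : HasQ σ f x c) (hg : HasQ σ g x d) :
    HasQ σ (fun Y => f Y - g Y) x (c - d) := by
  refine (Tendsto.sub hf hg).congr fun t => ?_
  ring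

lemma HasQ.const {x : EuclideanSpace ℝ (Fin n)} (r : ℝ) : HasQ σ (fun _ : Pt n => r) x 0 := by
  refine tendsto_const_nhds.congr fun t => ?_
  simp

/-- A difference quotient bound `O(t²)` is negligible against `t^{2σ}`. -/
lemma tendsto_sq_div_rpow (hσ : σ < 1) :
    Tendsto (fun t : ℝ => t ^ 2 / t ^ (2 * σ)) (𝓝[>] 0) (𝓝 0) := by
  have h : Tendsto (fun t : ℝ => t ^ (2 - 2 * σ)) (𝓝[>] 0) (𝓝 0) := by
    have := (Real.continuousAt_rpow_const 0 (2 - 2 * σ) (Or.inr (by linarith))).tendsto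
    rw [Real.zero_rpow (by linarith)] at this
    exact this.mono_left nhdsWithin_le_nhds
  refine h.congr' ?_
  filter_upwards [self_mem_nhdsWithin] with t ht
  rw [Real.rpow_sub ht, Real.rpow_two]

/-- A function of `t²`, differentiable at `t² = 0`, has vanishing weighted vertical quotient. -/
lemma tendsto_quot_comp_sq (hσ : σ < 1) {F : ℝ → ℝ} {F' : ℝ} (hF : HasDerivAt F F' 0) :
    Tendsto (fun t : ℝ => (F (t ^ 2) - F 0) / t ^ (2 * σ)) (𝓝[>] 0) (𝓝 0) := by
  have h1 := hasDerivAt_iff_tendsto_slope.mp hF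
  have h2 : Tendsto (fun t : ℝ => t ^ 2) (𝓝[>] 0) (𝓝[≠] 0) := by
    refine tendsto_nhdsWithin_iff.mpr ⟨?_, ?_⟩
    · have : Tendsto (fun t : ℝ => t ^ 2) (𝓝 0) (𝓝 0) := by
        simpa using (continuous_pow 2).tendsto (0 : ℝ)
      exact this.mono_left nhdsWithin_le_nhds
    · filter_upwards [self_mem_nhdsWithin] with t ht
      exact pow_ne_zero 2 (ne_of_gt ht)
  have h3 := (h1.comp h2).mul (tendsto_sq_div_rpow hσ)
  rw [mul_zero] at h3
  refine h3.congr' ?_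
  filter_upwards [self_mem_nhdsWithin] with t ht
  have : (t : ℝ) ≠ 0 := ne_of_gt ht
  simp only [Function.comp, slope_def_field, sub_zero]
  field_simp

/-- Comparison principle: a function `w` on the part of `C` in `t ≥ 0` is nonnegative if, wherever
it is negative, it is a supersolution relative to the strict positive supersolution `Φ`. -/
theorem comparison {C : Set (Pt n)} (hC : IsCompact C) {w Φ : Pt n → ℝ}
    (hw : ContinuousOn w (C ∩ {X | 0 ≤ X.2})) (hΦ : ContinuousOn Φ (C ∩ {X | 0 ≤ X.2}))
    (hpos : ∀ X ∈ C, 0 ≤ X.2 → 0 < Φ X)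
    (h : ∀ X ∈ C, 0 ≤ X.2 → w X < 0 → C ∈ 𝓝 X ∧
      (0 < X.2 → ∃ cw cΦ, HasL σ w X cw ∧ HasL σ Φ X cΦ ∧ cw ≤ 0 ∧ cΦ < 0) ∧
      (X.2 = 0 → ∃ lw lΦ, HasQ σ w X.1 lw ∧ HasQ σ Φ X.1 lΦ ∧ lw * Φ X < w X * lΦ)) :
    ∀ X ∈ C, 0 ≤ X.2 → 0 ≤ w X := by
  intro X0 hX0 ht0
  by_contra hneg
  push Not at hneg
  set K := C ∩ {X : Pt n | 0 ≤ X.2} with hK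
  have hKc : IsCompact K := hC.inter_right (isClosed_le continuous_const continuous_snd)
  have hposK : ∀ X ∈ K, 0 < Φ X := fun X hX => hpos X hX.1 hX.2
  obtain ⟨X, hX, hmin⟩ := hKc.exists_isMinOn ⟨X0, hX0, ht0⟩
    (hw.div hΦ fun X hX => (hposK X hX).ne')
  set s := -(w X / Φ X) with hs
  have hΦX := hposK X hX
  have hs0 : 0 < s := by
    have h1 : w X / Φ X ≤ w X0 / Φ X0 := hmin ⟨hX0, ht0⟩
    have h2 : w X0 / Φ X0 < 0 := div_neg_of_neg_of_pos hneg (hposK X0 ⟨hX0, ht0⟩)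
    rw [hs]; linarith
  have hwX : w X = -s * Φ X := by rw [hs]; field_simp
  have hwneg : w X < 0 := by rw [hwX]; nlinarith
  have hall : ∀ Y ∈ K, w X + s * Φ X ≤ w Y + s * Φ Y := fun Y hY => by
    have h1 : w X / Φ X ≤ w Y / Φ Y := hmin hY
    have h2 : -s ≤ w Y / Φ Y := by rw [hs]; linarith
    rw [le_div_iff₀ (hposK Y hY)] at h2
    rw [hwX]; linarith
  obtain ⟨hnb, hint, hflat⟩ := h X hX.1 hX.2 hwneg
  have hX2 : 0 ≤ X.2 := hX.2
  rcases hX2.eq_or_lt with h0 | h0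
  · obtain ⟨lw, lΦ, h1, h2, h3⟩ := hflat h0.symm
    have h4 := h1.add (h2.const_mul s)
    have hX' : X = (X.1, 0) := Prod.ext rfl h0.symm
    have h5 : 0 ≤ lw + s * lΦ := by
      refine ge_of_tendsto h4 ?_
      have hcont : Tendsto (fun t : ℝ => ((X.1, t) : Pt n)) (𝓝[>] 0) (𝓝 X) := by
        have : Tendsto (fun t : ℝ => ((X.1, t) : Pt n)) (𝓝 0) (𝓝 (X.1, 0)) :=
          (Continuous.prodMk_right X.1).tendsto 0
        rw [← hX'] at this
        exact this.mono_left nhdsWithin_le_nhds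
      filter_upwards [hcont.eventually hnb, self_mem_nhdsWithin] with t ht1 ht2
      have ht2' : (0 : ℝ) < t := ht2
      have := hall (X.1, t) ⟨ht1, ht2'.le⟩
      rw [hX'] at this
      exact div_nonneg (by simpa using this) (Real.rpow_nonneg ht2'.le _)
    rw [hwX] at h3
    nlinarith
  · obtain ⟨cw, cΦ, h1, h2, h3, h4⟩ := hint h0
    have h5 := h1.add (h2.const_mul s)
    have : IsLocalMin (fun Y => w Y + s * Φ Y) X := by
      have hu : {Y : Pt n | 0 < Y.2} ∈ 𝓝 X :=
        (isOpen_lt continuous_const continuous_snd).mem_nhds h0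
      filter_upwards [hnb, hu] with Y hY1 hY2
      exact hall Y ⟨hY1, le_of_lt hY2⟩
    have := h5.nonneg_of_isLocalMin this
    nlinarith

end Calculus

section Barriers

variable {n : ℕ} {σ : ℝ}

lemma norm_sq_add_smul_single (ξ : EuclideanSpace ℝ (Fin n)) (i : Fin n) (s : ℝ) :
    ‖ξ + s • EuclideanSpace.single i (1 : ℝ)‖ ^ 2 = ‖ξ‖ ^ 2 + 2 * s * ξ i + s ^ 2 := by
  rw [norm_add_sq_real, inner_smul_right, EuclideanSpace.inner_single_right, norm_smul]
  simp
  ring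

lemma sum_sq_coord (ξ : EuclideanSpace ℝ (Fin n)) : ∑ i, ξ i ^ 2 = ‖ξ‖ ^ 2 := by
  rw [EuclideanSpace.norm_sq_eq]; simp

lemma nsq_line_single (X Z : Pt n) (i : Fin n) (s : ℝ) :
    nsq (X + s • ((EuclideanSpace.single i (1 : ℝ), 0) : Pt n) - Z) =
      nsq (X - Z) + 2 * s * (X - Z).1 i + s ^ 2 := by
  have : (X + s • ((EuclideanSpace.single i (1 : ℝ), 0) : Pt n) - Z).1 =
      (X - Z).1 + s • EuclideanSpace.single i (1 : ℝ) := by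
    simp only [Prod.fst_sub, Prod.fst_add, Prod.smul_fst]; abel
  rw [nsq, this, norm_sq_add_smul_single, nsq]
  simp
  ring

lemma nsq_line_vert (X Z : Pt n) (s : ℝ) :
    nsq (X + s • ((0, 1) : Pt n) - Z) = nsq (X - Z) + 2 * s * (X - Z).2 + s ^ 2 := by
  simp [nsq]
  ring

lemma contDiff_nsq_sub (Z : Pt n) : ContDiff ℝ 2 fun Y : Pt n => nsq (Y - Z) := by
  unfold nsq
  have h1 : ContDiff ℝ 2 fun Y : Pt n => ‖(Y - Z).1‖ ^ 2 :=
    (contDiff_fst.comp (contDiff_id.sub contDiff_const)).norm_sq ℝ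
  have h2 : ContDiff ℝ 2 fun Y : Pt n => (Y - Z).2 ^ 2 :=
    (contDiff_snd.comp (contDiff_id.sub contDiff_const)).pow 2
  exact h1.add h2

lemma hasDerivAt_quad (q b s : ℝ) :
    HasDerivAt (fun s : ℝ => q + 2 * s * b + s ^ 2) (2 * b + 2 * s) s := by
  have := ((((hasDerivAt_id s).const_mul 2).mul_const b).const_add q).add
    ((hasDerivAt_id s).pow 2)
  refine this.congr_deriv ?_
  simp

lemma eventually_quad_pos {q : ℝ} (hq : 0 < q) (b : ℝ) :
    ∀ᶠ s : ℝ in 𝓝 0, 0 < q + 2 * s * b + s ^ 2 := by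
  have : ContinuousAt (fun s : ℝ => q + 2 * s * b + s ^ 2) 0 := (hasDerivAt_quad q b 0).continuousAt
  exact this.eventually (lt_mem_nhds (by simpa using hq))

lemma hasDerivAt_rpow_quad {q : ℝ} (b r : ℝ) {s : ℝ} (hs : 0 < q + 2 * s * b + s ^ 2) :
    HasDerivAt (fun s : ℝ => (q + 2 * s * b + s ^ 2) ^ r)
      ((2 * b + 2 * s) * r * (q + 2 * s * b + s ^ 2) ^ (r - 1)) s :=
  (hasDerivAt_quad q b s).rpow_const (Or.inl hs.ne')

lemma hasDerivAt_rpow_quad_two {q : ℝ} (b r : ℝ) (hq : 0 < q) :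
    HasDerivAt (fun s : ℝ => (2 * b + 2 * s) * r * (q + 2 * s * b + s ^ 2) ^ (r - 1))
      (2 * r * q ^ (r - 1) + 4 * b ^ 2 * r * (r - 1) * q ^ (r - 2)) 0 := by
  have h1 : HasDerivAt (fun s : ℝ => (2 * b + 2 * s) * r) (2 * r) 0 := by
    simpa using (((hasDerivAt_id (0 : ℝ)).const_mul 2).const_add (2 * b)).mul_const r
  have h2 := h1.fun_mul (hasDerivAt_rpow_quad (q := q) b (r - 1) (s := 0) (by simpa using hq))
  refine h2.congr_deriv ?_
  have : r - 1 - 1 = r - 2 := by ring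
  simp only [this]
  norm_num
  ring

/-- The radial power `|Y - Z|^{-2β}`. -/
def radial (Z : Pt n) (β : ℝ) (Y : Pt n) : ℝ := nsq (Y - Z) ^ (-β)

lemma hasL_radial {Z X : Pt n} (β : ℝ) (hX : 0 < nsq (X - Z)) :
    HasL σ (radial Z β) X (2 * β * nsq (X - Z) ^ (-β - 1) *
      (2 * (β + 1) - (n + 1) - (1 - 2 * σ) * (X.2 - Z.2) / X.2)) := by
  have hc : ContDiffAt ℝ 2 (radial Z β) X :=
    ((contDiff_nsq_sub Z).contDiffAt).rpow_const_of_ne hX.ne'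
  refine ⟨hc, ?_⟩
  set q := nsq (X - Z) with hq
  have h1 : ∀ i : Fin n, d2 (radial Z β) X (EuclideanSpace.single i 1, 0) =
      2 * (-β) * q ^ (-β - 1) + 4 * ((X - Z).1 i) ^ 2 * (-β) * (-β - 1) * q ^ (-β - 2) :=
    fun i => by
    refine d2_of_line hc ?_ (hasDerivAt_rpow_quad_two ((X - Z).1 i) (-β) hX)
    filter_upwards [eventually_quad_pos hX ((X - Z).1 i)] with s hs
    simp only [radial, nsq_line_single]
    exact hasDerivAt_rpow_quad _ _ hs
  have h2 : d2 (radial Z β) X (0, 1) =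
      2 * (-β) * q ^ (-β - 1) + 4 * ((X - Z).2) ^ 2 * (-β) * (-β - 1) * q ^ (-β - 2) := by
    refine d2_of_line hc ?_ (hasDerivAt_rpow_quad_two ((X - Z).2) (-β) hX)
    filter_upwards [eventually_quad_pos hX ((X - Z).2)] with s hs
    simp only [radial, nsq_line_vert]
    exact hasDerivAt_rpow_quad _ _ hs
  have h3 : dt (radial Z β) X = 2 * (X - Z).2 * (-β) * q ^ (-β - 1) := by
    refine dt_of_line hc ?_
    simp only [radial, nsq_line_vert]
    have := hasDerivAt_rpow_quad (q := q) (X - Z).2 (-β) (s := 0) (by simpa using hX)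
    simpa using this
  have h4 : q ^ (-β - 1) = q ^ (-β - 2) * q := by
    rw [← Real.rpow_add_one hX.ne']; congr 1; ring
  have h5 : ∑ i, (X - Z).1 i ^ 2 = q - (X.2 - Z.2) ^ 2 := by
    rw [sum_sq_coord, hq, nsq]; simp
  have h6 : ∑ i : Fin n, (2 * (-β) * q ^ (-β - 1) +
      4 * ((X - Z).1 i) ^ 2 * (-β) * (-β - 1) * q ^ (-β - 2)) =
      n * (2 * (-β) * q ^ (-β - 1)) +
        4 * (q - (X.2 - Z.2) ^ 2) * (-β) * (-β - 1) * q ^ (-β - 2) := by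
    rw [Finset.sum_add_distrib, ← h5, Finset.mul_sum, Finset.sum_mul, Finset.sum_mul,
      Finset.sum_mul]
    simp
  simp only [Lop, lapl, h1, h2, h3, h6, Prod.snd_sub]
  rw [h4]
  ring

lemma hasQ_radial (hσ : σ < 1) {z x : EuclideanSpace ℝ (Fin n)} (β : ℝ) (hx : x ≠ z) :
    HasQ σ (radial (z, 0) β) x 0 := by
  have hpos : 0 < ‖x - z‖ ^ 2 := by
    have := norm_pos_iff.mpr (sub_ne_zero.mpr hx); positivity
  have h : HasDerivAt (fun r : ℝ => (‖x - z‖ ^ 2 + r) ^ (-β))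
      (1 * (-β) * (‖x - z‖ ^ 2 + 0) ^ (-β - 1)) 0 :=
    ((hasDerivAt_id (0 : ℝ)).const_add _).rpow_const (Or.inl (by simpa using hpos.ne'))
  refine (tendsto_quot_comp_sq hσ h).congr fun t => ?_
  simp [radial, nsq]

lemma continuousOn_radial (Z : Pt n) (β : ℝ) {K : Set (Pt n)} (hK : ∀ Y ∈ K, 0 < nsq (Y - Z)) :
    ContinuousOn (radial Z β) K :=
  (contDiff_nsq_sub Z).continuous.continuousOn.rpow_const fun Y hY => Or.inl (hK Y hY).ne'

/-- A quadratic polynomial in the horizontal variable. -/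
def quadP (e z : EuclideanSpace ℝ (Fin n)) (c N Q D : ℝ) (y : EuclideanSpace ℝ (Fin n)) : ℝ :=
  c + N * ⟪e, y - z⟫ - Q * ⟪e, y - z⟫ ^ 2 + D * ‖y - z‖ ^ 2

/-- The family of barriers `P(y) (1 - E t^{2σ}) + γ (t - τ)² - μ t^{2σ}`. -/
def quadBar (σ : ℝ) (e z : EuclideanSpace ℝ (Fin n)) (c N Q D E γ τ μ : ℝ) (Y : Pt n) : ℝ :=
  quadP e z c N Q D Y.1 * (1 - E * Y.2 ^ (2 * σ)) + γ * (Y.2 - τ) ^ 2 - μ * Y.2 ^ (2 * σ)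

lemma contDiff_quadP (e z : EuclideanSpace ℝ (Fin n)) (c N Q D : ℝ) :
    ContDiff ℝ 2 (quadP e z c N Q D) := by
  unfold quadP
  have h1 : ContDiff ℝ 2 fun y : EuclideanSpace ℝ (Fin n) => ⟪e, y - z⟫ :=
    contDiff_const.inner ℝ (contDiff_id.sub contDiff_const)
  have h2 : ContDiff ℝ 2 fun y : EuclideanSpace ℝ (Fin n) => ‖y - z‖ ^ 2 :=
    (contDiff_id.sub contDiff_const).norm_sq ℝ
  exact ((contDiff_const.add (contDiff_const.mul h1)).sub (contDiff_const.mul (h1.pow 2))).add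
    (contDiff_const.mul h2)

lemma quadP_line (e z y : EuclideanSpace ℝ (Fin n)) (c N Q D : ℝ) (i : Fin n) (s : ℝ) :
    quadP e z c N Q D (y + s • EuclideanSpace.single i (1 : ℝ)) =
      quadP e z c N Q D y + (N * e i - 2 * Q * ⟪e, y - z⟫ * e i + 2 * D * (y - z) i) * s +
        (D - Q * e i ^ 2) * s ^ 2 := by
  have h1 : y + s • EuclideanSpace.single i (1 : ℝ) - z =
      (y - z) + s • EuclideanSpace.single i (1 : ℝ) := by abel
  have h2 : ⟪e, (y - z) + s • EuclideanSpace.single i (1 : ℝ)⟫ = ⟪e, y - z⟫ + s * e i := by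
    rw [inner_add_right, inner_smul_right, EuclideanSpace.inner_single_right]; simp
  rw [quadP, h1, h2, norm_sq_add_smul_single, quadP]
  ring

lemma hasL_quadBar (e z : EuclideanSpace ℝ (Fin n)) (c N Q D E γ τ μ : ℝ) {X : Pt n}
    (hX : 0 < X.2) :
    HasL σ (quadBar σ e z c N Q D E γ τ μ) X
      ((2 * n * D - 2 * Q * ‖e‖ ^ 2) * (1 - E * X.2 ^ (2 * σ)) + 2 * γ +
        2 * γ * ((1 - 2 * σ) * (X.2 - τ) / X.2)) := by
  have hsnd : ContDiffAt ℝ 2 (fun Y : Pt n => Y.2) X := contDiff_snd.contDiffAt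
  have hpow : ContDiffAt ℝ 2 (fun Y : Pt n => Y.2 ^ (2 * σ)) X := hsnd.rpow_const_of_ne hX.ne'
  have hc : ContDiffAt ℝ 2 (quadBar σ e z c N Q D E γ τ μ) X :=
    ((((contDiff_quadP e z c N Q D).comp contDiff_fst).contDiffAt.mul
      (contDiffAt_const.sub (contDiffAt_const.mul hpow))).add
      (contDiffAt_const.mul ((hsnd.sub contDiffAt_const).pow 2))).sub
      (contDiffAt_const.mul hpow)
  refine ⟨hc, ?_⟩
  set P := quadP e z c N Q D X.1 with hP
  set G := 1 - E * X.2 ^ (2 * σ) with hG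
  have h1 : ∀ i : Fin n, d2 (quadBar σ e z c N Q D E γ τ μ) X (EuclideanSpace.single i 1, 0) =
      2 * (D - Q * e i ^ 2) * G := fun i => by
    set b := N * e i - 2 * Q * ⟪e, X.1 - z⟫ * e i + 2 * D * (X.1 - z) i with hb
    refine d2_of_line hc (g' := fun s => (b + 2 * (D - Q * e i ^ 2) * s) * G)
      (Eventually.of_forall fun s => ?_) ?_
    · have h : (fun s : ℝ => quadBar σ e z c N Q D E γ τ μ
          (X + s • ((EuclideanSpace.single i 1, 0) : Pt n))) = fun s =>
          (P + b * s + (D - Q * e i ^ 2) * s ^ 2) * G + γ * (X.2 - τ) ^ 2 - μ * X.2 ^ (2 * σ) := by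
        ext s
        simp only [quadBar, Prod.fst_add, Prod.smul_fst, Prod.snd_add, Prod.smul_snd, smul_zero,
          add_zero, quadP_line, ← hP, ← hb, ← hG]
      rw [h]
      have := (((((hasDerivAt_id s).const_mul b).const_add P).add
        (((hasDerivAt_id s).pow 2).const_mul (D - Q * e i ^ 2))).mul_const G).add_const
        (γ * (X.2 - τ) ^ 2) |>.sub_const (μ * X.2 ^ (2 * σ))
      refine this.congr_deriv ?_
      norm_num only [id, pow_one, mul_one, one_mul]
      ring
    · have := (((hasDerivAt_id (0 : ℝ)).const_mul (2 * (D - Q * e i ^ 2))).const_add b).mul_const G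
      simpa using this
  have hv : (fun s : ℝ => quadBar σ e z c N Q D E γ τ μ (X + s • ((0, 1) : Pt n))) = fun s =>
      P + γ * (X.2 + s - τ) ^ 2 - (P * E + μ) * (X.2 + s) ^ (2 * σ) := by
    ext s
    simp only [quadBar, Prod.fst_add, Prod.smul_fst, Prod.snd_add, Prod.smul_snd, smul_zero,
      add_zero, ← hP, smul_eq_mul, mul_one]
    ring
  have hlin : ∀ r s : ℝ, HasDerivAt (fun s : ℝ => r + s) 1 s := fun r s =>
    (hasDerivAt_id s).const_add r
  have hpw : ∀ r s : ℝ, 0 < X.2 + s →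
      HasDerivAt (fun s : ℝ => (X.2 + s) ^ r) (r * (X.2 + s) ^ (r - 1)) s := fun r s hs => by
    have := (hlin X.2 s).rpow_const (p := r) (Or.inl hs.ne')
    simpa using this
  have hd1 : ∀ s : ℝ, 0 < X.2 + s → HasDerivAt (fun s : ℝ =>
      P + γ * (X.2 + s - τ) ^ 2 - (P * E + μ) * (X.2 + s) ^ (2 * σ))
      (2 * γ * (X.2 + s - τ) - (P * E + μ) * (2 * σ * (X.2 + s) ^ (2 * σ - 1))) s := fun s hs => by
    have := (((((hlin X.2 s).sub_const τ).pow 2).const_mul γ).const_add P).sub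
      ((hpw (2 * σ) s hs).const_mul (P * E + μ))
    refine this.congr_deriv ?_
    simp
    ring
  have h2 : d2 (quadBar σ e z c N Q D E γ τ μ) X (0, 1) =
      2 * γ - (P * E + μ) * (2 * σ * ((2 * σ - 1) * X.2 ^ (2 * σ - 2))) := by
    refine d2_of_line hc (g' := fun s => 2 * γ * (X.2 + s - τ) -
      (P * E + μ) * (2 * σ * (X.2 + s) ^ (2 * σ - 1))) ?_ ?_
    · rw [hv]
      have : ∀ᶠ s : ℝ in 𝓝 0, 0 < X.2 + s :=
        (hlin X.2 0).continuousAt.eventually (lt_mem_nhds (by simpa using hX))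
      exact this.mono hd1
    · have := ((((hlin X.2 0).sub_const τ).const_mul (2 * γ))).sub
        (((hpw (2 * σ - 1) 0 (by simpa using hX)).const_mul (2 * σ)).const_mul (P * E + μ))
      refine this.congr_deriv ?_
      have : 2 * σ - 1 - 1 = 2 * σ - 2 := by ring
      simp [this]
  have h3 : dt (quadBar σ e z c N Q D E γ τ μ) X =
      2 * γ * (X.2 - τ) - (P * E + μ) * (2 * σ * X.2 ^ (2 * σ - 1)) := by
    refine dt_of_line hc ?_
    rw [hv]
    simpa using hd1 0 (by simpa using hX)
  have h4 : X.2 ^ (2 * σ - 1) = X.2 ^ (2 * σ - 2) * X.2 := by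
    rw [← Real.rpow_add_one hX.ne']; congr 1; ring
  have h5 : ∑ i : Fin n, 2 * (D - Q * e i ^ 2) * G = (2 * n * D - 2 * Q * ‖e‖ ^ 2) * G := by
    rw [← Finset.sum_mul, ← Finset.mul_sum, Finset.sum_sub_distrib, ← Finset.mul_sum, sum_sq_coord,
      Finset.sum_const, Finset.card_univ, Fintype.card_fin, nsmul_eq_mul]
    ring
  simp only [Lop, lapl, h1, h2, h3, h5, h4]
  field_simp
  ring

lemma hasQ_quadBar (hσ0 : 0 < σ) (hσ : σ < 1) (e z : EuclideanSpace ℝ (Fin n))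
    (c N Q D E γ μ : ℝ) (x : EuclideanSpace ℝ (Fin n)) :
    HasQ σ (quadBar σ e z c N Q D E γ 0 μ) x (-(E * quadP e z c N Q D x) - μ) := by
  have h := ((tendsto_sq_div_rpow hσ).const_mul γ).add_const (-(E * quadP e z c N Q D x) - μ)
  rw [mul_zero, zero_add] at h
  refine h.congr' ?_
  filter_upwards [self_mem_nhdsWithin] with t ht
  have ht' : (t : ℝ) ^ (2 * σ) ≠ 0 := (Real.rpow_pos_of_pos ht _).ne'
  have h0 : (0 : ℝ) ^ (2 * σ) = 0 := Real.zero_rpow (by linarith)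
  simp only [quadBar, h0]
  field_simp
  ring

lemma continuous_quadBar (hσ0 : 0 < σ) (e z : EuclideanSpace ℝ (Fin n))
    (c N Q D E γ τ μ : ℝ) : Continuous (quadBar σ e z c N Q D E γ τ μ) := by
  have h1 := (contDiff_quadP e z c N Q D).continuous
  have h2 : Continuous fun Y : Pt n => Y.2 ^ (2 * σ) :=
    continuous_snd.rpow_const fun _ => Or.inr (by linarith)
  unfold quadBar
  exact (((h1.comp continuous_fst).mul (continuous_const.sub (continuous_const.mul h2))).add
    (continuous_const.mul ((continuous_snd.sub continuous_const).pow 2))).sub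
    (continuous_const.mul h2)

end Barriers

section Solutions

variable {n : ℕ} {σ : ℝ} {U : Pt n → ℝ}

lemma enorm'_eq (X : Pt n) : enorm' X = √(nsq X) := rfl

lemma nsq_nonneg (X : Pt n) : 0 ≤ nsq X := by unfold nsq; positivity

lemma enorm'_nonneg (X : Pt n) : 0 ≤ enorm' X := Real.sqrt_nonneg _

lemma enorm'_sq (X : Pt n) : enorm' X ^ 2 = nsq X := Real.sq_sqrt (nsq_nonneg X)

lemma enorm'_add_le (X Y : Pt n) : enorm' (X + Y) ≤ enorm' X + enorm' Y := by
  have h : ∀ X : Pt n, enorm' X = ‖(WithLp.toLp 2 X : WithLp 2 (Pt n))‖ := fun X => by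
    rw [WithLp.prod_norm_eq_of_L2]; simp [enorm']
  rw [h, h, h]
  exact norm_add_le _ _

lemma enorm'_neg (X : Pt n) : enorm' (-X) = enorm' X := by simp [enorm']

lemma enorm'_sub_le (X Y : Pt n) : enorm' X ≤ enorm' (X - Y) + enorm' Y := by
  simpa using enorm'_add_le (X - Y) Y

lemma enorm'_sub_comm (X Y : Pt n) : enorm' (X - Y) = enorm' (Y - X) := by
  rw [← enorm'_neg, neg_sub]

lemma norm_fst_le (X : Pt n) : ‖X.1‖ ≤ enorm' X := by
  refine Real.le_sqrt_of_sq_le ?_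
  nlinarith [sq_nonneg X.2]

lemma abs_snd_le (X : Pt n) : |X.2| ≤ enorm' X := by
  refine Real.le_sqrt_of_sq_le ?_
  rw [sq_abs]
  nlinarith [sq_nonneg ‖X.1‖]

lemma enorm'_le_add (X : Pt n) : enorm' X ≤ ‖X.1‖ + |X.2| := by
  refine Real.sqrt_le_iff.mpr ⟨by positivity, ?_⟩
  have := mul_nonneg (norm_nonneg X.1) (abs_nonneg X.2)
  nlinarith [sq_abs X.2]

lemma enorm'_trace (x : EuclideanSpace ℝ (Fin n)) : enorm' ((x, 0) : Pt n) = ‖x‖ := by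
  simp [enorm']

lemma enorm'_le_iff {X : Pt n} {r : ℝ} (hr : 0 ≤ r) : enorm' X ≤ r ↔ nsq X ≤ r ^ 2 := by
  exact Real.sqrt_le_left hr

lemma enorm'_lt_iff {X : Pt n} {r : ℝ} (hr : 0 < r) : enorm' X < r ↔ nsq X < r ^ 2 := by
  rw [enorm'_eq, Real.sqrt_lt' hr]

lemma le_enorm'_iff {X : Pt n} {r : ℝ} (hr : 0 ≤ r) : r ≤ enorm' X ↔ r ^ 2 ≤ nsq X :=
  Real.le_sqrt hr (nsq_nonneg X)

lemma continuous_nsq : Continuous (nsq : Pt n → ℝ) := by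
  unfold nsq; fun_prop

lemma continuous_nsq_sub (Z : Pt n) : Continuous fun Y : Pt n => nsq (Y - Z) :=
  (contDiff_nsq_sub Z).continuous

lemma continuous_enorm' : Continuous (enorm' : Pt n → ℝ) := continuous_nsq.sqrt

lemma nsq_pos {X : Pt n} (h : X ≠ 0) : 0 < nsq X := by
  rcases (nsq_nonneg X).lt_or_eq with h1 | h1
  · exact h1
  · refine absurd ?_ h
    have h2 : ‖X.1‖ ^ 2 = 0 := by unfold nsq at h1; nlinarith [sq_nonneg ‖X.1‖, sq_nonneg X.2]
    have h3 : X.2 ^ 2 = 0 := by unfold nsq at h1; nlinarith [sq_nonneg ‖X.1‖, sq_nonneg X.2]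
    exact Prod.ext (by simpa using h2) (by simpa using h3)

lemma ne_zero_of_nsq_pos {X : Pt n} (h : 0 < nsq X) : X ≠ 0 := by
  rintro rfl; simp [nsq] at h

lemma isCompact_of_nsq_sub_le {C : Set (Pt n)} (hC : IsClosed C) (Z : Pt n) {r : ℝ}
    (h : ∀ Y ∈ C, nsq (Y - Z) ≤ r) : IsCompact C := by
  refine Metric.isCompact_of_isClosed_isBounded hC
    ((Metric.isBounded_closedBall (x := Z) (r := √r)).subset fun Y hY => ?_)
  have h1 : enorm' (Y - Z) ≤ √r := Real.sqrt_le_sqrt (h Y hY)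
  rw [Metric.mem_closedBall, dist_eq_norm, Prod.norm_def]
  exact max_le ((norm_fst_le _).trans h1) ((abs_snd_le _).trans h1)

/-- The critical decay exponent `(n - 2σ)/2`. -/
def expA (n : ℕ) (σ : ℝ) : ℝ := ((n : ℝ) - 2 * σ) / 2

/-- The exponent `(n + 2σ)/(n - 2σ)` of the nonlinear boundary condition. -/
def expP (n : ℕ) (σ : ℝ) : ℝ := ((n : ℝ) + 2 * σ) / ((n : ℝ) - 2 * σ)

/-- Pointwise reformulation of `ExtSol n σ 2 U`. -/
structure Sol (n : ℕ) (σ : ℝ) (U : Pt n → ℝ) : Prop where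
  hn : (2 : ℝ) ≤ n
  hσ0 : 0 < σ
  hσ1 : σ < 1
  nonneg : ∀ X : Pt n, nsq X ≤ 4 → 0 ≤ X.2 → X ≠ 0 → 0 ≤ U X
  cont : ContinuousOn U {X : Pt n | nsq X ≤ 4 ∧ 0 ≤ X.2 ∧ X ≠ 0}
  hasL : ∀ X : Pt n, nsq X < 4 → 0 < X.2 → HasL σ U X 0
  hasQ : ∀ x : EuclideanSpace ℝ (Fin n), ‖x‖ < 2 → x ≠ 0 →
    HasQ σ U x (-(U (x, 0) ^ expP n σ / (2 * σ)))

lemma ExtSol.sol (hn : 2 ≤ n) (hσ : σ ∈ Set.Ioo (0 : ℝ) 1) (hU : ExtSol n σ 2 U) :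
    Sol n σ U := by
  obtain ⟨h0, hc, hd, hL, hQ⟩ := hU
  have e1 : ∀ X : Pt n, enorm' X ≤ 2 ↔ nsq X ≤ 4 := fun X => by
    rw [enorm'_le_iff zero_le_two]; norm_num
  have e2 : ∀ X : Pt n, enorm' X < 2 ↔ nsq X < 4 := fun X => by
    rw [enorm'_lt_iff zero_lt_two]; norm_num
  have hcont : ContinuousOn U {X : Pt n | nsq X ≤ 4 ∧ 0 ≤ X.2 ∧ X ≠ 0} :=
    hc.mono fun X hX => ⟨⟨(e1 X).2 hX.1, hX.2.1⟩, hX.2.2⟩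
  have hopen : IsOpen {X : Pt n | enorm' X < 2 ∧ 0 < X.2} :=
    (isOpen_lt continuous_enorm' continuous_const).inter (isOpen_lt continuous_const continuous_snd)
  have hdiff : ∀ X : Pt n, enorm' X < 2 → 0 < X.2 → ContDiffAt ℝ 2 U X := fun X h1 h2 =>
    hd.contDiffAt (hopen.mem_nhds ⟨h1, h2⟩)
  refine ⟨by exact_mod_cast hn, hσ.1, hσ.2, fun X h1 => h0 X ((e1 X).2 h1), hcont,
    fun X h1 h2 => ⟨hdiff X ((e2 X).2 h1) h2, hL X ((e2 X).2 h1) h2⟩, fun x hx hx0 => ?_⟩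
  have hlt : ∀ᶠ t : ℝ in 𝓝[>] 0, enorm' ((x, t) : Pt n) < 2 := by
    have : ContinuousAt (fun t : ℝ => enorm' ((x, t) : Pt n)) 0 :=
      (continuous_enorm'.comp (by fun_prop : Continuous fun t : ℝ => ((x, t) : Pt n))).continuousAt
    refine (this.eventually (gt_mem_nhds ?_)).filter_mono nhdsWithin_le_nhds
    simpa only [enorm'_trace] using hx
  refine HasDerivAt.lhopital_zero_nhdsGT (f' := fun t => dt U (x, t))
    (g' := fun t => 2 * σ * t ^ (2 * σ - 1)) ?_ ?_ ?_ ?_ ?_ ?_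
  · filter_upwards [hlt, self_mem_nhdsWithin] with t h1 h2
    have h3 : HasFDerivAt U (fderiv ℝ U (x, t)) (x, t) :=
      ((hdiff _ h1 h2).differentiableAt (by norm_num)).hasFDerivAt
    have h4 : HasDerivAt (fun t : ℝ => ((x, t) : Pt n)) (0, 1) t :=
      (hasDerivAt_const t x).prodMk (hasDerivAt_id t)
    exact (h3.comp_hasDerivAt t h4).sub_const _
  · filter_upwards [self_mem_nhdsWithin] with t ht
    exact Real.hasDerivAt_rpow_const (Or.inl (ne_of_gt ht))
  · filter_upwards [self_mem_nhdsWithin] with t ht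
    have := Real.rpow_pos_of_pos (show 0 < t from ht) (2 * σ - 1)
    have := hσ.1
    positivity
  · have h1 : Tendsto (fun t : ℝ => U (x, t)) (𝓝[>] 0) (𝓝 (U (x, 0))) := by
      have h2 : ContinuousWithinAt U {X : Pt n | nsq X ≤ 4 ∧ 0 ≤ X.2 ∧ X ≠ 0} (x, 0) :=
        hcont _ ⟨(e1 _).1 (by rw [enorm'_trace]; exact hx.le), le_rfl, by simpa using hx0⟩
      refine h2.tendsto.comp (tendsto_nhdsWithin_iff.mpr ⟨?_, ?_⟩)
      · have : ContinuousAt (fun t : ℝ => ((x, t) : Pt n)) 0 := by fun_prop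
        exact this.tendsto.mono_left nhdsWithin_le_nhds
      · filter_upwards [hlt, self_mem_nhdsWithin] with t h3 h4
        exact ⟨(e1 _).1 h3.le, le_of_lt h4, by simp [hx0]⟩
    simpa using h1.sub_const (U (x, 0))
  · have : ContinuousAt (fun t : ℝ => t ^ (2 * σ)) 0 :=
      Real.continuousAt_rpow_const _ _ (Or.inr (by linarith [hσ.1]))
    have h := this.tendsto.mono_left (nhdsWithin_le_nhds (s := Set.Ioi 0))
    rwa [Real.zero_rpow (by linarith [hσ.1])] at h
  · have h := (hQ x hx hx0).div_const (2 * σ)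
    rw [neg_div] at h
    refine h.congr' ?_
    filter_upwards [self_mem_nhdsWithin] with t ht
    have ht' : (0 : ℝ) < t := ht
    have h1 : t ^ (1 - 2 * σ) = (t ^ (2 * σ - 1))⁻¹ := by
      rw [← Real.rpow_neg ht'.le]; congr 1; ring
    have h2 := Real.rpow_pos_of_pos ht' (2 * σ - 1)
    have := hσ.1
    rw [h1]
    field_simp

namespace Sol

lemma expA_pos (h : Sol n σ U) : 0 < expA n σ := by
  unfold expA; linarith [h.hn, h.hσ1]

lemma expA_mul_expP (h : Sol n σ U) : expA n σ * expP n σ = expA n σ + 2 * σ := by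
  have h1 : (n : ℝ) - 2 * σ ≠ 0 := by linarith [h.hn, h.hσ1]
  unfold expA expP
  field_simp
  ring

lemma one_lt_expP (h : Sol n σ U) : 1 < expP n σ := by
  have := h.expA_mul_expP
  have := h.expA_pos
  have := h.hσ0
  by_contra hle
  push Not at hle
  nlinarith

/-- Weak comparison principle on compact subsets of the half-ball. -/
lemma minPrinciple (h : Sol n σ U) {C : Set (Pt n)} (hC : IsCompact C) (h4 : ∀ X ∈ C, nsq X ≤ 4)
    {w : Pt n → ℝ} (hw : ContinuousOn w (C ∩ {X | 0 ≤ X.2}))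
    (hloc : ∀ X ∈ C, 0 ≤ X.2 → w X < 0 → C ∈ 𝓝 X ∧
      (0 < X.2 → ∃ c, HasL σ w X c ∧ c ≤ 0) ∧ (X.2 = 0 → ∃ l, HasQ σ w X.1 l ∧ l ≤ 0)) :
    ∀ X ∈ C, 0 ≤ X.2 → 0 ≤ w X := by
  have hσ0 := h.hσ0
  have hσ1 := h.hσ1
  have hpos : ∀ X ∈ C, 0 ≤ X.2 → 0 < quadBar σ 0 0 10 0 0 (-1) 0 (-1) 0 1 X := by
    intro X hX ht
    have h1 := h4 X hX
    unfold nsq at h1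
    have h2 : X.2 ≤ 2 := by nlinarith [sq_nonneg ‖X.1‖]
    have h3 : X.2 ^ (2 * σ) ≤ 4 := by
      calc X.2 ^ (2 * σ) ≤ 2 ^ (2 * σ) := Real.rpow_le_rpow ht h2 (by linarith)
        _ ≤ 2 ^ (2 : ℝ) := Real.rpow_le_rpow_of_exponent_le (by norm_num) (by linarith)
        _ = 4 := by norm_num
    simp only [quadBar, quadP, inner_zero_left, sub_zero]
    linarith
  refine comparison (σ := σ) hC hw (continuous_quadBar hσ0 _ _ _ _ _ _ _ _ _ _).continuousOn hpos
    fun X hX ht hneg => ?_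
  obtain ⟨h1, h2, h3⟩ := hloc X hX ht hneg
  refine ⟨h1, fun ht' => ?_, fun ht' => ?_⟩
  · obtain ⟨c, hc, hc0⟩ := h2 ht'
    refine ⟨c, _, hc, hasL_quadBar _ _ _ _ _ _ _ _ _ _ ht', hc0, ?_⟩
    have hn := h.hn
    have : (1 - 2 * σ) * (X.2 - 0) / X.2 = 1 - 2 * σ := by field_simp; ring
    rw [this]
    simp
    linarith
  · obtain ⟨l, hl, hl0⟩ := h3 ht'
    refine ⟨l, _, hl, hasQ_quadBar hσ0 hσ1 _ _ _ _ _ _ _ _ _ _, ?_⟩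
    have := hpos X hX ht
    simp only [zero_mul, neg_zero, zero_sub, mul_neg, mul_one]
    nlinarith

lemma hasL_radial_trace (z : EuclideanSpace ℝ (Fin n)) {X : Pt n} (hX : 0 < X.2) :
    HasL σ (radial (z, 0) (expA n σ)) X 0 := by
  have h1 : 0 < nsq (X - (z, 0)) := by
    have := sq_nonneg ‖(X - (z, 0)).1‖
    have : (X - (z, 0)).2 = X.2 := by simp
    unfold nsq; rw [this]; positivity
  refine (hasL_radial (expA n σ) h1).of_eq ?_
  unfold expA
  field_simp
  ring

lemma rpow_le_rpow_neg {x y β : ℝ} (hx : 0 < x) (hxy : x ≤ y) (hβ : 0 ≤ β) :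
    y ^ (-β) ≤ x ^ (-β) :=
  Real.rpow_le_rpow_of_nonpos hx hxy (by linarith)

lemma rpow_mul_rpow_neg {x : ℝ} (hx : 0 < x) (β : ℝ) : x ^ β * x ^ (-β) = 1 := by
  rw [← Real.rpow_add hx]; simp

lemma eventually_const_lt' {f : Pt n → ℝ} (hf : Continuous f) {c : ℝ} {X : Pt n} (h : c < f X) :
    ∀ᶠ Y in 𝓝 X, c < f Y := hf.continuousAt.eventually (lt_mem_nhds h)

lemma eventually_lt_const' {f : Pt n → ℝ} (hf : Continuous f) {c : ℝ} {X : Pt n} (h : f X < c) :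
    ∀ᶠ Y in 𝓝 X, f Y < c := hf.continuousAt.eventually (gt_mem_nhds h)

lemma hasQ_trace (h : Sol n σ U) {X : Pt n} (h4 : nsq X < 4) (h0 : X ≠ 0) (ht : X.2 = 0) :
    HasQ σ U X.1 (-(U X ^ expP n σ / (2 * σ))) := by
  have hX : X = (X.1, 0) := Prod.ext rfl ht
  have h1 : X.1 ≠ 0 := fun h1 => h0 (Prod.ext h1 ht)
  have h2 : ‖X.1‖ < 2 := by
    unfold nsq at h4; rw [ht] at h4
    nlinarith [norm_nonneg X.1]
  have := h.hasQ X.1 h2 h1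
  rwa [← hX] at this

lemma rpow_div_nonneg (h : Sol n σ U) {X : Pt n} (h4 : nsq X ≤ 4) (h0 : X ≠ 0) (ht : 0 ≤ X.2) :
    0 ≤ U X ^ expP n σ / (2 * σ) :=
  div_nonneg (Real.rpow_nonneg (h.nonneg X h4 ht h0) _) (by linarith [h.hσ0])

/-- A lower bound on a half-sphere centred on the trace propagates outwards. -/
lemma spread (h : Sol n σ U) {x₁ : EuclideanSpace ℝ (Fin n)} {S R m : ℝ} (hS : 0 < S)
    (hm : 0 ≤ m) (hR : ∀ Y : Pt n, nsq (Y - (x₁, 0)) ≤ R → nsq Y < 4)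
    (hb : ∀ Y : Pt n, 0 ≤ Y.2 → Y ≠ 0 → nsq (Y - (x₁, 0)) = S → m ≤ U Y)
    {Y : Pt n} (hY : 0 ≤ Y.2) (hY0 : Y ≠ 0) (hYS : S ≤ nsq (Y - (x₁, 0)))
    (hYR : nsq (Y - (x₁, 0)) ≤ R) :
    m * S ^ expA n σ * (nsq (Y - (x₁, 0)) ^ (-expA n σ) - R ^ (-expA n σ)) ≤ U Y := by
  set a := expA n σ with ha
  have ha0 : 0 < a := h.expA_pos
  have hR0 : 0 < R := hS.trans_le (hYS.trans hYR)
  have hSa : 0 < S ^ a := Real.rpow_pos_of_pos hS a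
  have key : ∀ η : ℝ, 0 < η → m * S ^ a * (radial (x₁, 0) a Y - R ^ (-a)) ≤
      U Y + η * nsq Y ^ (-a) := by
    intro η hη
    obtain ⟨r, hr0, hrY, hrm⟩ : ∃ r : ℝ, 0 < r ∧ r ≤ nsq Y ∧ m ≤ η * r ^ (-a) := by
      have h1 := (tendsto_rpow_neg_nhdsGT_zero (y := -a) (by linarith)).eventually_ge_atTop (m / η)
      have h2 : ∀ᶠ r : ℝ in 𝓝[>] 0, r ≤ nsq Y :=
        nhdsWithin_le_nhds (Iic_mem_nhds (nsq_pos hY0))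
      obtain ⟨r, h3, h4, h5⟩ := (h1.and (h2.and self_mem_nhdsWithin)).exists
      exact ⟨r, h5, h4, by rwa [div_le_iff₀' hη] at h3⟩
    set C : Set (Pt n) := {X | S ≤ nsq (X - (x₁, 0)) ∧ nsq (X - (x₁, 0)) ≤ R ∧ r ≤ nsq X} with hC
    have hCc : IsCompact C := isCompact_of_nsq_sub_le
      ((isClosed_le continuous_const (continuous_nsq_sub _)).inter
        ((isClosed_le (continuous_nsq_sub _) continuous_const).inter
          (isClosed_le continuous_const continuous_nsq))) (x₁, 0) (r := R) fun X hX => hX.2.1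
    have hne : ∀ X ∈ C, X ≠ 0 := fun X hX => ne_zero_of_nsq_pos (hr0.trans_le hX.2.2)
    have hw := h.minPrinciple hCc (fun X hX => (hR X hX.2.1).le)
      (w := fun X => U X - m * S ^ a * (radial (x₁, 0) a X - R ^ (-a)) + η * radial (0, 0) a X)
      (((h.cont.mono fun X hX => ⟨(hR X hX.1.2.1).le, hX.2, hne X hX.1⟩).sub
        (continuousOn_const.mul ((continuousOn_radial _ _ fun X hX => hS.trans_le hX.1.1).sub
          continuousOn_const))).add (continuousOn_const.mul (continuousOn_radial _ _ fun X hX =>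
            nsq_pos (by simpa [← Prod.zero_eq_mk] using hne X hX.1)))) ?_ Y ⟨hYS, hYR, hrY⟩ hY
    · simp only [radial, ← Prod.zero_eq_mk, sub_zero] at hw ⊢
      linarith
    · intro X hX ht hneg
      have hX4 := hR X hX.2.1
      have hU0 := h.nonneg X hX4.le ht (hne X hX)
      have hrad : 0 ≤ η * radial (0, 0) a X := mul_nonneg hη.le (Real.rpow_nonneg (nsq_nonneg _) _)
      have hkm : m * S ^ a * (radial (x₁, 0) a X - R ^ (-a)) ≤ m := by
        have h1 : radial (x₁, 0) a X ≤ S ^ (-a) := rpow_le_rpow_neg hS hX.1 ha0.le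
        have h2 : 0 < R ^ (-a) := Real.rpow_pos_of_pos hR0 _
        calc m * S ^ a * (radial (x₁, 0) a X - R ^ (-a)) ≤ m * S ^ a * S ^ (-a) := by gcongr; linarith
          _ = m := by rw [mul_assoc, rpow_mul_rpow_neg hS, mul_one]
      have hXS : S < nsq (X - (x₁, 0)) := hX.1.lt_of_ne fun e => by
        have := hb X ht (hne X hX) e.symm
        linarith
      have hXR : nsq (X - (x₁, 0)) < R := hX.2.1.lt_of_ne fun e => by
        simp only [radial, e, sub_self, mul_zero, sub_zero] at hneg
        simp only [radial] at hrad
        linarith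
      have hXr : r < nsq X := hX.2.2.lt_of_ne fun e => by
        have : radial (0, 0) a X = r ^ (-a) := by
          simp only [radial, ← Prod.zero_eq_mk, sub_zero, e]
        rw [this] at hneg
        linarith
      refine ⟨?_, fun ht' => ⟨_, ((h.hasL X hX4 ht').sub (((hasL_radial_trace x₁ ht').sub
        (HasL.const (R ^ (-a)))).const_mul (m * S ^ a))).add
        ((hasL_radial_trace 0 ht').const_mul η), by simp⟩, fun ht' => ?_⟩
      · filter_upwards [eventually_const_lt' (continuous_nsq_sub _) hXS,
          eventually_lt_const' (continuous_nsq_sub _) hXR,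
          eventually_const_lt' continuous_nsq hXr] with Z h1 h2 h3
        exact ⟨h1.le, h2.le, h3.le⟩
      · have hx1 : X.1 ≠ x₁ := fun e => by
          have : X - (x₁, 0) = 0 := by rw [sub_eq_zero]; exact Prod.ext e ht'
          rw [this] at hXS
          simp [nsq] at hXS; linarith
        have hx0 : X.1 ≠ 0 := fun e => hne X hX (Prod.ext e ht')
        refine ⟨_, ((h.hasQ_trace hX4 (hne X hX) ht').sub
          (((hasQ_radial h.hσ1 a hx1).sub (HasQ.const (R ^ (-a)))).const_mul (m * S ^ a))).add
          ((hasQ_radial h.hσ1 a hx0).const_mul η), ?_⟩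
        have := h.rpow_div_nonneg hX4.le (hne X hX) ht
        simp
        linarith
  refine le_of_forall_pos_le_add fun ε hε => ?_
  have h1 : 0 < nsq Y ^ (-a) := Real.rpow_pos_of_pos (nsq_pos hY0) _
  have := key (ε / nsq Y ^ (-a)) (by positivity)
  rwa [div_mul_cancel₀ _ h1.ne'] at this

end Sol

end Solutions

section LowerBounds

variable {n : ℕ} {σ : ℝ} {U : Pt n → ℝ}

/-- The aspect parameter `(1 - σ)/n`. -/
def aspect (n : ℕ) (σ : ℝ) : ℝ := (1 - σ) / n

lemma HasL.quadBar_zero (e z : EuclideanSpace ℝ (Fin n)) (c N Q D E γ μ : ℝ) {X : Pt n}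
    (hX : 0 < X.2) :
    HasL σ (quadBar σ e z c N Q D E γ 0 μ) X
      ((2 * n * D - 2 * Q * ‖e‖ ^ 2) * (1 - E * X.2 ^ (2 * σ)) + 4 * (1 - σ) * γ) := by
  refine (hasL_quadBar e z c N Q D E γ 0 μ hX).of_eq ?_
  field_simp
  ring

namespace Sol

lemma aspect_pos (h : Sol n σ U) : 0 < aspect n σ :=
  div_pos (by linarith [h.hσ1]) (by linarith [h.hn])

lemma aspect_le (h : Sol n σ U) : aspect n σ ≤ 1 / 2 := by
  have := h.hn
  unfold aspect
  rw [div_le_iff₀ (by linarith)]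
  linarith [h.hσ0]

lemma aspect_mul (h : Sol n σ U) : aspect n σ * n = 1 - σ := by
  have : (n : ℝ) ≠ 0 := by linarith [h.hn]
  unfold aspect
  field_simp

/-- A barrier that lies below a solution at the boundary lies below it everywhere. -/
lemma lowerBarrier (h : Sol n σ U) {C : Set (Pt n)} (hC : IsCompact C)
    (hdom : ∀ X ∈ C, 0 ≤ X.2 → X ≠ 0) (h4 : ∀ X ∈ C, nsq X < 4) {k : Pt n → ℝ}
    (hk : ContinuousOn k (C ∩ {X | 0 ≤ X.2}))
    (hloc : ∀ X ∈ C, 0 ≤ X.2 → U X < k X → C ∈ 𝓝 X ∧ (0 < X.2 → ∃ c, HasL σ k X c ∧ 0 ≤ c) ∧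
      (X.2 = 0 → ∃ l, HasQ σ k X.1 l ∧ -(U X ^ expP n σ / (2 * σ)) ≤ l)) :
    ∀ X ∈ C, 0 ≤ X.2 → k X ≤ U X := by
  have := h.minPrinciple hC (fun X hX => (h4 X hX).le) (w := fun X => U X - k X)
    ((h.cont.mono fun X hX => ⟨(h4 X hX.1).le, hX.2, hdom X hX.1 hX.2⟩).sub hk)
    fun X hX ht hneg => ?_
  · intro X hX ht
    linarith [this X hX ht]
  · obtain ⟨h1, h2, h3⟩ := hloc X hX ht (by linarith)
    refine ⟨h1, fun ht' => ?_, fun ht' => ?_⟩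
    · obtain ⟨c, hc, hc0⟩ := h2 ht'
      exact ⟨_, (h.hasL X (h4 X hX) ht').sub hc, by linarith⟩
    · obtain ⟨l, hl, hl0⟩ := h3 ht'
      exact ⟨_, (h.hasQ_trace (h4 X hX) (hdom X hX ht) ht').sub hl, by linarith⟩

lemma isCompact_cylinder (z : EuclideanSpace ℝ (Fin n)) (r τ : ℝ) :
    IsCompact {X : Pt n | ‖X.1 - z‖ ≤ r ∧ -τ ≤ X.2 ∧ X.2 ≤ τ} := by
  have : {X : Pt n | ‖X.1 - z‖ ≤ r ∧ -τ ≤ X.2 ∧ X.2 ≤ τ} =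
      Metric.closedBall z r ×ˢ Set.Icc (-τ) τ := by
    ext X
    simp [dist_eq_norm]
  rw [this]
  exact (isCompact_closedBall z r).prod isCompact_Icc

lemma cylinder_mem_nhds {z : EuclideanSpace ℝ (Fin n)} {r τ : ℝ} {X : Pt n}
    (h1 : ‖X.1 - z‖ < r) (h2 : 0 ≤ X.2) (h3 : X.2 < τ) :
    {X : Pt n | ‖X.1 - z‖ ≤ r ∧ -τ ≤ X.2 ∧ X.2 ≤ τ} ∈ 𝓝 X := by
  filter_upwards [eventually_lt_const' (f := fun X : Pt n => ‖X.1 - z‖) (by fun_prop) h1,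
    eventually_lt_const' (f := fun X : Pt n => X.2) (by fun_prop) h3,
    eventually_const_lt' (f := fun X : Pt n => X.2) (c := -τ) (by fun_prop) (by linarith)]
    with Y h1 h2 h3
  exact ⟨h1.le, h3.le, h2.le⟩

/-- A lower bound on a horizontal disc propagates down to the trace. -/
lemma disc_to_trace (h : Sol n σ U) {z : EuclideanSpace ℝ (Fin n)} {r τ m : ℝ} (hr : 0 < r)
    (hm : 0 ≤ m) (hτ : τ ^ 2 ≤ aspect n σ * r ^ 2) (hrz : r < ‖z‖)
    (h4 : ∀ Y : Pt n, ‖Y.1 - z‖ ≤ r → |Y.2| ≤ τ → nsq Y < 4)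
    (hb : ∀ y : EuclideanSpace ℝ (Fin n), ‖y - z‖ ≤ r → m ≤ U (y, τ))
    {Y : Pt n} (hY : ‖Y.1 - z‖ ≤ r / 2) (hY0 : 0 ≤ Y.2) (hYτ : Y.2 ≤ τ) : m / 4 ≤ U Y := by
  have hν := h.aspect_pos
  set ν := aspect n σ with hνdef
  have hνn : ν * n = 1 - σ := h.aspect_mul
  have hform : ∀ X : Pt n, quadBar σ 0 z (m / 2) 0 0 (-(m / r ^ 2)) 0 (m / (2 * ν * r ^ 2)) 0 0 X =
      (m / r ^ 2) * (r ^ 2 / 2 - ‖X.1 - z‖ ^ 2 + X.2 ^ 2 / (2 * ν)) := fun X => by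
    simp only [quadBar, quadP, inner_zero_left]
    field_simp
    ring
  have hmr : 0 ≤ m / r ^ 2 := by positivity
  have hne : ∀ X : Pt n, ‖X.1 - z‖ ≤ r → X ≠ 0 := by
    rintro X hX rfl
    simp at hX
    linarith
  have key := h.lowerBarrier (isCompact_cylinder z r τ) (fun X hX _ => hne X hX.1)
    (fun X hX => h4 X hX.1 (abs_le.mpr hX.2))
    (k := quadBar σ 0 z (m / 2) 0 0 (-(m / r ^ 2)) 0 (m / (2 * ν * r ^ 2)) 0 0)
    (continuous_quadBar h.hσ0 _ _ _ _ _ _ _ _ _ _).continuousOn ?_ Y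
    ⟨hY.trans (by linarith), by linarith, hYτ⟩ hY0
  · refine le_trans ?_ key
    rw [hform]
    have h1 : ‖Y.1 - z‖ ^ 2 ≤ r ^ 2 / 4 := by
      have := pow_le_pow_left₀ (norm_nonneg _) hY 2
      linarith
    have h2 : 0 ≤ Y.2 ^ 2 / (2 * ν) := by positivity
    calc m / 4 = (m / r ^ 2) * (r ^ 2 / 4) := by field_simp
      _ ≤ _ := by gcongr; linarith
  · intro X hX ht hlt
    have hX4 := h4 X hX.1 (abs_le.mpr hX.2)
    have hU := h.nonneg X hX4.le ht (hne X hX.1)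
    have hτ' : X.2 ^ 2 / (2 * ν) ≤ r ^ 2 / 2 := by
      rw [div_le_iff₀ (by positivity)]
      have := pow_le_pow_left₀ ht hX.2.2 2
      nlinarith
    have h1 : ‖X.1 - z‖ < r := hX.1.lt_of_ne fun e => by
      rw [hform, e] at hlt
      have : (m / r ^ 2) * (r ^ 2 / 2 - r ^ 2 + X.2 ^ 2 / (2 * ν)) ≤ 0 :=
        mul_nonpos_of_nonneg_of_nonpos hmr (by linarith)
      linarith
    have h2 : X.2 < τ := hX.2.2.lt_of_ne fun e => by
      have h3 := hb X.1 hX.1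
      rw [← e] at h3
      rw [hform] at hlt
      have : (m / r ^ 2) * (r ^ 2 / 2 - ‖X.1 - z‖ ^ 2 + X.2 ^ 2 / (2 * ν)) ≤ (m / r ^ 2) * r ^ 2 := by
        gcongr
        nlinarith [sq_nonneg ‖X.1 - z‖]
      rw [div_mul_cancel₀ _ (by positivity)] at this
      exact absurd hlt (not_lt.mpr (this.trans h3))
    refine ⟨cylinder_mem_nhds h1 ht h2, fun ht' => ⟨_, HasL.quadBar_zero _ _ _ _ _ _ _ _ _ ht', ?_⟩,
      fun ht' => ⟨_, hasQ_quadBar h.hσ0 h.hσ1 _ _ _ _ _ _ _ _ _ _, ?_⟩⟩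
    · refine le_of_eq ?_
      rw [← hνn]
      field_simp
      ring
    · have := h.rpow_div_nonneg hX4.le (hne X hX.1) ht
      simp only [zero_mul, neg_zero, sub_zero]
      linarith

/-- The constant in `hopf`. -/
def hopfC (n : ℕ) (σ : ℝ) : ℝ := aspect n σ ^ σ / (4 * σ)

lemma hopfC_pos (h : Sol n σ U) : 0 < hopfC n σ :=
  div_pos (Real.rpow_pos_of_pos h.aspect_pos _) (by linarith [h.hσ0])

/-- Quantitative Hopf lemma: the nonlinear flux forces a lower bound at the centre. -/
lemma hopf (h : Sol n σ U) {z : EuclideanSpace ℝ (Fin n)} {r m : ℝ} (hr : 0 < r)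
    (hm : 0 ≤ m) (hrz : r < ‖z‖)
    (h4 : ∀ Y : Pt n, ‖Y.1 - z‖ ≤ r → |Y.2| ≤ r → nsq Y < 4)
    (hb : ∀ y : EuclideanSpace ℝ (Fin n), ‖y - z‖ ≤ r → m ≤ U (y, 0)) :
    hopfC n σ * m ^ expP n σ * r ^ (2 * σ) ≤ U (z, 0) := by
  have hν := h.aspect_pos
  have hν2 := h.aspect_le
  have hσ0 := h.hσ0
  have hσ1 := h.hσ1
  unfold hopfC
  set ν := aspect n σ with hνdef
  have hνn : ν * n = 1 - σ := h.aspect_mul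
  set θ := √ν with hθ
  have hθ0 : 0 < θ := Real.sqrt_pos.mpr hν
  have hθ2 : θ ^ 2 = ν := Real.sq_sqrt hν.le
  have hθ1 : θ ≤ 1 := by nlinarith
  have hθσ : θ ^ (2 * σ) = ν ^ σ := by
    rw [Real.rpow_mul hθ0.le, Real.rpow_two, hθ2]
  set μ := m ^ expP n σ / (2 * σ) with hμ
  have hμ0 : 0 ≤ μ := div_nonneg (Real.rpow_nonneg hm _) (by linarith)
  set c := ν ^ σ / 2 with hc
  have hc0 : 0 < c := by rw [hc]; have := Real.rpow_pos_of_pos hν σ; positivity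
  set L := r ^ (2 * σ) with hL
  have hL0 : 0 < L := Real.rpow_pos_of_pos hr _
  have hform : ∀ X : Pt n, quadBar σ 0 z (μ * (c * L)) 0 0 (-(μ * (2 * c * L / r ^ 2))) 0
      (μ * (c * L / (ν * r ^ 2))) 0 μ X =
      μ * (c * L - 2 * c * L * (‖X.1 - z‖ ^ 2 / r ^ 2) + c * L * (X.2 ^ 2 / (ν * r ^ 2)) -
        X.2 ^ (2 * σ)) := fun X => by
    simp only [quadBar, quadP, inner_zero_left]
    field_simp
    ring
  have hne : ∀ X : Pt n, ‖X.1 - z‖ ≤ r → X ≠ 0 := by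
    rintro X hX rfl
    simp at hX
    linarith
  have hθr : θ * r ≤ r := by nlinarith
  have key := h.lowerBarrier (isCompact_cylinder z r (θ * r)) (fun X hX _ => hne X hX.1)
    (fun X hX => h4 X hX.1 ((abs_le.mpr hX.2).trans hθr))
    (k := quadBar σ 0 z (μ * (c * L)) 0 0 (-(μ * (2 * c * L / r ^ 2))) 0
      (μ * (c * L / (ν * r ^ 2))) 0 μ)
    (continuous_quadBar h.hσ0 _ _ _ _ _ _ _ _ _ _).continuousOn ?_ (z, 0)
    ⟨by simpa using hr.le, by simpa using (by positivity : 0 ≤ θ * r), by positivity⟩ le_rfl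
  · refine le_trans (le_of_eq ?_) key
    rw [hform]
    have : (0 : ℝ) ^ (2 * σ) = 0 := Real.zero_rpow (by linarith)
    simp only [this, sub_self, norm_zero, hμ, hc]
    field_simp
    ring
  · intro X hX ht hlt
    have hX4 := h4 X hX.1 ((abs_le.mpr hX.2).trans hθr)
    have hU := h.nonneg X hX4.le ht (hne X hX.1)
    have hp0 : 0 ≤ X.2 ^ (2 * σ) := Real.rpow_nonneg ht _
    have hτ' : X.2 ^ 2 / (ν * r ^ 2) ≤ 1 := by
      rw [div_le_one (by positivity), ← hθ2, ← mul_pow]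
      exact pow_le_pow_left₀ ht hX.2.2 2
    have hcL : 0 < c * L := by positivity
    have h1 : ‖X.1 - z‖ < r := hX.1.lt_of_ne fun e => by
      rw [hform, e, div_self (by positivity)] at hlt
      have : μ * (c * L - 2 * c * L * 1 + c * L * (X.2 ^ 2 / (ν * r ^ 2)) - X.2 ^ (2 * σ)) ≤ 0 :=
        mul_nonpos_of_nonneg_of_nonpos hμ0 (by nlinarith)
      linarith
    have h2 : X.2 < θ * r := hX.2.2.lt_of_ne fun e => by
      have h3 : X.2 ^ (2 * σ) = 2 * c * L := by
        rw [e, Real.mul_rpow hθ0.le hr.le, hθσ, hc, hL]; ring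
      rw [hform, h3] at hlt
      have h5 : 0 ≤ ‖X.1 - z‖ ^ 2 / r ^ 2 := by positivity
      have : μ * (c * L - 2 * c * L * (‖X.1 - z‖ ^ 2 / r ^ 2) + c * L * (X.2 ^ 2 / (ν * r ^ 2)) -
          2 * c * L) ≤ 0 :=
        mul_nonpos_of_nonneg_of_nonpos hμ0 (by nlinarith)
      linarith
    refine ⟨cylinder_mem_nhds h1 ht h2, fun ht' => ⟨_, HasL.quadBar_zero _ _ _ _ _ _ _ _ _ ht', ?_⟩,
      fun ht' => ⟨_, hasQ_quadBar h.hσ0 h.hσ1 _ _ _ _ _ _ _ _ _ _, ?_⟩⟩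
    · refine le_of_eq ?_
      rw [← hνn]
      field_simp
      ring
    · have h6 : m ≤ U X := by
        have := hb X.1 hX.1
        rwa [← ht', Prod.mk.eta] at this
      have : μ ≤ U X ^ expP n σ / (2 * σ) := by
        have := Real.rpow_le_rpow hm h6 (by linarith [h.one_lt_expP] : 0 ≤ expP n σ)
        rw [hμ]
        gcongr
      simp only [zero_mul, neg_zero]
      linarith

/-- A lower bound on part of a sphere propagates outwards in the interior. -/
lemma interior_spread (h : Sol n σ U) {Z : Pt n} {S R τ m A β : ℝ} (hS : 0 < S) (hm : 0 ≤ m)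
    (hβ0 : 0 ≤ β) (hβ : n + 1 + A ≤ 2 * (β + 1))
    (hdom : ∀ Y : Pt n, nsq (Y - Z) ≤ R → Y.2 ≤ τ →
      S ≤ nsq (Y - Z) → nsq Y < 4 ∧ 0 < Y.2 ∧ |Y.2 - Z.2| ≤ A * Y.2)
    (hb : ∀ Y : Pt n, nsq (Y - Z) = S → Y.2 ≤ τ → m ≤ U Y)
    (hb' : ∀ Y : Pt n, nsq (Y - Z) ≤ R → S ≤ nsq (Y - Z) → Y.2 = τ → m ≤ U Y)
    {Y : Pt n} (hYS : S ≤ nsq (Y - Z)) (hYR : nsq (Y - Z) ≤ R) (hYτ : Y.2 ≤ τ) :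
    m * S ^ β * (nsq (Y - Z) ^ (-β) - R ^ (-β)) ≤ U Y := by
  have hσ0 := h.hσ0
  have hσ1 := h.hσ1
  have hR0 : 0 < R := hS.trans_le (hYS.trans hYR)
  have hSb : 0 < S ^ β := Real.rpow_pos_of_pos hS β
  set C : Set (Pt n) := {X | S ≤ nsq (X - Z) ∧ nsq (X - Z) ≤ R ∧ X.2 ≤ τ} with hC
  have hCc : IsCompact C := isCompact_of_nsq_sub_le
    ((isClosed_le continuous_const (continuous_nsq_sub _)).inter
      ((isClosed_le (continuous_nsq_sub _) continuous_const).inter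
        (isClosed_le continuous_snd continuous_const))) Z (r := R) fun X hX => hX.2.1
  have hD : ∀ X ∈ C, nsq X < 4 ∧ 0 < X.2 ∧ |X.2 - Z.2| ≤ A * X.2 := fun X hX =>
    hdom X hX.2.1 hX.2.2 hX.1
  have hne : ∀ X ∈ C, X ≠ 0 := by
    rintro X hX rfl
    simpa using (hD _ hX).2.1
  refine h.lowerBarrier hCc (fun X hX _ => hne X hX) (fun X hX => (hD X hX).1)
    (k := fun X => m * S ^ β * (radial Z β X - R ^ (-β)))
    (continuousOn_const.mul ((continuousOn_radial _ _ fun X hX => hS.trans_le hX.1.1).sub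
      continuousOn_const)) ?_ Y ⟨hYS, hYR, hYτ⟩ (hD Y ⟨hYS, hYR, hYτ⟩).2.1.le
  intro X hX _ hlt
  obtain ⟨hX4, ht, hA⟩ := hD X hX
  have hU0 := h.nonneg X hX4.le ht.le (hne X hX)
  have hkm : m * S ^ β * (radial Z β X - R ^ (-β)) ≤ m := by
    have h1 : radial Z β X ≤ S ^ (-β) := rpow_le_rpow_neg hS hX.1 hβ0
    have h2 : 0 < R ^ (-β) := Real.rpow_pos_of_pos hR0 _
    calc m * S ^ β * (radial Z β X - R ^ (-β)) ≤ m * S ^ β * S ^ (-β) := by gcongr; linarith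
      _ = m := by rw [mul_assoc, rpow_mul_rpow_neg hS, mul_one]
  have hXS : S < nsq (X - Z) := hX.1.lt_of_ne fun e => by
    have := hb X e.symm hX.2.2
    linarith
  have hXR : nsq (X - Z) < R := hX.2.1.lt_of_ne fun e => by
    simp only [radial, e, sub_self, mul_zero] at hlt
    linarith
  have hXτ : X.2 < τ := hX.2.2.lt_of_ne fun e => by
    have := hb' X hX.2.1 hX.1 e
    linarith
  have hXp : 0 < nsq (X - Z) := hS.trans hXS
  refine ⟨?_, fun _ => ⟨_, ((hasL_radial β hXp).sub (HasL.const (R ^ (-β)))).const_mul (m * S ^ β),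
    ?_⟩, fun ht' => absurd ht' ht.ne'⟩
  · filter_upwards [eventually_const_lt' (continuous_nsq_sub _) hXS,
      eventually_lt_const' (continuous_nsq_sub _) hXR,
      eventually_lt_const' (f := fun X : Pt n => X.2) continuous_snd hXτ] with Y h1 h2 h3
    exact ⟨h1.le, h2.le, h3.le⟩
  · have h1 : (1 - 2 * σ) * (X.2 - Z.2) / X.2 ≤ A := by
      rw [div_le_iff₀ ht]
      have h2 : |(1 - 2 * σ)| ≤ 1 := abs_le.mpr ⟨by linarith, by linarith⟩
      calc (1 - 2 * σ) * (X.2 - Z.2) ≤ |(1 - 2 * σ) * (X.2 - Z.2)| := le_abs_self _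
        _ = |1 - 2 * σ| * |X.2 - Z.2| := abs_mul _ _
        _ ≤ 1 * |X.2 - Z.2| := by gcongr
        _ ≤ A * X.2 := by rw [one_mul]; exact hA
    have h3 : 0 < nsq (X - Z) ^ (-β - 1) := Real.rpow_pos_of_pos hXp _
    have h4 : 0 ≤ 2 * (β + 1) - (n + 1) - (1 - 2 * σ) * (X.2 - Z.2) / X.2 := by linarith
    rw [sub_zero]
    positivity

end Sol

end LowerBounds

section Reflection

variable {n : ℕ} {σ : ℝ} {U : Pt n → ℝ}

/-- Reflection in the vertical hyperplane through `z` orthogonal to the unit vector `e`. -/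
def hrefl (e z : EuclideanSpace ℝ (Fin n)) (X : Pt n) : Pt n :=
  (X.1 - (2 * ⟪e, X.1 - z⟫) • e, X.2)

lemma continuous_hrefl (e z : EuclideanSpace ℝ (Fin n)) : Continuous (hrefl e z) := by
  unfold hrefl; fun_prop

lemma contDiff_hrefl (e z : EuclideanSpace ℝ (Fin n)) : ContDiff ℝ 2 (hrefl e z) := by
  have h1 : ContDiff ℝ 2 fun X : Pt n => ⟪e, X.1 - z⟫ :=
    contDiff_const.inner ℝ (contDiff_fst.sub contDiff_const)
  exact (contDiff_fst.sub ((contDiff_const.mul h1).smul contDiff_const)).prodMk contDiff_snd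

lemma hrefl_line (e z : EuclideanSpace ℝ (Fin n)) (X v : Pt n) (s : ℝ) :
    hrefl e z (X + s • v) = hrefl e z X + s • (v - (2 * ⟪e, v.1⟫) • ((e, 0) : Pt n)) := by
  refine Prod.ext ?_ (by simp [hrefl])
  simp only [hrefl, Prod.fst_add, Prod.smul_fst, Prod.fst_sub]
  rw [show X.1 + s • v.1 - z = (X.1 - z) + s • v.1 by abel, inner_add_right, inner_smul_right]
  module

lemma HasL.comp_hrefl {e z : EuclideanSpace ℝ (Fin n)} (he : ‖e‖ = 1) {X : Pt n} {c : ℝ}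
    (h : HasL σ U (hrefl e z X) c) : HasL σ (fun Y => U (hrefl e z Y)) X c := by
  have hc : ContDiffAt ℝ 2 (fun Y => U (hrefl e z Y)) X :=
    h.1.comp X (contDiff_hrefl e z).contDiffAt
  have hd : ∀ v : Pt n, d2 (fun Y => U (hrefl e z Y)) X v =
      d2 U (hrefl e z X) (v - (2 * ⟪e, v.1⟫) • ((e, 0) : Pt n)) := fun v => by
    refine d2_of_line hc ?_ (hasDerivAt_fderiv_line h.1 _)
    simp only [hrefl_line]
    exact eventually_hasDerivAt_line h.1 _
  have hdt : dt (fun Y => U (hrefl e z Y)) X = dt U (hrefl e z X) := by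
    refine dt_of_line hc ?_
    simp only [hrefl_line]
    have := (eventually_hasDerivAt_line h.1 (0, 1)).self_of_nhds
    simpa [dt] using this
  refine ⟨hc, ?_⟩
  rw [← h.2, Lop, Lop, hdt]
  have hs : (hrefl e z X).2 = X.2 := rfl
  rw [hs]
  congr 1
  unfold lapl
  simp only [hd]
  congr 1
  · set B := fderiv ℝ (fderiv ℝ U) (hrefl e z X) with hB
    simp only [d2_eq h.1, ← hB]
    set f : Fin n → Pt n := fun i => (EuclideanSpace.single i (1 : ℝ), (0 : ℝ)) with hf
    have h1 : ∀ i, ⟪e, (EuclideanSpace.single i (1 : ℝ))⟫ = e i := fun i => by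
      rw [EuclideanSpace.inner_single_right]; simp
    have h2 : ∑ i, e i • f i = (e, 0) := by
      have h3 : ∑ i, e i • EuclideanSpace.single i (1 : ℝ) = e := by
        simpa using (EuclideanSpace.basisFun (Fin n) ℝ).sum_repr e
      refine Prod.ext ?_ ?_
      · rw [Prod.fst_sum]; simpa [hf] using h3
      · rw [Prod.snd_sum]; simp [hf]
    have h3 : ∑ i, e i ^ 2 = 1 := by rw [sum_sq_coord, he]; norm_num
    have h4 : ∑ i, e i * B (e, 0) (f i) = B (e, 0) (e, 0) := by
      conv_rhs => rw [← h2]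
      rw [map_sum]
      simp [h2]
    have h5 : ∑ i, e i * B (f i) (e, 0) = B (e, 0) (e, 0) := by
      calc ∑ i, e i * B (f i) (e, 0) = (∑ i, e i • B (f i)) (e, 0) := by
            simp only [sum_apply, smul_apply, smul_eq_mul]
        _ = B (∑ i, e i • f i) (e, 0) := by simp only [map_sum, map_smul]
        _ = B (e, 0) (e, 0) := by rw [h2]
    have h6 : ∀ i, B (f i - (2 * e i) • ((e, 0) : Pt n)) (f i - (2 * e i) • ((e, 0) : Pt n)) =
        B (f i) (f i) - 2 * (e i * B (f i) (e, 0)) - 2 * (e i * B (e, 0) (f i)) +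
          4 * (e i ^ 2 * B (e, 0) (e, 0)) := fun i => by
      simp only [map_sub, map_smul, sub_apply, smul_apply,
        smul_eq_mul]
      ring
    have h7 : ∀ i, B ((EuclideanSpace.single i (1 : ℝ), (0 : ℝ)) -
        (2 * ⟪e, (EuclideanSpace.single i (1 : ℝ))⟫) • ((e, 0) : Pt n))
        ((EuclideanSpace.single i (1 : ℝ), (0 : ℝ)) -
        (2 * ⟪e, (EuclideanSpace.single i (1 : ℝ))⟫) • ((e, 0) : Pt n)) =
        B (f i) (f i) - 2 * (e i * B (f i) (e, 0)) - 2 * (e i * B (e, 0) (f i)) +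
          4 * (e i ^ 2 * B (e, 0) (e, 0)) := fun i => by
      rw [h1 i]; exact h6 i
    rw [Finset.sum_congr rfl fun i _ => h7 i, Finset.sum_add_distrib, Finset.sum_sub_distrib,
      Finset.sum_sub_distrib, ← Finset.mul_sum, ← Finset.mul_sum, ← Finset.mul_sum,
      ← Finset.sum_mul, h3, h4, h5]
    ring
  · simp

lemma norm_sq_hrefl {e z : EuclideanSpace ℝ (Fin n)} (he : ‖e‖ = 1)
    (X : Pt n) : ‖(hrefl e z X).1 - z‖ ^ 2 = ‖X.1 - z‖ ^ 2 := by
  have h1 : (hrefl e z X).1 - z = (X.1 - z) - (2 * ⟪e, X.1 - z⟫) • e := by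
    simp only [hrefl]; abel
  rw [h1, norm_sub_sq_real, inner_smul_right, norm_smul, he, real_inner_comm e]
  simp only [Real.norm_eq_abs, mul_one, sq_abs]
  ring

lemma nsq_hrefl_sub {e z : EuclideanSpace ℝ (Fin n)} (he : ‖e‖ = 1) (τ : ℝ) (X : Pt n) :
    nsq (hrefl e z X - (z, τ)) = nsq (X - (z, τ)) := by
  simp only [nsq, Prod.fst_sub, Prod.snd_sub, norm_sq_hrefl he]
  rfl

lemma hrefl_add_smul {e : EuclideanSpace ℝ (Fin n)} (he : ‖e‖ = 1)
    (z : EuclideanSpace ℝ (Fin n)) (s t : ℝ) :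
    hrefl e z (z + s • e, t) = (z - s • e, t) := by
  simp only [hrefl, add_sub_cancel_left, inner_smul_right, real_inner_self_eq_norm_sq, he]
  refine Prod.ext ?_ rfl
  module

lemma inner_le_of_nsq_le {e z : EuclideanSpace ℝ (Fin n)} (he : ‖e‖ = 1) {τ r : ℝ} (hr : 0 ≤ r)
    {X : Pt n} (hX : nsq (X - (z, τ)) ≤ r ^ 2) : ⟪e, X.1 - z⟫ ≤ r := by
  have h1 := real_inner_le_norm e (X.1 - z)
  rw [he, one_mul] at h1
  exact h1.trans ((norm_fst_le (X - (z, τ))).trans ((enorm'_le_iff hr).2 hX))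

lemma rpow_sub_rpow_le {u v A p : ℝ} (hv : 0 ≤ v) (hvu : v ≤ u) (huA : u ≤ A) (hp : 1 ≤ p) :
    u ^ p - v ^ p ≤ p * A ^ (p - 1) * (u - v) := by
  rcases hv.eq_or_lt with rfl | hv0
  · rcases hvu.eq_or_lt with rfl | hu0
    · simp
    · have h1 : (0 : ℝ) ^ p = 0 := Real.zero_rpow (by linarith)
      have h2 : u ^ p = u ^ (p - 1) * u := by rw [← Real.rpow_add_one hu0.ne']; congr 1; ring
      rw [h1, h2, sub_zero, sub_zero]
      have h3 : u ^ (p - 1) ≤ A ^ (p - 1) := Real.rpow_le_rpow hu0.le huA (by linarith)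
      have h4 : 0 ≤ u ^ (p - 1) := Real.rpow_nonneg hu0.le _
      have h5 : u ^ (p - 1) ≤ p * A ^ (p - 1) := by nlinarith
      gcongr
  · have hu0 : 0 < u := hv0.trans_le hvu
    have h1 := one_add_mul_self_le_rpow_one_add (s := v / u - 1) (p := p)
      (by have := div_pos hv0 hu0; linarith) hp
    have h2 : (1 + (v / u - 1)) ^ p = v ^ p / u ^ p := by
      rw [add_sub_cancel, Real.div_rpow hv hu0.le]
    have hup : 0 < u ^ p := Real.rpow_pos_of_pos hu0 p
    rw [h2, le_div_iff₀ hup] at h1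
    have h3 : u ^ p = u ^ (p - 1) * u := by rw [← Real.rpow_add_one hu0.ne']; congr 1; ring
    have h4 : u ^ p - v ^ p ≤ p * u ^ (p - 1) * (u - v) := by
      have h5 : (1 + p * (v / u - 1)) * u ^ p = u ^ p - p * u ^ (p - 1) * (u - v) := by
        rw [h3]; field_simp; ring
      linarith
    refine h4.trans ?_
    have h3 : u ^ (p - 1) ≤ A ^ (p - 1) := Real.rpow_le_rpow hu0.le huA (by linarith)
    gcongr

namespace Sol

/-- Interior horizontal Lipschitz estimate. -/
lemma lipschitz_interior (h : Sol n σ U) {z e : EuclideanSpace ℝ (Fin n)} (he : ‖e‖ = 1)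
    {τ r A : ℝ} (hr : 0 < r) (hrτ : r ≤ τ / 2)
    (hdom : ∀ Y : Pt n, nsq (Y - (z, τ)) ≤ r ^ 2 → nsq Y < 4)
    (hA : ∀ Y : Pt n, nsq (Y - (z, τ)) ≤ r ^ 2 → U Y ≤ A) {s : ℝ} (hs0 : 0 ≤ s) (hsr : s ≤ r) :
    U (z + s • e, τ) - U (z - s • e, τ) ≤ (n + 2) * A * s / r := by
  have hσ0 := h.hσ0
  have hσ1 := h.hσ1
  have hn := h.hn
  set C : Set (Pt n) := {X | nsq (X - (z, τ)) ≤ r ^ 2 ∧ 0 ≤ ⟪e, X.1 - z⟫} with hC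
  have hic : Continuous fun X : Pt n => ⟪e, X.1 - z⟫ := by fun_prop
  have hCc : IsCompact C := isCompact_of_nsq_sub_le
    ((isClosed_le (continuous_nsq_sub _) continuous_const).inter
      (isClosed_le continuous_const hic)) (z, τ) (r := r ^ 2) fun X hX => hX.1
  have ht : ∀ X : Pt n, nsq (X - (z, τ)) ≤ r ^ 2 → |X.2 - τ| ≤ r := fun X hX =>
    (abs_snd_le (X - (z, τ))).trans ((enorm'_le_iff hr.le).2 hX)
  have htp : ∀ X : Pt n, nsq (X - (z, τ)) ≤ r ^ 2 → 0 < X.2 := fun X hX => by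
    have := (abs_le.mp (ht X hX)).1
    linarith
  have hne : ∀ X : Pt n, nsq (X - (z, τ)) ≤ r ^ 2 → X ≠ 0 := by
    rintro X hX rfl
    simpa using htp _ hX
  have hUc : ContinuousOn U {X : Pt n | nsq (X - (z, τ)) ≤ r ^ 2} :=
    h.cont.mono fun X hX => ⟨(hdom X hX).le, (htp X hX).le, hne X hX⟩
  have hA0 : 0 ≤ A := by
    have h1 : nsq (((z, τ) : Pt n) - (z, τ)) ≤ r ^ 2 := by simpa [nsq] using sq_nonneg r
    exact (h.nonneg _ (hdom _ h1).le (htp _ h1).le (hne _ h1)).trans (hA _ h1)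
  set B := A / r ^ 2 with hB
  have hB0 : 0 ≤ B := by positivity
  have hBr : B * r ^ 2 = A := by rw [hB]; field_simp
  set k := quadBar σ e z 0 (B * (n + 2) * r) (B * (n + 2)) B 0 B τ 0 with hk
  have hform : ∀ X : Pt n, k X = B * (n + 2) * ⟪e, X.1 - z⟫ * (r - ⟪e, X.1 - z⟫) +
      B * nsq (X - (z, τ)) := fun X => by
    simp only [hk, quadBar, quadP, nsq, Prod.fst_sub, Prod.snd_sub]
    ring
  have hk0 : ∀ X ∈ C, 0 ≤ B * (n + 2) * ⟪e, X.1 - z⟫ * (r - ⟪e, X.1 - z⟫) := fun X hX => by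
    have := hX.2
    have := inner_le_of_nsq_le he hr.le hX.1
    have : 0 ≤ r - ⟪e, X.1 - z⟫ := by linarith
    positivity
  have hmem : ((z + s • e, τ) : Pt n) ∈ C := by
    refine ⟨?_, ?_⟩
    · simp only [nsq, Prod.fst_sub, Prod.snd_sub, add_sub_cancel_left, norm_smul, he]
      rw [Real.norm_eq_abs, abs_of_nonneg hs0]
      nlinarith
    · simp only [add_sub_cancel_left, inner_smul_right, real_inner_self_eq_norm_sq, he]
      linarith
  have key := h.minPrinciple hCc (fun X hX => (hdom X hX.1).le)
    (w := fun X => k X - (U X - U (hrefl e z X)))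
    ((continuous_quadBar hσ0 _ _ _ _ _ _ _ _ _ _).continuousOn.sub
      ((hUc.mono fun X hX => hX.1.1).sub (hUc.comp (continuous_hrefl e z).continuousOn
        fun X hX => by simpa only [Set.mem_ofPred_eq, nsq_hrefl_sub he] using hX.1.1))) ?_
    _ hmem (by simpa using (by linarith : 0 ≤ τ))
  · simp only [hrefl_add_smul he, hform] at key
    have h1 : nsq (((z + s • e, τ) : Pt n) - (z, τ)) = s ^ 2 := by
      simp only [nsq, Prod.fst_sub, Prod.snd_sub, add_sub_cancel_left, norm_smul, he]
      simp
    have h2 : ⟪e, (z + s • e) - z⟫ = s := by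
      simp only [add_sub_cancel_left, inner_smul_right, real_inner_self_eq_norm_sq, he]
      ring
    rw [h1, h2] at key
    have h3 : (n + 2) * A * s / r = B * (n + 2) * s * r := by rw [hB]; field_simp
    rw [h3]
    have : 0 ≤ B * (n + 1) * s ^ 2 := by positivity
    nlinarith
  · intro X hX ht0 hneg
    have hρ : nsq (hrefl e z X - (z, τ)) ≤ r ^ 2 := by rw [nsq_hrefl_sub he]; exact hX.1
    have hUρ := h.nonneg _ (hdom _ hρ).le (htp _ hρ).le (hne _ hρ)
    have h1 := hk0 X hX
    have hXr : nsq (X - (z, τ)) < r ^ 2 := hX.1.lt_of_ne fun e' => by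
      have := hA X hX.1
      rw [hform, e', hBr] at hneg
      linarith
    have hXe : 0 < ⟪e, X.1 - z⟫ := hX.2.lt_of_ne fun e' => by
      have h2 : hrefl e z X = X := by
        simp only [hrefl, ← e']; simp
      rw [h2, hform] at hneg
      have := mul_nonneg hB0 (nsq_nonneg (X - (z, τ)))
      linarith
    have htX := htp X hX.1
    refine ⟨?_, fun _ => ⟨_, (hasL_quadBar _ _ _ _ _ _ _ _ _ _ htX).sub
      ((h.hasL X (hdom X hX.1) htX).sub
        (HasL.comp_hrefl he (h.hasL _ (hdom _ hρ) (htp _ hρ)))), ?_⟩, fun h' => absurd h' htX.ne'⟩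
    · filter_upwards [eventually_lt_const' (continuous_nsq_sub _) hXr,
        eventually_const_lt' hic hXe] with Y h1 h2
      exact ⟨h1.le, h2.le⟩
    · have h2 : (1 - 2 * σ) * (X.2 - τ) / X.2 ≤ 1 := by
        rw [div_le_iff₀ htX]
        have h3 := abs_le.mp (ht X hX.1)
        have h4 : |1 - 2 * σ| ≤ 1 := abs_le.mpr ⟨by linarith, by linarith⟩
        calc (1 - 2 * σ) * (X.2 - τ) ≤ |(1 - 2 * σ) * (X.2 - τ)| := le_abs_self _
          _ = |1 - 2 * σ| * |X.2 - τ| := abs_mul _ _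
          _ ≤ 1 * r := by gcongr; exact ht X hX.1
          _ ≤ 1 * X.2 := by linarith
      rw [he]
      nlinarith

/-- Horizontal Lipschitz estimate up to the trace. -/
lemma lipschitz_trace (h : Sol n σ U) {z e : EuclideanSpace ℝ (Fin n)} (he : ‖e‖ = 1)
    {r A : ℝ} (hr : 0 < r) (hrz : r < ‖z‖)
    (hdom : ∀ Y : Pt n, nsq (Y - (z, 0)) ≤ r ^ 2 → nsq Y < 4)
    (hA : ∀ Y : Pt n, 0 ≤ Y.2 → nsq (Y - (z, 0)) ≤ r ^ 2 → U Y ≤ A)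
    (hE : (expP n σ * A ^ (expP n σ - 1) / (2 * σ) + 1) * r ^ (2 * σ) ≤ 1 / 2)
    {s t : ℝ} (hs0 : 0 ≤ s) (ht0 : 0 ≤ t) (hst : s ^ 2 + t ^ 2 ≤ r ^ 2) :
    U (z + s • e, t) - U (z - s • e, t) ≤ A / r ^ 2 * ((2 * n + 5) * r * s + t ^ 2) := by
  have hσ0 := h.hσ0
  have hσ1 := h.hσ1
  have hn := h.hn
  have hp := h.one_lt_expP
  set p := expP n σ with hpdef
  set E := p * A ^ (p - 1) / (2 * σ) + 1 with hEdef
  set C : Set (Pt n) := {X | nsq (X - (z, 0)) ≤ r ^ 2 ∧ 0 ≤ ⟪e, X.1 - z⟫} with hC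
  have hic : Continuous fun X : Pt n => ⟪e, X.1 - z⟫ := by fun_prop
  have hCc : IsCompact C := isCompact_of_nsq_sub_le
    ((isClosed_le (continuous_nsq_sub _) continuous_const).inter
      (isClosed_le continuous_const hic)) (z, 0) (r := r ^ 2) fun X hX => hX.1
  have hne : ∀ X : Pt n, nsq (X - (z, 0)) ≤ r ^ 2 → X ≠ 0 := by
    rintro X hX rfl
    have h1 := (enorm'_le_iff hr.le).2 hX
    rw [enorm'_sub_comm, sub_zero, enorm'_trace] at h1
    linarith
  have hUc : ContinuousOn U {X : Pt n | nsq (X - (z, 0)) ≤ r ^ 2 ∧ 0 ≤ X.2} :=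
    h.cont.mono fun X hX => ⟨(hdom X hX.1).le, hX.2, hne X hX.1⟩
  have hA0 : 0 ≤ A := by
    have h1 : nsq (((z, 0) : Pt n) - (z, 0)) ≤ r ^ 2 := by simpa [nsq] using sq_nonneg r
    exact (h.nonneg _ (hdom _ h1).le le_rfl (hne _ h1)).trans (hA _ le_rfl h1)
  have hE0 : 0 ≤ E := by
    have := Real.rpow_nonneg hA0 (p - 1)
    rw [hEdef]; positivity
  set B := A / r ^ 2 with hB
  have hB0 : 0 ≤ B := by positivity
  have hBr : B * r ^ 2 = A := by rw [hB]; field_simp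
  have hmem : ((z + s • e, t) : Pt n) ∈ C := by
    refine ⟨?_, ?_⟩
    · simp only [nsq, Prod.fst_sub, Prod.snd_sub, add_sub_cancel_left, norm_smul, he]
      rw [Real.norm_eq_abs, abs_of_nonneg hs0]
      linarith
    · simp only [add_sub_cancel_left, inner_smul_right, real_inner_self_eq_norm_sq, he]
      linarith
  have htr : ∀ X ∈ C, 0 ≤ X.2 → 1 / 2 ≤ 1 - E * X.2 ^ (2 * σ) := fun X hX ht => by
    have h1 : X.2 ≤ r := by
      have := (le_abs_self _).trans
        ((abs_snd_le (X - (z, 0))).trans ((enorm'_le_iff hr.le).2 hX.1))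
      simpa using this
    have h2 : X.2 ^ (2 * σ) ≤ r ^ (2 * σ) := Real.rpow_le_rpow ht h1 (by linarith)
    nlinarith
  have main : ∀ η : ℝ, 0 < η → U (z + s • e, t) - U (z - s • e, t) ≤
      B * ((2 * n + 5) * r * s + t ^ 2) + B * η := by
    intro η hη
    set k := quadBar σ e z η ((2 * n + 5) * r) (2 * n + 5) 2 E 1 0 0 with hk
    have hkc : Continuous k := continuous_quadBar hσ0 _ _ _ _ _ _ _ _ _ _
    have hform : ∀ X : Pt n, k X = (η + (2 * n + 5) * ⟪e, X.1 - z⟫ * (r - ⟪e, X.1 - z⟫) +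
        2 * ‖X.1 - z‖ ^ 2) * (1 - E * X.2 ^ (2 * σ)) + X.2 ^ 2 := fun X => by
      simp only [hk, quadBar, quadP]
      ring
    have hψ : ∀ X ∈ C, 0 ≤ (2 * n + 5) * ⟪e, X.1 - z⟫ * (r - ⟪e, X.1 - z⟫) := fun X hX => by
      have := hX.2
      have := inner_le_of_nsq_le he hr.le hX.1
      have : 0 ≤ r - ⟪e, X.1 - z⟫ := by linarith
      positivity
    have hklow : ∀ X ∈ C, 0 ≤ X.2 → η / 2 + nsq (X - (z, 0)) ≤ k X := fun X hX ht => by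
      have h1 := htr X hX ht
      have h2 := hψ X hX
      have h3 : nsq (X - (z, 0)) = ‖X.1 - z‖ ^ 2 + X.2 ^ 2 := by simp [nsq]
      have h4 := sq_nonneg ‖X.1 - z‖
      rw [hform, h3]
      nlinarith
    have hkpos : ∀ X ∈ C, 0 ≤ X.2 → 0 < k X := fun X hX ht => by
      have := hklow X hX ht
      have := nsq_nonneg (X - (z, 0))
      linarith
    have key := comparison (σ := σ) hCc (w := fun X => B * k X - (U X - U (hrefl e z X))) (Φ := k)
      ((continuousOn_const.mul hkc.continuousOn).sub
      ((hUc.mono fun X hX => ⟨hX.1.1, hX.2⟩).sub (hUc.comp (continuous_hrefl e z).continuousOn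
        fun X hX => ⟨by simpa only [nsq_hrefl_sub he] using hX.1.1, hX.2⟩)))
      hkc.continuousOn hkpos ?_ _ hmem ht0
    · simp only [hrefl_add_smul he, hform] at key
      have h2 : ⟪e, (z + s • e) - z⟫ = s := by
        simp only [add_sub_cancel_left, inner_smul_right, real_inner_self_eq_norm_sq, he]
        ring
      have h3 : ‖z + s • e - z‖ ^ 2 = s ^ 2 := by
        rw [add_sub_cancel_left, norm_smul, he]; simp
      rw [h2, h3] at key
      have h5 : s ≤ r := by nlinarith [sq_nonneg t]
      have h6 : 1 - E * t ^ (2 * σ) ≤ 1 := by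
        have := Real.rpow_nonneg ht0 (2 * σ)
        nlinarith
      have h7 : 0 ≤ η + (2 * n + 5) * s * (r - s) + 2 * s ^ 2 := by
        have : 0 ≤ r - s := by linarith
        positivity
      have h8 : (η + (2 * n + 5) * s * (r - s) + 2 * s ^ 2) * (1 - E * t ^ (2 * σ)) ≤
          η + (2 * n + 5) * r * s := by
        have h9 : 0 ≤ (2 * (n : ℝ) + 3) * s ^ 2 := by positivity
        nlinarith
      have h9 := mul_le_mul_of_nonneg_left (add_le_add_left h8 (t ^ 2)) hB0
      linarith
    · intro X hX ht hneg
      have hρ : nsq (hrefl e z X - (z, 0)) ≤ r ^ 2 := by rw [nsq_hrefl_sub he]; exact hX.1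
      have hUρ := h.nonneg _ (hdom _ hρ).le ht (hne _ hρ)
      have hkX := hkpos X hX ht
      have hXr : nsq (X - (z, 0)) < r ^ 2 := hX.1.lt_of_ne fun e' => by
        have h1 := hA X ht hX.1
        have h2 := hklow X hX ht
        rw [e'] at h2
        have : B * r ^ 2 ≤ B * k X := mul_le_mul_of_nonneg_left (by linarith) hB0
        linarith
      have hXe : 0 < ⟪e, X.1 - z⟫ := hX.2.lt_of_ne fun e' => by
        have h2 : hrefl e z X = X := by
          simp only [hrefl, ← e']; simp
        rw [h2] at hneg
        have := mul_nonneg hB0 hkX.le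
        linarith
      have hQk : HasQ σ k X.1 _ := hasQ_quadBar hσ0 hσ1 e z η ((2 * n + 5) * r) (2 * n + 5) 2 E 1 0 X.1
      have hLk : 0 < X.2 → HasL σ k X _ := fun htX =>
        HasL.quadBar_zero e z η ((2 * n + 5) * r) (2 * n + 5) 2 E 1 0 htX
      have hneg' : (2 * n * 2 - 2 * (2 * n + 5) * ‖e‖ ^ 2) * (1 - E * X.2 ^ (2 * σ)) +
          4 * (1 - σ) * 1 < 0 := by
        have h1 : (2 * n * 2 - 2 * (2 * n + 5) * ‖e‖ ^ 2) * (1 - E * X.2 ^ (2 * σ)) =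
            -10 * (1 - E * X.2 ^ (2 * σ)) := by rw [he]; ring
        linarith [htr X hX ht]
      have hQρ : X.2 = 0 → HasQ σ (fun Y => U (hrefl e z Y)) X.1 (-(U (hrefl e z X) ^ p / (2 * σ))) :=
        fun htX => h.hasQ_trace (hdom _ hρ) (hne _ hρ) htX
      refine ⟨?_, fun htX => ⟨_, _, ((hLk htX).const_mul B).sub ((h.hasL X (hdom X hX.1) htX).sub
        (HasL.comp_hrefl he (h.hasL _ (hdom _ hρ) htX))), hLk htX, ?_, ?_⟩, fun htX => ⟨_, _,
          (hQk.const_mul B).sub ((h.hasQ_trace (hdom X hX.1) (hne X hX.1) htX).sub (hQρ htX)), hQk,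
          ?_⟩⟩
      · filter_upwards [eventually_lt_const' (continuous_nsq_sub _) hXr,
          eventually_const_lt' hic hXe] with Y h1 h2
        exact ⟨h1.le, h2.le⟩
      · have := mul_nonpos_of_nonneg_of_nonpos hB0 hneg'.le
        linarith
      · exact hneg'
      · have hkq : k X = quadP e z η ((2 * n + 5) * r) (2 * n + 5) 2 X.1 := by
          have : (0 : ℝ) ^ (2 * σ) = 0 := Real.zero_rpow (by linarith)
          simp [hk, quadBar, htX, this]
        rw [← hkq, ← hpdef]
        have hlt : U (hrefl e z X) < U X := by
          have := mul_nonneg hB0 hkX.le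
          linarith
        have h1 := rpow_sub_rpow_le hUρ hlt.le (hA X ht hX.1) hp.le
        have h2 : (U X ^ p - U (hrefl e z X) ^ p) / (2 * σ) < E * (U X - U (hrefl e z X)) := by
          have h3 : (U X ^ p - U (hrefl e z X) ^ p) / (2 * σ) ≤
              p * A ^ (p - 1) * (U X - U (hrefl e z X)) / (2 * σ) := by gcongr
          have h4 : p * A ^ (p - 1) * (U X - U (hrefl e z X)) / (2 * σ) =
              (E - 1) * (U X - U (hrefl e z X)) := by rw [hEdef]; ring
          linarith
        rw [sub_div] at h2
        have h5 := mul_lt_mul_of_pos_right h2 hkX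
        linarith
  refine le_of_forall_pos_le_add fun ε hε => ?_
  refine (main (ε / (B + 1)) (by positivity)).trans ?_
  have : B * (ε / (B + 1)) ≤ ε := by
    rw [mul_div_assoc', div_le_iff₀ (by positivity)]
    nlinarith
  linarith

end Sol

end Reflection

section Kelvin

variable {n : ℕ} {σ : ℝ} {U : Pt n → ℝ}

/-- Inversion in the sphere of squared radius `L` about the trace point `x₀`. -/
def invPt (x₀ : EuclideanSpace ℝ (Fin n)) (L : ℝ) (Y : Pt n) : Pt n :=
  (x₀, 0) + (L * nsq (Y - (x₀, 0)) ^ (-1 : ℝ)) • (Y - (x₀, 0))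

/-- The Kelvin transform of `U` with respect to the sphere of squared radius `L` about `x₀`. -/
def kelvin (a : ℝ) (x₀ : EuclideanSpace ℝ (Fin n)) (L : ℝ) (U : Pt n → ℝ) (Y : Pt n) : ℝ :=
  L ^ a * nsq (Y - (x₀, 0)) ^ (-a) * U (invPt x₀ L Y)

lemma contDiffAt_kelvin {a L : ℝ} {x₀ : EuclideanSpace ℝ (Fin n)} {Y : Pt n}
    (hY : 0 < nsq (Y - (x₀, 0))) (hU : ContDiffAt ℝ 2 U (invPt x₀ L Y)) :
    ContDiffAt ℝ 2 (kelvin a x₀ L U) Y := by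
  have h1 : ∀ r : ℝ, ContDiffAt ℝ 2 (fun Y : Pt n => nsq (Y - (x₀, 0)) ^ r) Y := fun r =>
    (contDiff_nsq_sub _).contDiffAt.rpow_const_of_ne hY.ne'
  have h2 : ContDiffAt ℝ 2 (invPt x₀ L) Y :=
    contDiffAt_const.add ((contDiffAt_const.mul (h1 (-1))).smul (contDiffAt_id.sub contDiffAt_const))
  exact (contDiffAt_const.mul (h1 (-a))).mul (hU.comp Y h2)

section Direction

variable {a L : ℝ} {x₀ : EuclideanSpace ℝ (Fin n)} {Y v : Pt n} {q b : ℝ}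

/-- Velocity of the inverted line `s ↦ invPt x₀ L (Y + s • v)`. -/
def invVel (x₀ : EuclideanSpace ℝ (Fin n)) (L q b : ℝ) (Y v : Pt n) (s : ℝ) : Pt n :=
  (L * (q + 2 * s * b + s ^ 2) ^ (-1 : ℝ)) • v +
    (L * ((2 * b + 2 * s) * (-1) * (q + 2 * s * b + s ^ 2) ^ (-1 - 1 : ℝ))) •
      (Y + s • v - (x₀, 0))

lemma hasDerivAt_invPt (hline : ∀ s : ℝ, nsq (Y + s • v - (x₀, 0)) = q + 2 * s * b + s ^ 2) {s : ℝ}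
    (hs : 0 < q + 2 * s * b + s ^ 2) :
    HasDerivAt (fun s : ℝ => invPt x₀ L (Y + s • v)) (invVel x₀ L q b Y v s) s := by
  unfold invPt
  simp only [hline]
  exact (((hasDerivAt_rpow_quad b (-1) hs).const_mul L).smul
    ((hasDerivAt_line Y v s).sub_const (x₀, 0))).const_add _

lemma hasDerivAt_invVel (hq : 0 < q) :
    HasDerivAt (invVel x₀ L q b Y v)
      ((2 * (L * (-2 * b / q ^ 2))) • v + (L * (-2 / q ^ 2 + 8 * b ^ 2 / q ^ 3)) • (Y - (x₀, 0)))
      0 := by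
  have e2 : q ^ (-1 - 1 : ℝ) = 1 / q ^ 2 := by
    rw [show (-1 - 1 : ℝ) = -(2 : ℝ) by norm_num, Real.rpow_neg hq.le, Real.rpow_two, one_div]
  have e3 : q ^ (-1 - 2 : ℝ) = 1 / q ^ 3 := by
    rw [show (-1 - 2 : ℝ) = -((3 : ℕ) : ℝ) by norm_num, Real.rpow_neg hq.le, Real.rpow_natCast,
      one_div]
  have h1 := ((hasDerivAt_rpow_quad (q := q) b (-1) (s := 0) (by simpa using hq)).const_mul
    L).smul_const v
  have h2 := (((hasDerivAt_rpow_quad_two (q := q) b (-1) hq).const_mul L).fun_smul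
    ((hasDerivAt_line Y v 0).sub_const (x₀, 0)))
  refine (h1.fun_add h2).congr_deriv ?_
  simp only [mul_zero, zero_mul, add_zero, zero_smul, ne_eq, OfNat.ofNat_ne_zero,
    not_false_eq_true, zero_pow, e2, e3]
  module

lemma eventually_kelvin_line (hq : 0 < q)
    (hline : ∀ s : ℝ, nsq (Y + s • v - (x₀, 0)) = q + 2 * s * b + s ^ 2)
    (hU : ContDiffAt ℝ 2 U (invPt x₀ L Y)) :
    ∀ᶠ s : ℝ in 𝓝 0, HasDerivAt (fun s : ℝ => kelvin a x₀ L U (Y + s • v))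
      (L ^ a * ((2 * b + 2 * s) * (-a) * (q + 2 * s * b + s ^ 2) ^ (-a - 1)) *
          U (invPt x₀ L (Y + s • v)) +
        L ^ a * (q + 2 * s * b + s ^ 2) ^ (-a) *
          fderiv ℝ U (invPt x₀ L (Y + s • v)) (invVel x₀ L q b Y v s)) s := by
  have h0 : ContinuousAt (fun s : ℝ => invPt x₀ L (Y + s • v)) 0 :=
    (hasDerivAt_invPt hline (by simpa using hq)).continuousAt
  have h1 : ∀ᶠ s : ℝ in 𝓝 0, DifferentiableAt ℝ U (invPt x₀ L (Y + s • v)) :=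
    h0.eventually (by simpa using eventually_differentiableAt hU)
  filter_upwards [h1, eventually_quad_pos hq b] with s h2 h3
  unfold kelvin
  simp only [hline]
  exact ((hasDerivAt_rpow_quad b (-a) h3).const_mul (L ^ a)).mul
    (h2.hasFDerivAt.comp_hasDerivAt s (hasDerivAt_invPt hline h3))

lemma invVel_zero (hq : 0 < q) : invVel x₀ L q b Y v 0 =
    (L / q) • v + (L * (-2 * b / q ^ 2)) • (Y - (x₀, 0)) := by
  have e2 : q ^ (-1 - 1 : ℝ) = 1 / q ^ 2 := by
    rw [show (-1 - 1 : ℝ) = -(2 : ℝ) by norm_num, Real.rpow_neg hq.le, Real.rpow_two, one_div]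
  simp only [invVel, mul_zero, zero_mul, add_zero, ne_eq, OfNat.ofNat_ne_zero, not_false_eq_true,
    zero_pow, zero_smul, e2, Real.rpow_neg_one]
  module

lemma rpow_neg_sub_one (hq : 0 < q) (a : ℝ) : q ^ (-a - 1) = q ^ (-a) / q := by
  rw [Real.rpow_sub_one hq.ne']

lemma rpow_neg_sub_two (hq : 0 < q) (a : ℝ) : q ^ (-a - 2) = q ^ (-a) / q ^ 2 := by
  rw [Real.rpow_sub hq, Real.rpow_two]

set_option maxHeartbeats 1000000 in
lemma d2_kelvin (hY : nsq (Y - (x₀, 0)) = q) (hq : 0 < q)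
    (hline : ∀ s : ℝ, nsq (Y + s • v - (x₀, 0)) = q + 2 * s * b + s ^ 2)
    (hU : ContDiffAt ℝ 2 U (invPt x₀ L Y)) :
    d2 (kelvin a x₀ L U) Y v = L ^ a * q ^ (-a) *
      ((-2 * a / q + 4 * b ^ 2 * a * (a + 1) / q ^ 2) * U (invPt x₀ L Y) +
        (-4 * a * b / q) * (L / q * fderiv ℝ U (invPt x₀ L Y) v +
          L * (-2 * b / q ^ 2) * fderiv ℝ U (invPt x₀ L Y) (Y - (x₀, 0))) +
        (4 * b ^ 2 * L ^ 2 / q ^ 4 *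
            fderiv ℝ (fderiv ℝ U) (invPt x₀ L Y) (Y - (x₀, 0)) (Y - (x₀, 0)) -
          2 * L ^ 2 / q ^ 3 * (b * fderiv ℝ (fderiv ℝ U) (invPt x₀ L Y) (Y - (x₀, 0)) v +
            b * fderiv ℝ (fderiv ℝ U) (invPt x₀ L Y) v (Y - (x₀, 0))) +
          L ^ 2 / q ^ 2 * fderiv ℝ (fderiv ℝ U) (invPt x₀ L Y) v v) +
        (2 * (L * (-2 * b / q ^ 2)) * fderiv ℝ U (invPt x₀ L Y) v +
          L * (-2 / q ^ 2 + 8 * b ^ 2 / q ^ 3) *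
            fderiv ℝ U (invPt x₀ L Y) (Y - (x₀, 0)))) := by
  have hI : invPt x₀ L (Y + (0 : ℝ) • v) = invPt x₀ L Y := by simp
  have hc := hasDerivAt_invPt (L := L) hline (s := 0) (by simpa using hq)
  have hD : HasFDerivAt (fderiv ℝ U) (fderiv ℝ (fderiv ℝ U) (invPt x₀ L Y))
      (invPt x₀ L (Y + (0 : ℝ) • v)) := by
    rw [hI]; exact (differentiableAt_fderiv hU).hasFDerivAt
  have hD1 : HasFDerivAt U (fderiv ℝ U (invPt x₀ L Y)) (invPt x₀ L (Y + (0 : ℝ) • v)) := by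
    rw [hI]; exact (hU.differentiableAt (by norm_num)).hasFDerivAt
  have h1 := (hD.comp_hasDerivAt (0 : ℝ) hc).clm_apply (hasDerivAt_invVel (x₀ := x₀) (L := L)
    (b := b) (Y := Y) (v := v) hq)
  have h2 := ((((hasDerivAt_rpow_quad_two (q := q) b (-a) hq).const_mul (L ^ a)).fun_mul
    (hD1.comp_hasDerivAt (0 : ℝ) hc)).fun_add
    (((hasDerivAt_rpow_quad (q := q) b (-a) (s := 0) (by simpa using hq)).const_mul
      (L ^ a)).fun_mul h1))
  rw [d2_of_line (contDiffAt_kelvin (hY ▸ hq) hU) (eventually_kelvin_line hq hline hU) h2]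
  simp only [Function.comp, hI, invVel_zero hq, mul_zero, zero_mul, add_zero, ne_eq,
    OfNat.ofNat_ne_zero, not_false_eq_true, zero_pow, map_add, map_smul, add_apply,
    smul_apply, smul_eq_mul, rpow_neg_sub_one hq, rpow_neg_sub_two hq]
  clear h1 h2 hD hD1 hc hI
  generalize fderiv ℝ (fderiv ℝ U) (invPt x₀ L Y) = B
  generalize fderiv ℝ U (invPt x₀ L Y) = D
  generalize U (invPt x₀ L Y) = u
  generalize B v v = b1
  generalize B v (Y - (x₀, 0)) = b2
  generalize B (Y - (x₀, 0)) v = b3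
  generalize B (Y - (x₀, 0)) (Y - (x₀, 0)) = b4
  generalize D v = d1
  generalize D (Y - (x₀, 0)) = d3
  generalize q ^ (-a) = qa
  generalize L ^ a = La
  field_simp
  ring

end Direction

lemma HasL.kelvin {L : ℝ} {x₀ : EuclideanSpace ℝ (Fin n)} {Y : Pt n} (hL : 0 < L) (ht : 0 < Y.2)
    (h : HasL σ U (invPt x₀ L Y) 0) : HasL σ (kelvin (expA n σ) x₀ L U) Y 0 := by
  set a := expA n σ with ha
  have hq : 0 < nsq (Y - (x₀, 0)) := nsq_pos fun e => by
    have : (Y - (x₀, 0)).2 = Y.2 := by simp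
    rw [e] at this
    simp at this; linarith
  refine ⟨contDiffAt_kelvin hq h.1, ?_⟩
  set q := nsq (Y - (x₀, 0)) with hqdef
  set ξ := Y - (x₀, 0) with hξ
  set D := fderiv ℝ U (invPt x₀ L Y) with hD
  set B := fderiv ℝ (fderiv ℝ U) (invPt x₀ L Y) with hB
  set f : Fin n → Pt n := fun i => (EuclideanSpace.single i (1 : ℝ), (0 : ℝ)) with hf
  have hξt : ξ.2 = Y.2 := by simp [hξ]
  have hI2 : (invPt x₀ L Y).2 = L / q * Y.2 := by
    simp only [invPt, ← hξ, ← hqdef, Real.rpow_neg_one, Prod.snd_add, Prod.smul_snd, hξt]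
    rw [smul_eq_mul]; ring
  have hdec : ∑ i, ξ.1 i • f i = ξ - Y.2 • ((0, 1) : Pt n) := by
    have h3 : ∑ i, ξ.1 i • EuclideanSpace.single i (1 : ℝ) = ξ.1 := by
      simpa using (EuclideanSpace.basisFun (Fin n) ℝ).sum_repr ξ.1
    refine Prod.ext ?_ ?_
    · rw [Prod.fst_sum]; simpa [hf] using h3
    · rw [Prod.snd_sum]; simp [hf, hξt]
  have hsq : ∑ i, ξ.1 i ^ 2 = q - Y.2 ^ 2 := by
    rw [sum_sq_coord, hqdef, nsq, hξt]; ring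
  have s1 : ∑ i, ξ.1 i * D (f i) = D ξ - Y.2 * D (0, 1) := by
    have := congrArg D hdec
    simpa only [map_sum, map_smul, map_sub, smul_eq_mul] using this
  have s2 : ∑ i, ξ.1 i * B ξ (f i) = B ξ ξ - Y.2 * B ξ (0, 1) := by
    have := congrArg (B ξ) hdec
    simpa only [map_sum, map_smul, map_sub, smul_eq_mul] using this
  have s3 : ∑ i, ξ.1 i * B (f i) ξ = B ξ ξ - Y.2 * B (0, 1) ξ := by
    have := congrArg (fun L => L ξ) (congrArg B hdec)
    simpa only [map_sum, map_smul, map_sub, smul_eq_mul, sum_apply, smul_apply, sub_apply]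
      using this
  have hv := d2_kelvin (a := a) (L := L) hqdef.symm hq (fun s => nsq_line_vert Y (x₀, 0) s) h.1
  have hh := fun i : Fin n => d2_kelvin (a := a) (L := L) hqdef.symm hq
    (fun s => nsq_line_single Y (x₀, 0) i s) h.1
  have hdt : dt (FracExt.kelvin a x₀ L U) Y = L ^ a * q ^ (-a) * (-2 * a * Y.2 / q *
      U (invPt x₀ L Y) + (L / q * D (0, 1) + L * (-2 * Y.2 / q ^ 2) * D ξ)) := by
    refine dt_of_line (contDiffAt_kelvin hq h.1) ?_
    have := (eventually_kelvin_line (a := a) (L := L) hq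
      (fun s => nsq_line_vert Y (x₀, 0) s) h.1).self_of_nhds
    refine this.congr_deriv ?_
    simp only [← hξ, invVel_zero hq, hξt, mul_zero, zero_mul, add_zero, ne_eq,
      OfNat.ofNat_ne_zero, not_false_eq_true, zero_pow, zero_smul, map_add, map_smul,
      smul_eq_mul, rpow_neg_sub_one hq, ← hD]
    field_simp
  have hLop := h.2
  have hlapU : lapl U (invPt x₀ L Y) = ∑ i, B (f i) (f i) + B (0, 1) (0, 1) := by
    simp only [lapl, d2_eq h.1, ← hB, hf]
  have hS : ∑ i, d2 (FracExt.kelvin a x₀ L U) Y (f i) = L ^ a * q ^ (-a) *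
      ((-2 * a * n / q + 4 * (q - Y.2 ^ 2) * a * (a + 1) / q ^ 2) * U (invPt x₀ L Y) +
        (-4 * a * L / q ^ 2) * (D ξ - Y.2 * D (0, 1)) +
          8 * a * L * (q - Y.2 ^ 2) / q ^ 3 * D ξ +
        (4 * (q - Y.2 ^ 2) * L ^ 2 / q ^ 4 * B ξ ξ -
          2 * L ^ 2 / q ^ 3 * ((B ξ ξ - Y.2 * B ξ (0, 1)) + (B ξ ξ - Y.2 * B (0, 1) ξ)) +
          L ^ 2 / q ^ 2 * ∑ i, B (f i) (f i)) +
        (-4 * L / q ^ 2 * (D ξ - Y.2 * D (0, 1)) +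
          L * (-2 * n / q ^ 2 + 8 * (q - Y.2 ^ 2) / q ^ 3) * D ξ)) := by
    rw [← s1, ← s2, ← s3, ← hsq, Finset.sum_congr rfl fun i _ => hh i, ← Finset.mul_sum]
    congr 1
    have hn : ∀ c : ℝ, c * (n : ℝ) = ∑ _i : Fin n, c := fun c => by simp [mul_comm]
    rw [show -2 * a * n / q = (-2 * a / q) * n by ring, hn,
      show -2 * (n : ℝ) / q ^ 2 = (-2 / q ^ 2) * n by ring, hn]
    simp only [div_eq_mul_inv, Finset.mul_sum, Finset.sum_mul, ← Finset.sum_add_distrib,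
      ← Finset.sum_sub_distrib]
    refine Finset.sum_congr rfl fun i _ => ?_
    simp only [← hξ, ← hD, ← hB, hf]
    ring
  rw [Lop, hlapU, hI2] at hLop
  rw [Lop, lapl, hdt]
  have hS' := hS
  simp only [hf] at hS'
  rw [hS', hv]
  simp only [← hξ, ← hD, ← hB, hξt]
  have hsum : ∑ i, B (f i) (f i) = -B (0, 1) (0, 1) - (1 - 2 * σ) / (L / q * Y.2) * D (0, 1) := by
    have : dt U (invPt x₀ L Y) = D (0, 1) := rfl
    rw [this] at hLop
    linarith
  simp only [hf] at hsum
  rw [hsum]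
  have hn : (n : ℝ) = 2 * a + 2 * σ := by rw [ha, expA]; ring
  rw [hn]
  have hLa : L ^ a ≠ 0 := (Real.rpow_pos_of_pos hL a).ne'
  have hqa : q ^ (-a) ≠ 0 := (Real.rpow_pos_of_pos hq (-a)).ne'
  field_simp
  ring

end Kelvin

section KelvinTrace

variable {n : ℕ} {σ : ℝ} {U : Pt n → ℝ}

namespace Sol

lemma exists_bound (h : Sol n σ U) {C : Set (Pt n)} (hC : IsCompact C)
    (hs : C ⊆ {X : Pt n | nsq X ≤ 4 ∧ 0 ≤ X.2 ∧ X ≠ 0}) : ∃ A : ℝ, 0 < A ∧ ∀ Y ∈ C, U Y ≤ A := by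
  obtain ⟨A, hA⟩ := hC.exists_bound_of_continuousOn (h.cont.mono hs)
  exact ⟨max A 1, by positivity, fun Y hY => ((le_abs_self _).trans (hA Y hY)).trans (le_max_left _ _)⟩

/-- Near a trace point the solution is Lipschitz in the horizontal variable up to `O(t²)`. -/
lemma lipschitz_near (h : Sol n σ U) {x : EuclideanSpace ℝ (Fin n)} (hx0 : x ≠ 0) (hx2 : ‖x‖ < 2) :
    ∃ K δ : ℝ, 0 ≤ K ∧ 0 < δ ∧ ∀ (y y' : EuclideanSpace ℝ (Fin n)) (t : ℝ), ‖y - x‖ < δ →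
      ‖y' - x‖ < δ → 0 ≤ t → t < δ → U (y, t) - U (y', t) ≤ K * (‖y - y'‖ + t ^ 2) := by
  have hσ0 := h.hσ0
  have hn := h.hn
  have hx : 0 < ‖x‖ := norm_pos_iff.mpr hx0
  obtain ⟨r₀, hr₀, hr₁, hr₂⟩ : ∃ r₀ : ℝ, 0 < r₀ ∧ 4 * r₀ ≤ ‖x‖ ∧ 4 * r₀ ≤ 2 - ‖x‖ := by
    refine ⟨min ‖x‖ (2 - ‖x‖) / 4, by have := lt_min hx (sub_pos.mpr hx2); positivity, ?_, ?_⟩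
    · have := min_le_left ‖x‖ (2 - ‖x‖); linarith
    · have := min_le_right ‖x‖ (2 - ‖x‖); linarith
  have hball : ∀ Y : Pt n, enorm' (Y - (x, 0)) ≤ 2 * r₀ → 0 < nsq Y ∧ nsq Y < 4 := fun Y hY => by
    have h1 := enorm'_sub_le Y (x, 0)
    have h2 := enorm'_sub_le (x, 0) Y
    rw [enorm'_sub_comm] at h2
    rw [enorm'_trace] at h1 h2
    rw [← enorm'_sq]
    constructor <;> nlinarith [enorm'_nonneg Y]
  set C : Set (Pt n) := {Y | nsq (Y - (x, 0)) ≤ (2 * r₀) ^ 2 ∧ 0 ≤ Y.2} with hC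
  have hCc : IsCompact C := isCompact_of_nsq_sub_le
    ((isClosed_le (continuous_nsq_sub _) continuous_const).inter
      (isClosed_le continuous_const continuous_snd)) (x, 0) (r := (2 * r₀) ^ 2) fun X hX => hX.1
  obtain ⟨A, hA0, hA⟩ := h.exists_bound hCc fun X hX => by
    have := hball X ((enorm'_le_iff (by positivity)).mpr hX.1)
    exact ⟨this.2.le, hX.2, ne_zero_of_nsq_pos this.1⟩
  set E := expP n σ * A ^ (expP n σ - 1) / (2 * σ) + 1 with hE
  obtain ⟨r, hr, hrr, hEr⟩ : ∃ r : ℝ, 0 < r ∧ r ≤ r₀ ∧ E * r ^ (2 * σ) ≤ 1 / 2 := by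
    have h1 : Tendsto (fun r : ℝ => E * r ^ (2 * σ)) (𝓝[>] 0) (𝓝 0) := by
      have := ((Real.continuousAt_rpow_const 0 (2 * σ) (Or.inr (by linarith))).tendsto).const_mul E
      rw [Real.zero_rpow (by linarith), mul_zero] at this
      exact this.mono_left nhdsWithin_le_nhds
    have h2 := h1.eventually (Iic_mem_nhds (by norm_num : (0 : ℝ) < 1 / 2))
    have h3 : ∀ᶠ r : ℝ in 𝓝[>] 0, r ≤ r₀ := nhdsWithin_le_nhds (Iic_mem_nhds hr₀)
    obtain ⟨r, h4, h5, h6⟩ := (h2.and (h3.and self_mem_nhdsWithin)).exists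
    exact ⟨r, h6, h5, h4⟩
  refine ⟨A / r ^ 2 * ((2 * n + 5) * r + 1), r / 2, by positivity, by positivity,
    fun y y' t hy hy' ht0 htδ => ?_⟩
  rcases eq_or_ne y y' with rfl | hne
  · simp only [sub_self, norm_zero, zero_add]; positivity
  have hd : 0 < ‖y - y'‖ := norm_pos_iff.mpr (sub_ne_zero.mpr hne)
  set z := (1 / 2 : ℝ) • (y + y') with hz
  set e := (1 / ‖y - y'‖) • (y - y') with he
  have hzx : ‖z - x‖ < r / 2 := by
    have : z - x = (1 / 2 : ℝ) • ((y - x) + (y' - x)) := by rw [hz]; module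
    rw [this, norm_smul, Real.norm_of_nonneg (by norm_num)]
    linarith [norm_add_le (y - x) (y' - x)]
  have hdd : ‖y - y'‖ < r := by
    have : y - y' = (y - x) - (y' - x) := by abel
    rw [this]
    linarith [norm_sub_le (y - x) (y' - x)]
  have hz2 : ‖x‖ ≤ ‖z‖ + ‖z - x‖ := by
    have := norm_sub_le z (z - x); rwa [sub_sub_cancel] at this
  have hYx : ∀ Y : Pt n, nsq (Y - (z, 0)) ≤ r ^ 2 → enorm' (Y - (x, 0)) ≤ 2 * r₀ := fun Y hY => by
    have h1 := (enorm'_le_iff hr.le).mpr hY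
    have h2 := enorm'_sub_le (Y - (x, 0)) ((z, 0) - (x, 0))
    rw [sub_sub_sub_cancel_right, show ((z, 0) : Pt n) - (x, 0) = (z - x, 0) by simp,
      enorm'_trace] at h2
    linarith
  have hse : (‖y - y'‖ / 2) • e = (1 / 2 : ℝ) • (y - y') := by
    rw [he, smul_smul]; congr 1; field_simp
  have := h.lipschitz_trace (z := z) (e := e) (r := r) (A := A)
    (by rw [he, norm_smul, norm_div, norm_one, norm_norm, one_div_mul_cancel hd.ne']) hr
    (by linarith) (fun Y hY => (hball Y (hYx Y hY)).2)
    (fun Y hY0 hY => hA Y ⟨(enorm'_le_iff (by positivity)).mp (hYx Y hY), hY0⟩) hEr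
    (s := ‖y - y'‖ / 2) (t := t) (by positivity) ht0 (by nlinarith)
  rw [hse, show z + (1 / 2 : ℝ) • (y - y') = y by rw [hz]; module,
    show z - (1 / 2 : ℝ) • (y - y') = y' by rw [hz]; module] at this
  refine this.trans ((?_ : _ ≤ A / r ^ 2 * (((2 * n + 5) * r + 1) * (‖y - y'‖ + t ^ 2))).trans_eq
    (mul_assoc _ _ _).symm)
  gcongr
  nlinarith [mul_nonneg (mul_pos (by linarith : (0 : ℝ) < 2 * n + 5) hr).le (sq_nonneg t), sq_nonneg t, mul_pos hr hd, mul_pos (mul_pos hr hd) (by linarith : (0 : ℝ) < n)]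

end Sol

lemma invPt_line (x₀ y : EuclideanSpace ℝ (Fin n)) (L t : ℝ) :
    invPt x₀ L (y, t) = (x₀ + (L * (‖y - x₀‖ ^ 2 + t ^ 2) ^ (-1 : ℝ)) • (y - x₀),
      L * (‖y - x₀‖ ^ 2 + t ^ 2) ^ (-1 : ℝ) * t) := by
  simp [invPt, nsq]

lemma Sol.hasQ_kelvin (h : Sol n σ U) {L : ℝ} {x₀ y : EuclideanSpace ℝ (Fin n)} (hL : 0 < L)
    (hy : y ≠ x₀) (h0 : invPt x₀ L (y, 0) ≠ 0) (h4 : nsq (invPt x₀ L (y, 0)) < 4) :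
    HasQ σ (kelvin (expA n σ) x₀ L U) y
      (-(kelvin (expA n σ) x₀ L U (y, 0) ^ expP n σ / (2 * σ))) := by
  have hσ0 := h.hσ0
  have hσ1 := h.hσ1
  set a := expA n σ with ha
  set p := expP n σ with hp
  set q := ‖y - x₀‖ ^ 2 with hq
  have hq0 : 0 < q := by have := norm_pos_iff.mpr (sub_ne_zero.mpr hy); positivity
  set m : ℝ → ℝ := fun t => L * (q + t ^ 2) ^ (-1 : ℝ) with hm
  set A : ℝ → ℝ := fun t => L ^ a * (q + t ^ 2) ^ (-a) with hA
  set ys := x₀ + m 0 • (y - x₀) with hys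
  have hm0 : 0 < m 0 := mul_pos hL (Real.rpow_pos_of_pos (by simpa using hq0) _)
  have hmpos : ∀ t, 0 < m t := fun t => mul_pos hL (Real.rpow_pos_of_pos (by positivity) _)
  have hI : ∀ t, invPt x₀ L (y, t) = (x₀ + m t • (y - x₀), m t * t) := fun t => invPt_line _ _ _ _
  have hI0 : invPt x₀ L (y, 0) = (ys, 0) := by rw [hI, mul_zero]
  rw [hI0] at h0 h4
  have hys0 : ys ≠ 0 := fun e => h0 (by rw [e]; rfl)
  have hys2 : ‖ys‖ < 2 := by
    simp only [nsq] at h4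
    nlinarith [norm_nonneg ys]
  have hderiv : ∀ β : ℝ, HasDerivAt (fun r : ℝ => (q + r) ^ β) (1 * β * (q + 0) ^ (β - 1)) 0 :=
    fun β => ((hasDerivAt_id (0 : ℝ)).const_add q).rpow_const (Or.inl (by simpa using hq0.ne'))
  have hquot : ∀ c β : ℝ, Tendsto (fun t : ℝ => (c * (q + t ^ 2) ^ β - c * (q + 0 ^ 2) ^ β) /
      t ^ (2 * σ)) (𝓝[>] 0) (𝓝 0) := fun c β => by
    have := tendsto_quot_comp_sq hσ1 ((hderiv β).const_mul c)
    simpa using this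
  have hcont : ∀ c β : ℝ, Tendsto (fun t : ℝ => c * (q + t ^ 2) ^ β) (𝓝[>] 0)
      (𝓝 (c * (q + 0 ^ 2) ^ β)) := fun c β => by
    have : ContinuousAt (fun t : ℝ => c * (q + t ^ 2) ^ β) 0 :=
      continuousAt_const.mul ((by fun_prop : ContinuousAt (fun t : ℝ => q + t ^ 2) 0).rpow_const
        (Or.inl (by simpa using hq0.ne')))
    exact this.tendsto.mono_left nhdsWithin_le_nhds
  have hmt : Tendsto m (𝓝[>] 0) (𝓝 (m 0)) := hcont L (-1)
  have hAt : Tendsto A (𝓝[>] 0) (𝓝 (A 0)) := hcont _ _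
  have hmq : Tendsto (fun t => (m t - m 0) / t ^ (2 * σ)) (𝓝[>] 0) (𝓝 0) := hquot _ _
  have hAq : Tendsto (fun t => (A t - A 0) / t ^ (2 * σ)) (𝓝[>] 0) (𝓝 0) := hquot _ _
  have hid : Tendsto (fun t : ℝ => t) (𝓝[>] 0) (𝓝 0) := tendsto_id.mono_left nhdsWithin_le_nhds
  have hst : Tendsto (fun t => m t * t) (𝓝[>] 0) (𝓝 0) := by simpa using hmt.mul hid
  have hst' : Tendsto (fun t => m t * t) (𝓝[>] 0) (𝓝[>] 0) :=
    tendsto_nhdsWithin_iff.mpr ⟨hst, by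
      filter_upwards [self_mem_nhdsWithin] with t ht using mul_pos (hmpos t) ht⟩
  obtain ⟨K, δ, hK, hδ, hlip⟩ := h.lipschitz_near hys0 hys2
  -- the horizontal displacement contributes nothing
  have hhor : Tendsto (fun t => (U (x₀ + m t • (y - x₀), m t * t) - U (ys, m t * t)) / t ^ (2 * σ))
      (𝓝[>] 0) (𝓝 0) := by
    have hb : Tendsto (fun t => K * (‖y - x₀‖ * |(m t - m 0) / t ^ (2 * σ)| +
        m t ^ 2 * (t ^ 2 / t ^ (2 * σ)))) (𝓝[>] 0) (𝓝 0) := by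
      have := ((hmq.abs.const_mul ‖y - x₀‖).add ((hmt.pow 2).mul (tendsto_sq_div_rpow hσ1))).const_mul K
      simpa using this
    refine squeeze_zero_norm' ?_ hb
    have hd1 : ∀ᶠ t in 𝓝[>] (0 : ℝ), |m t - m 0| * ‖y - x₀‖ < δ := by
      have : Tendsto (fun t => |m t - m 0| * ‖y - x₀‖) (𝓝[>] 0) (𝓝 0) := by
        simpa using ((hmt.sub_const (m 0)).abs.mul_const ‖y - x₀‖)
      exact this.eventually (gt_mem_nhds hδ)
    filter_upwards [hd1, hst.eventually (gt_mem_nhds hδ), self_mem_nhdsWithin] with t h1 h2 h3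
    have ht : (0 : ℝ) < t := h3
    have htp : 0 < t ^ (2 * σ) := Real.rpow_pos_of_pos ht _
    have hdist : ‖x₀ + m t • (y - x₀) - ys‖ = |m t - m 0| * ‖y - x₀‖ := by
      rw [hys, add_sub_add_left_eq_sub, ← sub_smul, norm_smul, Real.norm_eq_abs]
    have hst0 : 0 ≤ m t * t := (mul_pos (hmpos t) ht).le
    have e1 := hlip (x₀ + m t • (y - x₀)) ys (m t * t) (by rwa [hdist]) (by simpa using hδ) hst0 h2
    have e2 := hlip ys (x₀ + m t • (y - x₀)) (m t * t) (by simpa using hδ) (by rwa [hdist]) hst0 h2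
    rw [norm_sub_rev] at e2
    rw [hdist] at e1 e2
    rw [Real.norm_eq_abs, abs_div, abs_of_pos htp, abs_div, abs_of_pos htp, div_le_iff₀ htp]
    refine (abs_sub_le_iff.mpr ⟨e1, e2⟩).trans (le_of_eq ?_)
    field_simp
  have hver : Tendsto (fun t => (U (ys, m t * t) - U (ys, 0)) / t ^ (2 * σ)) (𝓝[>] 0)
      (𝓝 (-(U (ys, 0) ^ p / (2 * σ)) * m 0 ^ (2 * σ))) := by
    have h1 := Tendsto.comp (show Tendsto _ _ _ from h.hasQ ys hys2 hys0) hst'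
    have h2 : Tendsto (fun t => m t ^ (2 * σ)) (𝓝[>] 0) (𝓝 (m 0 ^ (2 * σ))) :=
      hmt.rpow_const (Or.inr (by linarith))
    refine (h1.mul h2).congr' ?_
    filter_upwards [self_mem_nhdsWithin] with t ht
    have ht' : (0 : ℝ) < t := ht
    have htp : 0 < t ^ (2 * σ) := Real.rpow_pos_of_pos ht' _
    have hmp : 0 < m t ^ (2 * σ) := Real.rpow_pos_of_pos (hmpos t) _
    simp only [Function.comp]
    rw [Real.mul_rpow (hmpos t).le ht'.le]
    field_simp
  have hall := (hAq.mul_const (U (ys, 0))).add (hAt.mul (hhor.add hver))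
  have hA0 : A 0 = m 0 ^ a := by
    simp only [hA, hm]
    have : 0 ≤ (q + 0 ^ 2) ^ (-1 : ℝ) := by positivity
    rw [Real.mul_rpow hL.le this, ← Real.rpow_mul (by positivity), neg_one_mul]
  have hu0 : 0 ≤ U (ys, 0) := h.nonneg _ h4.le le_rfl h0
  have hk0 : kelvin a x₀ L U (y, 0) = A 0 * U (ys, 0) := by
    simp only [kelvin, hI0, hA]
    simp [nsq, hq]
  have hlim : 0 * U (ys, 0) + A 0 * (0 + -(U (ys, 0) ^ p / (2 * σ)) * m 0 ^ (2 * σ)) =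
      -(kelvin a x₀ L U (y, 0) ^ p / (2 * σ)) := by
    rw [hk0, hA0, Real.mul_rpow (Real.rpow_pos_of_pos hm0 a).le hu0, ← Real.rpow_mul hm0.le,
      h.expA_mul_expP, Real.rpow_add hm0]
    ring
  rw [hlim] at hall
  refine hall.congr fun t => ?_
  have hkt : kelvin a x₀ L U (y, t) = A t * U (x₀ + m t • (y - x₀), m t * t) := by
    simp only [kelvin, hI, hA]
    simp [nsq, hq]
  rw [hk0, hkt]
  ring

end KelvinTrace

section MovingSpheres

variable {n : ℕ} {σ : ℝ} {U : Pt n → ℝ} {x₀ : EuclideanSpace ℝ (Fin n)}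

lemma nsq_smul (c : ℝ) (X : Pt n) : nsq (c • X) = c ^ 2 * nsq X := by
  simp only [nsq, Prod.smul_fst, Prod.smul_snd, norm_smul, smul_eq_mul, mul_pow, Real.norm_eq_abs,
    sq_abs]
  ring

lemma nsq_invPt_sub {L : ℝ} {Y : Pt n} (hY : 0 < nsq (Y - (x₀, 0))) :
    nsq (invPt x₀ L Y - (x₀, 0)) = L ^ 2 / nsq (Y - (x₀, 0)) := by
  rw [invPt, add_sub_cancel_left, nsq_smul, Real.rpow_neg_one]
  field_simp

lemma invPt_snd (L : ℝ) (Y : Pt n) : (invPt x₀ L Y).2 = L / nsq (Y - (x₀, 0)) * Y.2 := by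
  simp only [invPt, Real.rpow_neg_one, Prod.snd_add, Prod.smul_snd, Prod.snd_sub, smul_eq_mul]
  ring

lemma invPt_of_eq {L : ℝ} {Y : Pt n} (hL : 0 < L) (hY : nsq (Y - (x₀, 0)) = L) :
    invPt x₀ L Y = Y := by
  rw [invPt, hY, Real.rpow_neg_one, mul_inv_cancel₀ hL.ne', one_smul]
  abel

lemma kelvin_of_eq {a L : ℝ} {Y : Pt n} (hL : 0 < L) (hY : nsq (Y - (x₀, 0)) = L) :
    kelvin a x₀ L U Y = U Y := by
  rw [kelvin, invPt_of_eq hL hY, hY, Sol.rpow_mul_rpow_neg hL, one_mul]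

/-- Points in the ball of radius `‖x₀‖/2` about `x₀` stay away from the singularity. -/
lemma nsq_of_near (h0 : 0 < ‖x₀‖) (h1 : ‖x₀‖ ≤ 1 / 2) {Y : Pt n}
    (hY : nsq (Y - (x₀, 0)) ≤ (‖x₀‖ / 2) ^ 2) : 0 < nsq Y ∧ nsq Y ≤ 1 := by
  have h2 := (enorm'_le_iff (by positivity)).mpr hY
  have h3 := enorm'_sub_le Y (x₀, 0)
  have h4 := enorm'_sub_le (x₀, 0) Y
  rw [enorm'_sub_comm] at h4
  rw [enorm'_trace] at h3 h4
  rw [← enorm'_sq]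
  constructor <;> nlinarith [enorm'_nonneg Y]

lemma invPt_near {l : ℝ} (hl : 0 < l) (hld : l < ‖x₀‖ / 2) {Y : Pt n}
    (hY : l ^ 2 ≤ nsq (Y - (x₀, 0))) :
    nsq (invPt x₀ (l ^ 2) Y - (x₀, 0)) ≤ (‖x₀‖ / 2) ^ 2 := by
  have h1 : 0 < l ^ 2 := by positivity
  rw [nsq_invPt_sub (h1.trans_le hY), div_le_iff₀ (h1.trans_le hY)]
  have h2 : l ^ 2 ≤ (‖x₀‖ / 2) ^ 2 := by gcongr
  calc (l ^ 2) ^ 2 = l ^ 2 * l ^ 2 := by ring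
    _ ≤ (‖x₀‖ / 2) ^ 2 * nsq (Y - (x₀, 0)) := by gcongr

lemma invPt_snd_nonneg {l : ℝ} {Y : Pt n} (hY : 0 ≤ Y.2) : 0 ≤ (invPt x₀ (l ^ 2) Y).2 := by
  rw [invPt_snd]
  have := nsq_nonneg (Y - (x₀, 0))
  positivity

namespace Sol

lemma exists_near_bound (h : Sol n σ U) (h0 : 0 < ‖x₀‖) (h1 : ‖x₀‖ ≤ 1 / 2) :
    ∃ A : ℝ, 0 < A ∧ ∀ Y : Pt n, 0 ≤ Y.2 → nsq (Y - (x₀, 0)) ≤ (‖x₀‖ / 2) ^ 2 → U Y ≤ A := by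
  obtain ⟨A, hA0, hA⟩ := h.exists_bound (C := {Y | nsq (Y - (x₀, 0)) ≤ (‖x₀‖ / 2) ^ 2 ∧ 0 ≤ Y.2})
    (isCompact_of_nsq_sub_le ((isClosed_le (continuous_nsq_sub _) continuous_const).inter
      (isClosed_le continuous_const continuous_snd)) (x₀, 0) (r := (‖x₀‖ / 2) ^ 2)
      fun X hX => hX.1)
    fun X hX => by
      have := nsq_of_near h0 h1 hX.1
      exact ⟨this.2.trans (by norm_num), hX.2, ne_zero_of_nsq_pos this.1⟩
  exact ⟨A, hA0, fun Y h2 h3 => hA Y ⟨h3, h2⟩⟩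

lemma kelvin_nonneg (h : Sol n σ U) (h0 : 0 < ‖x₀‖) (h1 : ‖x₀‖ ≤ 1 / 2)
    {l : ℝ} (hl : 0 < l) (hld : l < ‖x₀‖ / 2) {Y : Pt n} (hY0 : 0 ≤ Y.2)
    (hY : l ^ 2 ≤ nsq (Y - (x₀, 0))) : 0 ≤ kelvin (expA n σ) x₀ (l ^ 2) U Y := by
  have h2 := nsq_of_near h0 h1 (invPt_near hl hld hY)
  exact mul_nonneg (mul_nonneg (by positivity) (Real.rpow_nonneg (nsq_nonneg _) _))
    (h.nonneg _ (h2.2.trans (by norm_num)) (invPt_snd_nonneg hY0) (ne_zero_of_nsq_pos h2.1))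

lemma kelvin_hasL (h : Sol n σ U) (h0 : 0 < ‖x₀‖) (h1 : ‖x₀‖ ≤ 1 / 2)
    {l : ℝ} (hl : 0 < l) (hld : l < ‖x₀‖ / 2) {Y : Pt n} (hY0 : 0 < Y.2)
    (hY : l ^ 2 ≤ nsq (Y - (x₀, 0))) : HasL σ (kelvin (expA n σ) x₀ (l ^ 2) U) Y 0 := by
  have h2 := nsq_of_near h0 h1 (invPt_near hl hld hY)
  refine HasL.kelvin (by positivity) hY0 (h.hasL _ (h2.2.trans_lt (by norm_num)) ?_)
  rw [invPt_snd]
  have h3 : 0 < l ^ 2 := by positivity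
  have := h3.trans_le hY
  positivity

lemma kelvin_hasQ (h : Sol n σ U) (h0 : 0 < ‖x₀‖) (h1 : ‖x₀‖ ≤ 1 / 2)
    {l : ℝ} (hl : 0 < l) (hld : l < ‖x₀‖ / 2) {Y : Pt n} (hY0 : Y.2 = 0)
    (hY : l ^ 2 ≤ nsq (Y - (x₀, 0))) : HasQ σ (kelvin (expA n σ) x₀ (l ^ 2) U) Y.1
      (-(kelvin (expA n σ) x₀ (l ^ 2) U Y ^ expP n σ / (2 * σ))) := by
  have h2 := nsq_of_near h0 h1 (invPt_near hl hld hY)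
  have hYe : Y = (Y.1, 0) := Prod.ext rfl hY0
  have hq : 0 < nsq (Y - (x₀, 0)) := lt_of_lt_of_le (by positivity) hY
  rw [hYe] at h2
  have := h.hasQ_kelvin (L := l ^ 2) (x₀ := x₀) (y := Y.1) (by positivity)
    (fun e => by
      have h3 : Y - (x₀, 0) = 0 := by rw [sub_eq_zero, hYe, e]
      rw [h3] at hq; simp [nsq] at hq)
    (ne_zero_of_nsq_pos h2.1) (h2.2.trans_lt (by norm_num))
  rwa [← hYe] at this

/-- The Kelvin transform, extended evenly in `t`, is jointly continuous in radius and point. -/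
lemma continuousAt_kelvin (h : Sol n σ U) (h0 : 0 < ‖x₀‖) (h1 : ‖x₀‖ ≤ 1 / 2)
    {l : ℝ} (hl : 0 < l) (hld : l < ‖x₀‖ / 2) {Y : Pt n}
    (hY : l ^ 2 ≤ nsq (Y - (x₀, 0))) :
    ContinuousAt (fun z : ℝ × Pt n =>
      kelvin (expA n σ) x₀ (z.1 ^ 2) (fun X => U (X.1, |X.2|)) z.2) (l, Y) := by
  have h2 := nsq_of_near h0 h1 (invPt_near hl hld hY)
  have hq : 0 < nsq (Y - (x₀, 0)) := lt_of_lt_of_le (by positivity) hY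
  have hqc : ContinuousAt (fun z : ℝ × Pt n => nsq (z.2 - (x₀, 0))) (l, Y) :=
    ((continuous_nsq_sub _).comp continuous_snd).continuousAt
  have hpw : ∀ β : ℝ, ContinuousAt (fun z : ℝ × Pt n => nsq (z.2 - (x₀, 0)) ^ β) (l, Y) := fun β =>
    hqc.rpow_const (Or.inl hq.ne')
  have hinv : ContinuousAt (fun z : ℝ × Pt n => invPt x₀ (z.1 ^ 2) z.2) (l, Y) := by
    unfold invPt
    exact continuousAt_const.add (((continuousAt_fst.pow 2).mul (hpw (-1))).smul
      (continuousAt_snd.sub continuousAt_const))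
  have habs : ContinuousAt (fun z : ℝ × Pt n =>
      ((invPt x₀ (z.1 ^ 2) z.2).1, |(invPt x₀ (z.1 ^ 2) z.2).2|)) (l, Y) :=
    hinv.fst.prodMk hinv.snd.abs
  have hns : ∀ X : Pt n, nsq ((X.1, |X.2|) : Pt n) = nsq X := fun X => by simp [nsq]
  have hUc := h.cont ((invPt x₀ (l ^ 2) Y).1, |(invPt x₀ (l ^ 2) Y).2|)
    ⟨by rw [hns]; linarith, abs_nonneg _, ne_zero_of_nsq_pos (by rw [hns]; exact h2.1)⟩
  have hUt : ContinuousAt (fun z : ℝ × Pt n =>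
      U ((invPt x₀ (z.1 ^ 2) z.2).1, |(invPt x₀ (z.1 ^ 2) z.2).2|)) (l, Y) := by
    refine Tendsto.comp hUc (tendsto_nhdsWithin_iff.mpr ⟨habs.tendsto, ?_⟩)
    have e1 := hinv.eventually (eventually_const_lt' continuous_nsq h2.1)
    have e2 := hinv.eventually (eventually_lt_const' continuous_nsq
      (h2.2.trans_lt (by norm_num : (1 : ℝ) < 4)))
    filter_upwards [e1, e2] with z h3 h4
    exact ⟨by rw [hns]; exact h4.le, abs_nonneg _, ne_zero_of_nsq_pos (by rw [hns]; exact h3)⟩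
  have hl2 : ContinuousAt (fun z : ℝ × Pt n => (z.1 ^ 2) ^ expA n σ) (l, Y) :=
    (continuousAt_fst.pow 2).rpow_const (Or.inl (pow_pos hl 2).ne')
  exact (hl2.mul (hpw _)).mul hUt

lemma kelvin_abs {a l : ℝ} {Y : Pt n} (hY : 0 ≤ Y.2) :
    kelvin a x₀ (l ^ 2) (fun X => U (X.1, |X.2|)) Y = kelvin a x₀ (l ^ 2) U Y := by
  simp only [kelvin, abs_of_nonneg (invPt_snd_nonneg hY)]

lemma kelvin_le {a l A : ℝ} (hl : 0 < l) (hld : l < ‖x₀‖ / 2)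
    (hA : ∀ Y : Pt n, 0 ≤ Y.2 → nsq (Y - (x₀, 0)) ≤ (‖x₀‖ / 2) ^ 2 → U Y ≤ A) {Y : Pt n}
    (hY0 : 0 ≤ Y.2) (hY : l ^ 2 ≤ nsq (Y - (x₀, 0))) :
    kelvin a x₀ (l ^ 2) U Y ≤ (l ^ 2) ^ a * nsq (Y - (x₀, 0)) ^ (-a) * A :=
  mul_le_mul_of_nonneg_left (hA _ (invPt_snd_nonneg hY0) (invPt_near hl hld hY))
    (mul_nonneg (by positivity) (Real.rpow_nonneg (nsq_nonneg _) _))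

/-- Maximum principle for `U - U_λ` in a narrow half-annulus outside the sphere. -/
lemma exists_narrow (h : Sol n σ U) (h0 : 0 < ‖x₀‖) (h1 : ‖x₀‖ ≤ 1 / 2) {l₁ : ℝ} (hl₁ : 0 < l₁)
    (hld : l₁ < ‖x₀‖ / 2) : ∃ δ : ℝ, 0 < δ ∧ l₁ ^ 2 + δ ≤ (‖x₀‖ / 2) ^ 2 ∧ ∀ l : ℝ, 0 < l → l ≤ l₁ →
      (∀ Y : Pt n, 0 ≤ Y.2 → nsq (Y - (x₀, 0)) = l ^ 2 + δ →
        kelvin (expA n σ) x₀ (l ^ 2) U Y ≤ U Y) →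
      ∀ Y : Pt n, 0 ≤ Y.2 → l ^ 2 ≤ nsq (Y - (x₀, 0)) → nsq (Y - (x₀, 0)) ≤ l ^ 2 + δ →
        kelvin (expA n σ) x₀ (l ^ 2) U Y ≤ U Y := by
  have hσ0 := h.hσ0
  have hσ1 := h.hσ1
  have hn := h.hn
  have hp := h.one_lt_expP
  obtain ⟨A, hA0, hA⟩ := h.exists_near_bound h0 h1
  set a := expA n σ with ha
  set p := expP n σ with hpdef
  set E := p * A ^ (p - 1) / σ + 1 with hE
  have hAp : 0 < A ^ (p - 1) := Real.rpow_pos_of_pos hA0 _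
  have hE0 : 0 < E := by positivity
  obtain ⟨t₁, ht₁, hEt⟩ : ∃ t : ℝ, 0 < t ∧ E * t ^ (2 * σ) ≤ 1 / 2 := by
    have h1 : Tendsto (fun r : ℝ => E * r ^ (2 * σ)) (𝓝[>] 0) (𝓝 0) := by
      have := ((Real.continuousAt_rpow_const 0 (2 * σ) (Or.inr (by linarith))).tendsto).const_mul E
      rw [Real.zero_rpow (by linarith), mul_zero] at this
      exact this.mono_left nhdsWithin_le_nhds
    obtain ⟨r, h4, h6⟩ := ((h1.eventually (Iic_mem_nhds (by norm_num : (0 : ℝ) < 1 / 2))).and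
      self_mem_nhdsWithin).exists
    exact ⟨r, h6, h4⟩
  set B := 1 / t₁ ^ 2 with hB
  have hB0 : 0 < B := by positivity
  have hEB : ∀ t : ℝ, 0 ≤ t → t ≤ 1 → E * t ^ (2 * σ) ≤ 1 / 2 + E * B * t ^ 2 := fun t h2 h3 => by
    rcases le_total t t₁ with h4 | h4
    · have : t ^ (2 * σ) ≤ t₁ ^ (2 * σ) := Real.rpow_le_rpow h2 h4 (by linarith)
      have : E * t ^ (2 * σ) ≤ E * t₁ ^ (2 * σ) := by gcongr
      have : 0 ≤ E * B * t ^ 2 := by positivity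
      linarith
    · have h5 : t ^ (2 * σ) ≤ 1 := Real.rpow_le_one h2 h3 (by linarith)
      have h6 : 1 ≤ B * t ^ 2 := by
        rw [hB, one_div_mul_eq_div, one_le_div (by positivity)]; gcongr
      have : E * t ^ (2 * σ) ≤ E * 1 := by gcongr
      have : E * 1 ≤ E * (B * t ^ 2) := by gcongr
      linarith
  set Q := 2 * (E * B) + 1 with hQ
  have hQ0 : 0 < Q := by positivity
  obtain ⟨δ, hδ0, hδQ, hδd⟩ : ∃ δ : ℝ, 0 < δ ∧ Q * δ ≤ 1 / 2 ∧ l₁ ^ 2 + δ ≤ (‖x₀‖ / 2) ^ 2 := by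
    have h2 : 0 < (‖x₀‖ / 2) ^ 2 - l₁ ^ 2 := by rw [sub_pos]; gcongr
    refine ⟨min (1 / (2 * Q)) ((‖x₀‖ / 2) ^ 2 - l₁ ^ 2), lt_min (by positivity) h2, ?_, ?_⟩
    · calc Q * _ ≤ Q * (1 / (2 * Q)) := by gcongr; exact min_le_left _ _
        _ = 1 / 2 := by field_simp
    · linarith [min_le_right (1 / (2 * Q)) ((‖x₀‖ / 2) ^ 2 - l₁ ^ 2)]
  refine ⟨δ, hδ0, hδd, fun l hl hll hbd => ?_⟩
  have hld' : l < ‖x₀‖ / 2 := hll.trans_lt hld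
  have hl2 : 0 < l ^ 2 := by positivity
  have hll2 : l ^ 2 ≤ l₁ ^ 2 := by gcongr
  set V := kelvin a x₀ (l ^ 2) U with hV
  set C : Set (Pt n) := {X | l ^ 2 ≤ nsq (X - (x₀, 0)) ∧ nsq (X - (x₀, 0)) ≤ l ^ 2 + δ} with hC
  have hCc : IsCompact C := isCompact_of_nsq_sub_le
    ((isClosed_le continuous_const (continuous_nsq_sub _)).inter
      (isClosed_le (continuous_nsq_sub _) continuous_const)) (x₀, 0) (r := l ^ 2 + δ)
      fun X hX => hX.2
  have hCn : ∀ X ∈ C, nsq (X - (x₀, 0)) ≤ (‖x₀‖ / 2) ^ 2 := fun X hX => by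
    have := hX.2; linarith
  have hCs : ∀ X ∈ C, 0 < nsq X ∧ nsq X ≤ 1 := fun X hX => nsq_of_near h0 h1 (hCn X hX)
  have hVc : ContinuousOn V (C ∩ {X | 0 ≤ X.2}) := by
    have : ContinuousOn (kelvin a x₀ (l ^ 2) fun X => U (X.1, |X.2|)) (C ∩ {X | 0 ≤ X.2}) :=
      fun X hX => (ContinuousAt.comp (f := fun X : Pt n => (l, X))
        (h.continuousAt_kelvin h0 h1 hl hld' hX.1.1)
        (continuousAt_const.prodMk continuousAt_id)).continuousWithinAt
    exact this.congr fun X hX => (kelvin_abs hX.2).symm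
  have hΦe : ∀ X : Pt n, quadBar σ 0 x₀ (2 + Q * l ^ 2) 0 0 (-Q) 0 (E * B - Q) 0 E X =
      2 - Q * (nsq (X - (x₀, 0)) - l ^ 2) - E * X.2 ^ (2 * σ) + E * B * X.2 ^ 2 := fun X => by
    simp only [quadBar, quadP, inner_zero_left, nsq, Prod.fst_sub, Prod.snd_sub, sub_zero]
    ring
  have hΦ1 : ∀ X ∈ C, 0 ≤ X.2 →
      0 < quadBar σ 0 x₀ (2 + Q * l ^ 2) 0 0 (-Q) 0 (E * B - Q) 0 E X := fun X hX ht => by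
    rw [hΦe]
    have h2 := hEB X.2 ht (by
      have := (hCs X hX).2
      unfold nsq at this; nlinarith [sq_nonneg ‖X.1‖])
    have h3 : Q * (nsq (X - (x₀, 0)) - l ^ 2) ≤ Q * δ := by
      have := hX.2
      gcongr; linarith
    linarith
  have key := comparison (σ := σ) hCc (w := fun X => U X - V X)
    ((h.cont.mono fun X hX => ⟨(hCs X hX.1).2.trans (by norm_num), hX.2,
      ne_zero_of_nsq_pos (hCs X hX.1).1⟩).sub hVc)
    (continuous_quadBar hσ0 0 x₀ (2 + Q * l ^ 2) 0 0 (-Q) 0 (E * B - Q) 0 E).continuousOn hΦ1 ?_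
  · intro Y hY0 hY1 hY2
    have := key Y ⟨hY1, hY2⟩ hY0
    linarith
  intro X hX ht hneg
  have hX0 := ne_zero_of_nsq_pos (hCs X hX).1
  have hX4 : nsq X < 4 := (hCs X hX).2.trans_lt (by norm_num)
  have hX1 : l ^ 2 < nsq (X - (x₀, 0)) := hX.1.lt_of_ne fun e => by
    simp only [hV, kelvin_of_eq hl2 e.symm, sub_self] at hneg
    exact lt_irrefl _ hneg
  have hX2 : nsq (X - (x₀, 0)) < l ^ 2 + δ := hX.2.lt_of_ne fun e => by
    have := hbd X ht e
    simp only [hV] at hneg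
    linarith
  refine ⟨?_, fun ht' => ?_, fun ht' => ?_⟩
  · filter_upwards [eventually_const_lt' (continuous_nsq_sub _) hX1,
      eventually_lt_const' (continuous_nsq_sub _) hX2] with Z h1 h2
    exact ⟨h1.le, h2.le⟩
  · have e1 : HasL σ (fun X => U X - V X) X (0 - 0) :=
      (h.hasL X hX4 ht').sub (h.kelvin_hasL h0 h1 hl hld' ht' hX.1)
    refine ⟨_, _, e1, hasL_quadBar 0 x₀ (2 + Q * l ^ 2) 0 0 (-Q) 0 (E * B - Q) 0 E ht', by simp, ?_⟩
    have e2 : (1 - 2 * σ) * (X.2 - 0) / X.2 = 1 - 2 * σ := by rw [sub_zero]; field_simp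
    rw [e2]
    have hEB0 : 0 < E * B := by positivity
    simp only [norm_zero]
    nlinarith [mul_nonneg (by linarith : (0 : ℝ) ≤ n - 2) hQ0.le, mul_pos hσ0 hEB0]
  · have e1 : HasQ σ (fun X => U X - V X) X.1
        (-(U X ^ p / (2 * σ)) - -(V X ^ p / (2 * σ))) :=
      (h.hasQ_trace hX4 hX0 ht').sub (h.kelvin_hasQ h0 h1 hl hld' ht' hX.1)
    refine ⟨_, _, e1, hasQ_quadBar hσ0 hσ1 0 x₀ (2 + Q * l ^ 2) 0 0 (-Q) 0 (E * B - Q) E X.1, ?_⟩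
    have hΦp := hΦ1 X hX ht
    have hΦ2 : quadBar σ 0 x₀ (2 + Q * l ^ 2) 0 0 (-Q) 0 (E * B - Q) 0 E X ≤ 2 := by
      rw [hΦe, ht', Real.zero_rpow (by linarith)]
      have : 0 ≤ Q * (nsq (X - (x₀, 0)) - l ^ 2) := mul_nonneg hQ0.le (by linarith)
      linarith
    set Φ := quadBar σ 0 x₀ (2 + Q * l ^ 2) 0 0 (-Q) 0 (E * B - Q) 0 E X
    have hU0 := h.nonneg X hX4.le ht hX0
    have hVA : V X ≤ A := by
      refine (kelvin_le hl hld' hA ht hX.1).trans ?_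
      have h2 : nsq (X - (x₀, 0)) ^ (-a) ≤ (l ^ 2) ^ (-a) := rpow_le_rpow_neg hl2 hX.1 h.expA_pos.le
      calc (l ^ 2) ^ a * nsq (X - (x₀, 0)) ^ (-a) * A ≤ (l ^ 2) ^ a * (l ^ 2) ^ (-a) * A := by gcongr
        _ = A := by rw [rpow_mul_rpow_neg hl2, one_mul]
    have h3 := rpow_sub_rpow_le hU0 (by linarith : U X ≤ V X) hVA hp.le
    have h4 : V X ^ p / (2 * σ) - U X ^ p / (2 * σ) ≤ (E - 1) / 2 * (V X - U X) := by
      rw [← sub_div, div_le_iff₀ (by positivity), hE]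
      refine h3.trans (le_of_eq ?_)
      field_simp
      ring
    have hd : 0 < V X - U X := by linarith
    have hE1 : 0 ≤ (E - 1) / 2 * (V X - U X) := by
      have : 0 ≤ E - 1 := by rw [hE, add_sub_cancel_right]; positivity
      positivity
    calc (-(U X ^ p / (2 * σ)) - -(V X ^ p / (2 * σ))) * Φ
        = (V X ^ p / (2 * σ) - U X ^ p / (2 * σ)) * Φ := by ring
      _ ≤ ((E - 1) / 2 * (V X - U X)) * Φ := by gcongr
      _ ≤ ((E - 1) / 2 * (V X - U X)) * 2 := by gcongr
      _ < (U X - V X) * (-(0 * quadP 0 x₀ (2 + Q * l ^ 2) 0 0 (-Q) X.1) - E) := by nlinarith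

/-- If the Kelvin transform stays below `ε/2` on the outer sphere for every radius up to `l₁`,
then `U` dominates all of these Kelvin transforms outside their spheres. -/
theorem movingSpheres (h : Sol n σ U) (h0 : 0 < ‖x₀‖) (h1 : ‖x₀‖ ≤ 1 / 2) {ε l₁ : ℝ} (hε : 0 < ε)
    (hUε : ∀ Y : Pt n, 0 ≤ Y.2 → Y ≠ 0 → nsq Y ≤ 1 → ε ≤ U Y) (hl₁ : 0 < l₁)
    (hld : l₁ < ‖x₀‖ / 2)
    (hout : ∀ l : ℝ, 0 < l → l ≤ l₁ → ∀ Y : Pt n, 0 ≤ Y.2 → nsq Y = 1 →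
      kelvin (expA n σ) x₀ (l ^ 2) U Y ≤ ε / 2)
    {Y : Pt n} (hY0 : 0 ≤ Y.2) (hYne : Y ≠ 0) (hY1 : nsq Y ≤ 1) (hYl : l₁ ^ 2 ≤ nsq (Y - (x₀, 0))) :
    kelvin (expA n σ) x₀ (l₁ ^ 2) U Y ≤ U Y := by
  have hσ0 := h.hσ0
  have hσ1 := h.hσ1
  have ha0 := h.expA_pos
  have hp := h.one_lt_expP
  obtain ⟨A, hA0, hA⟩ := h.exists_near_bound h0 h1
  obtain ⟨δ, hδ0, hδd, hnar⟩ := h.exists_narrow h0 h1 hl₁ hld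
  set a := expA n σ with ha
  set P : Set ℝ := {l | ∀ Y : Pt n, 0 ≤ Y.2 → Y ≠ 0 → nsq Y ≤ 1 → l ^ 2 ≤ nsq (Y - (x₀, 0)) →
    kelvin a x₀ (l ^ 2) U Y ≤ U Y} with hP
  -- it suffices to dominate outside the narrow half-annulus
  have hred : ∀ l : ℝ, 0 < l → l ≤ l₁ → (∀ Y : Pt n, 0 ≤ Y.2 → Y ≠ 0 → nsq Y ≤ 1 →
      l ^ 2 + δ ≤ nsq (Y - (x₀, 0)) → kelvin a x₀ (l ^ 2) U Y ≤ U Y) → l ∈ P := by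
    intro l hl hll hfar Y hY0 hYne hY1 hYl
    have hll2 : l ^ 2 ≤ l₁ ^ 2 := by gcongr
    rcases le_total (l ^ 2 + δ) (nsq (Y - (x₀, 0))) with h2 | h2
    · exact hfar Y hY0 hYne hY1 h2
    · refine hnar l hl hll (fun Z hZ0 hZ => ?_) Y hY0 hYl h2
      have h3 := nsq_of_near h0 h1 (by rw [hZ]; linarith : nsq (Z - (x₀, 0)) ≤ (‖x₀‖ / 2) ^ 2)
      exact hfar Z hZ0 (ne_zero_of_nsq_pos h3.1) h3.2 hZ.ge
  obtain ⟨l₀, hl₀, hl₀₁, hsmall⟩ : ∃ l₀ : ℝ, 0 < l₀ ∧ l₀ ≤ l₁ ∧ (l₀ ^ 2) ^ a * δ ^ (-a) * A ≤ ε := by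
    have e1 : Tendsto (fun l : ℝ => (l ^ 2) ^ a * δ ^ (-a) * A) (𝓝[>] 0) (𝓝 0) := by
      have : ContinuousAt (fun l : ℝ => (l ^ 2) ^ a * δ ^ (-a) * A) 0 :=
        (((continuousAt_id.pow 2).rpow_const (Or.inr ha0.le)).mul continuousAt_const).mul
          continuousAt_const
      have := this.tendsto
      simp only [ne_eq, OfNat.ofNat_ne_zero, not_false_eq_true, zero_pow, Real.zero_rpow ha0.ne',
        zero_mul] at this
      exact this.mono_left nhdsWithin_le_nhds
    have e2 : ∀ᶠ r : ℝ in 𝓝[>] 0, r ≤ l₁ := nhdsWithin_le_nhds (Iic_mem_nhds hl₁)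
    obtain ⟨r, h4, h5, h6⟩ := ((e1.eventually (Iic_mem_nhds hε)).and
      (e2.and self_mem_nhdsWithin)).exists
    exact ⟨r, h6, h5, h4⟩
  have hstart : l₀ ∈ P := by
    refine hred l₀ hl₀ hl₀₁ fun Y hY0 hYne hY1 hYδ => ?_
    have h2 : l₀ ^ 2 ≤ nsq (Y - (x₀, 0)) := by linarith
    have h3 : nsq (Y - (x₀, 0)) ^ (-a) ≤ δ ^ (-a) :=
      rpow_le_rpow_neg hδ0 (by nlinarith [sq_nonneg l₀]) ha0.le
    calc kelvin a x₀ (l₀ ^ 2) U Y ≤ (l₀ ^ 2) ^ a * nsq (Y - (x₀, 0)) ^ (-a) * A :=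
          kelvin_le hl₀ (hl₀₁.trans_lt hld) hA hY0 h2
      _ ≤ (l₀ ^ 2) ^ a * δ ^ (-a) * A := by gcongr
      _ ≤ ε := hsmall
      _ ≤ U Y := hUε Y hY0 hYne hY1
  have hclosed : IsClosed (P ∩ Set.Icc l₀ l₁) := by
    refine isClosed_of_closure_subset fun l hl => ?_
    have hlI : l ∈ Set.Icc l₀ l₁ :=
      isClosed_Icc.closure_subset (closure_mono Set.inter_subset_right hl)
    refine ⟨fun Y hY0 hYne hY1 hYl => ?_, hlI⟩
    have hl0 : 0 < l := hl₀.trans_le hlI.1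
    rcases hYl.eq_or_lt with e | hlt
    · exact (kelvin_of_eq (by positivity) e.symm).le
    by_contra! hcon
    have hcont : ContinuousAt (fun l : ℝ => kelvin a x₀ (l ^ 2) (fun X => U (X.1, |X.2|)) Y) l :=
      ContinuousAt.comp (f := fun l : ℝ => (l, Y))
        (h.continuousAt_kelvin h0 h1 hl0 (hlI.2.trans_lt hld) hYl)
        (continuousAt_id.prodMk continuousAt_const)
    simp only [kelvin_abs hY0] at hcont
    have e1 := hcont.eventually (lt_mem_nhds hcon)
    have e2 : ∀ᶠ l' in 𝓝 l, l' ^ 2 < nsq (Y - (x₀, 0)) :=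
      (continuousAt_id.pow 2).eventually (gt_mem_nhds hlt)
    obtain ⟨l', ⟨h2, -⟩, h3, h4⟩ := ((mem_closure_iff_frequently.mp hl).and_eventually
      (e1.and e2)).exists
    exact absurd (h2 Y hY0 hYne hY1 h4.le) (not_le.mpr h3)
  have hopen : ∀ l ∈ P ∩ Set.Ico l₀ l₁, P ∈ 𝓝[>] l := by
    rintro l ⟨hlP, hl1, hl2⟩
    have hl0 : 0 < l := hl₀.trans_le hl1
    have hll0 : 0 < l ^ 2 := by positivity
    have hld' : l < ‖x₀‖ / 2 := hl2.trans hld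
    set V := kelvin a x₀ (l ^ 2) U with hV
    set g : ℝ → ℝ := fun q => ε / 2 * (1 - (l ^ 2) ^ a * q ^ (-a)) with hg
    have hla : 0 < (l ^ 2) ^ a := Real.rpow_pos_of_pos hll0 _
    have hg_le : ∀ q : ℝ, 0 < q → g q ≤ ε / 2 := fun q hq => by
      have : 0 < (l ^ 2) ^ a * q ^ (-a) := mul_pos hla (Real.rpow_pos_of_pos hq _)
      simp only [hg]; nlinarith
    have hstrict : ∀ Y : Pt n, 0 ≤ Y.2 → Y ≠ 0 → nsq Y ≤ 1 → l ^ 2 ≤ nsq (Y - (x₀, 0)) →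
        V Y + g (nsq (Y - (x₀, 0))) ≤ U Y := by
      intro Y hY0 hYne hY1 hYl
      have keyη : ∀ η : ℝ, 0 < η → 0 ≤ U Y - V Y - ε / 2 * (1 - (l ^ 2) ^ a * radial (x₀, 0) a Y) +
          η * radial (0, 0) a Y := by
        intro η hη
        obtain ⟨r, hr0, hrY, hrm⟩ : ∃ r : ℝ, 0 < r ∧ r ≤ nsq Y ∧ ε / η ≤ r ^ (-a) := by
          have h1 := (tendsto_rpow_neg_nhdsGT_zero (y := -a) (by linarith)).eventually_ge_atTop
            (ε / η)
          have h2 : ∀ᶠ r : ℝ in 𝓝[>] 0, r ≤ nsq Y :=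
            nhdsWithin_le_nhds (Iic_mem_nhds (nsq_pos hYne))
          obtain ⟨r, h3, h4, h5⟩ := (h1.and (h2.and self_mem_nhdsWithin)).exists
          exact ⟨r, h5, h4, h3⟩
        rw [div_le_iff₀' hη] at hrm
        set C : Set (Pt n) := {X | nsq (X - (0, 0)) ≤ 1 ∧ l ^ 2 ≤ nsq (X - (x₀, 0)) ∧ r ≤ nsq X}
          with hC
        have hz : ∀ X : Pt n, X - (0, 0) = X := fun X => by rw [← Prod.zero_eq_mk, sub_zero]
        have hCc : IsCompact C := isCompact_of_nsq_sub_le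
          ((isClosed_le (continuous_nsq_sub _) continuous_const).inter
            ((isClosed_le continuous_const (continuous_nsq_sub _)).inter
              (isClosed_le continuous_const continuous_nsq))) (0, 0) (r := 1) fun X hX => hX.1
        have hC1 : ∀ X ∈ C, nsq X ≤ 1 := fun X hX => by have := hX.1; rwa [hz] at this
        have hne : ∀ X ∈ C, X ≠ 0 := fun X hX => ne_zero_of_nsq_pos (hr0.trans_le hX.2.2)
        have hVc : ContinuousOn V (C ∩ {X | 0 ≤ X.2}) := by
          have : ContinuousOn (kelvin a x₀ (l ^ 2) fun X => U (X.1, |X.2|)) (C ∩ {X | 0 ≤ X.2}) :=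
            fun X hX => (ContinuousAt.comp (f := fun X : Pt n => (l, X))
              (h.continuousAt_kelvin h0 h1 hl0 hld' hX.1.2.1)
              (continuousAt_const.prodMk continuousAt_id)).continuousWithinAt
          exact this.congr fun X hX => (kelvin_abs hX.2).symm
        refine h.minPrinciple hCc (fun X hX => (hC1 X hX).trans (by norm_num))
          (w := fun X => U X - V X - ε / 2 * (1 - (l ^ 2) ^ a * radial (x₀, 0) a X) +
            η * radial (0, 0) a X)
          ((((h.cont.mono fun X hX => ⟨(hC1 X hX.1).trans (by norm_num), hX.2, hne X hX.1⟩).sub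
            hVc).sub (continuousOn_const.mul (continuousOn_const.sub (continuousOn_const.mul
            (continuousOn_radial _ _ fun X hX => hll0.trans_le hX.1.2.1))))).add
            (continuousOn_const.mul (continuousOn_radial _ _ fun X hX =>
              by rw [hz]; exact nsq_pos (hne X hX.1)))) ?_ Y ⟨by rwa [hz], hYl, hrY⟩ hY0
        intro X hX ht hneg
        have hX1 := hC1 X hX
        have hX4 : nsq X < 4 := hX1.trans_lt (by norm_num)
        have hUV : V X ≤ U X := hlP X ht (hne X hX) hX1 hX.2.1
        have hV0 : 0 ≤ V X := h.kelvin_nonneg h0 h1 hl0 hld' ht hX.2.1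
        have hgX : ε / 2 * (1 - (l ^ 2) ^ a * radial (x₀, 0) a X) ≤ ε / 2 :=
          hg_le _ (hll0.trans_le hX.2.1)
        have hrad : 0 ≤ η * radial (0, 0) a X := mul_nonneg hη.le (Real.rpow_nonneg (nsq_nonneg _) _)
        have hXl : l ^ 2 < nsq (X - (x₀, 0)) := hX.2.1.lt_of_ne fun e => by
          have : (l ^ 2) ^ a * radial (x₀, 0) a X = 1 := by
            simp only [radial, ← e, rpow_mul_rpow_neg hll0]
          rw [this] at hneg
          linarith
        have hXe : nsq X < 1 := hX1.lt_of_ne fun e => by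
          have h2 := hout l hl0 hl2.le X ht e
          have h3 := hUε X ht (hne X hX) hX1
          simp only [hV] at hneg
          linarith
        have hXr : r < nsq X := hX.2.2.lt_of_ne fun e => by
          have : radial (0, 0) a X = r ^ (-a) := by simp only [radial, hz, e]
          rw [this] at hneg
          linarith
        refine ⟨?_, fun ht' => ?_, fun ht' => ?_⟩
        · filter_upwards [eventually_const_lt' (continuous_nsq_sub _) hXl,
            eventually_lt_const' continuous_nsq hXe,
            eventually_const_lt' continuous_nsq hXr] with Z h1 h2 h3
          exact ⟨by rw [hz]; exact h2.le, h1.le, h3.le⟩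
        · have e1 : HasL σ (fun X => U X - V X - ε / 2 * (1 - (l ^ 2) ^ a * radial (x₀, 0) a X) +
              η * radial (0, 0) a X) X (0 - 0 - ε / 2 * (0 - (l ^ 2) ^ a * 0) + η * 0) :=
            (((h.hasL X hX4 ht').sub (h.kelvin_hasL h0 h1 hl0 hld' ht' hX.2.1)).sub
              (((HasL.const 1).sub ((hasL_radial_trace x₀ ht').const_mul _)).const_mul _)).add
              ((hasL_radial_trace 0 ht').const_mul η)
          exact ⟨_, e1, by simp⟩
        · have hx1 : X.1 ≠ x₀ := fun e => by
            have : X - (x₀, 0) = 0 := by rw [sub_eq_zero]; exact Prod.ext e ht'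
            rw [this] at hXl
            simp [nsq] at hXl; linarith
          have hx0 : X.1 ≠ 0 := fun e => hne X hX (Prod.ext e ht')
          have e1 : HasQ σ (fun X => U X - V X - ε / 2 * (1 - (l ^ 2) ^ a * radial (x₀, 0) a X) +
              η * radial (0, 0) a X) X.1 (-(U X ^ expP n σ / (2 * σ)) - -(V X ^ expP n σ / (2 * σ)) -
                ε / 2 * (0 - (l ^ 2) ^ a * 0) + η * 0) :=
            (((h.hasQ_trace hX4 (hne X hX) ht').sub (h.kelvin_hasQ h0 h1 hl0 hld' ht' hX.2.1)).sub
              (((HasQ.const 1).sub ((hasQ_radial hσ1 a hx1).const_mul _)).const_mul _)).add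
              ((hasQ_radial hσ1 a hx0).const_mul η)
          refine ⟨_, e1, ?_⟩
          have h2 : V X ^ expP n σ / (2 * σ) ≤ U X ^ expP n σ / (2 * σ) := by gcongr
          simp only [mul_zero, sub_zero, add_zero]
          linarith
      have hpos : 0 < nsq Y ^ (-a) := Real.rpow_pos_of_pos (nsq_pos hYne) _
      refine le_of_forall_pos_le_add fun η hη => ?_
      have h3 := keyη (η / nsq Y ^ (-a)) (by positivity)
      simp only [radial, ← Prod.zero_eq_mk, sub_zero, div_mul_cancel₀ _ hpos.ne'] at h3
      simp only [hg]
      linarith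
    set K : Set (Pt n) := {X | nsq (X - (0, 0)) ≤ 1 ∧ l ^ 2 + δ ≤ nsq (X - (x₀, 0)) ∧ 0 ≤ X.2}
      with hK
    have hKc : IsCompact K := isCompact_of_nsq_sub_le
      ((isClosed_le (continuous_nsq_sub _) continuous_const).inter
        ((isClosed_le continuous_const (continuous_nsq_sub _)).inter
          (isClosed_le continuous_const continuous_snd))) (0, 0) (r := 1) fun X hX => hX.1
    have hgδ : 0 < g (l ^ 2 + δ) := by
      have h2 : (l ^ 2 + δ) ^ (-a) < (l ^ 2) ^ (-a) :=
        Real.rpow_lt_rpow_of_neg hll0 (by linarith) (by linarith)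
      have h3 : (l ^ 2) ^ a * (l ^ 2 + δ) ^ (-a) < 1 := by
        rw [← rpow_mul_rpow_neg hll0 a]; gcongr
      simp only [hg]
      have : 0 < 1 - (l ^ 2) ^ a * (l ^ 2 + δ) ^ (-a) := by linarith
      positivity
    have hev : ∀ᶠ l' in 𝓝 l, ∀ X ∈ K, kelvin a x₀ (l' ^ 2) (fun X => U (X.1, |X.2|)) X -
        kelvin a x₀ (l ^ 2) (fun X => U (X.1, |X.2|)) X < g (l ^ 2 + δ) := by
      refine hKc.eventually_forall_of_forall_eventually fun X hX => ?_
      have hXl : l ^ 2 ≤ nsq (X - (x₀, 0)) := by have := hX.2.1; linarith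
      have c1 : ContinuousAt (fun z : ℝ × Pt n =>
          kelvin a x₀ (z.1 ^ 2) (fun X => U (X.1, |X.2|)) z.2) (l, X) :=
        h.continuousAt_kelvin h0 h1 hl0 hld' hXl
      have c2 : ContinuousAt (fun z : ℝ × Pt n =>
          kelvin a x₀ (l ^ 2) (fun X => U (X.1, |X.2|)) z.2) (l, X) :=
        ContinuousAt.comp (x := ((l, X) : ℝ × Pt n)) (f := fun z : ℝ × Pt n => (l, z.2))
          (g := fun z : ℝ × Pt n => kelvin a x₀ (z.1 ^ 2) (fun X => U (X.1, |X.2|)) z.2) c1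
          (continuousAt_const.prodMk continuousAt_snd)
      exact Tendsto.eventually_lt_const
        (show kelvin a x₀ (l ^ 2) (fun X => U (X.1, |X.2|)) X -
          kelvin a x₀ (l ^ 2) (fun X => U (X.1, |X.2|)) X < g (l ^ 2 + δ) by rwa [sub_self])
        (c1.sub c2).tendsto
    have hlt : ∀ᶠ l' in 𝓝[>] l, l' ≤ l₁ := nhdsWithin_le_nhds (Iic_mem_nhds hl2)
    filter_upwards [nhdsWithin_le_nhds hev, hlt, self_mem_nhdsWithin] with l' h2 h3 h4
    have h4' : l < l' := h4
    refine hred l' (hl0.trans h4') h3 fun X hX0 hXne hX1 hXδ => ?_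
    have hll' : l ^ 2 ≤ l' ^ 2 := by gcongr
    have hXδ' : l ^ 2 + δ ≤ nsq (X - (x₀, 0)) := by linarith
    have h5 := h2 X ⟨by rwa [← Prod.zero_eq_mk, sub_zero], hXδ', hX0⟩
    rw [kelvin_abs hX0, kelvin_abs hX0] at h5
    have h6 := hstrict X hX0 hXne hX1 (by linarith)
    have h7 : g (l ^ 2 + δ) ≤ g (nsq (X - (x₀, 0))) := by
      have : nsq (X - (x₀, 0)) ^ (-a) ≤ (l ^ 2 + δ) ^ (-a) :=
        rpow_le_rpow_neg (by positivity) hXδ' ha0.le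
      simp only [hg]
      gcongr
    simp only [hV] at h6
    linarith
  exact hclosed.Icc_subset_of_forall_mem_nhdsWithin hstart hopen (Set.right_mem_Icc.mpr hl₀₁)
    Y hY0 hYne hY1 hYl

end Sol

end MovingSpheres

section Harnack

variable {n : ℕ} {σ : ℝ} {U : Pt n → ℝ}

lemma nsq_mk_sub (z : EuclideanSpace ℝ (Fin n)) (τ : ℝ) (Y : Pt n) :
    nsq (Y - (z, τ)) = ‖Y.1 - z‖ ^ 2 + (Y.2 - τ) ^ 2 := rfl

namespace Sol

/-- The exponent used for the interior propagation of lower bounds. -/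
def spreadExp (n : ℕ) (σ : ℝ) : ℝ := n + 4 / aspect n σ

/-- The interior gradient bound keeps `U` above half its value on a small horizontal disc. -/
lemma half_le_on_disc (h : Sol n σ U) {x : EuclideanSpace ℝ (Fin n)} {t q A : ℝ} (hA : 1 ≤ A)
    (hq : 0 < q) (hqt : q ≤ t / 2) (hx : ‖x‖ ≤ 1 / 2) (ht : t ≤ 1 / 2)
    (hM : 0 ≤ U (x, t)) (hU : ∀ Y : Pt n, nsq (Y - (x, t)) ≤ q ^ 2 → U Y ≤ A * U (x, t))
    {y : EuclideanSpace ℝ (Fin n)} (hy : ‖y - x‖ ≤ q / (2 * (n + 2) * A)) :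
    U (x, t) / 2 ≤ U (y, t) := by
  have hn := h.hn
  rcases eq_or_ne x y with rfl | hne
  · linarith
  have hd : 0 < ‖x - y‖ := norm_pos_iff.mpr (sub_ne_zero.mpr hne)
  rw [norm_sub_rev] at hy
  have hϱq : q / (2 * (n + 2) * A) ≤ q / 8 := by
    gcongr
    nlinarith
  set z := (1 / 2 : ℝ) • (x + y) with hz
  set e := (1 / ‖x - y‖) • (x - y) with he
  have hse : (‖x - y‖ / 2) • e = (1 / 2 : ℝ) • (x - y) := by
    rw [he, smul_smul]; congr 1; field_simp
  have hzx : ‖z - x‖ = ‖x - y‖ / 2 := by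
    have : z - x = (-(1 / 2) : ℝ) • (x - y) := by rw [hz]; module
    rw [this, norm_smul, Real.norm_eq_abs, abs_of_neg (by norm_num)]
    ring
  have hball : ∀ Y : Pt n, nsq (Y - (z, t)) ≤ (q / 2) ^ 2 → enorm' (Y - (x, t)) ≤ q :=
      fun Y hY => by
    have h1 := (enorm'_le_iff (by positivity)).mpr hY
    have h2 := enorm'_sub_le (Y - (x, t)) ((z, t) - (x, t))
    rw [sub_sub_sub_cancel_right, show ((z, t) : Pt n) - (x, t) = (z - x, 0) by simp,
      enorm'_trace] at h2
    linarith
  have hX : enorm' ((x, t) : Pt n) ≤ 1 := by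
    refine (enorm'_le_add _).trans ?_
    simp only
    rw [abs_of_nonneg (by linarith)]
    linarith
  have := h.lipschitz_interior (z := z) (e := e) (τ := t) (r := q / 2) (A := A * U (x, t))
    (by rw [he, norm_smul, norm_div, norm_one, norm_norm, one_div_mul_cancel hd.ne'])
    (by positivity) (by linarith)
    (fun Y hY => by
      have h1 := enorm'_sub_le Y (x, t)
      have h2 := hball Y hY
      have h3 : enorm' Y < 2 := by linarith
      have := (enorm'_lt_iff two_pos).mp h3
      linarith)
    (fun Y hY => hU Y ((enorm'_le_iff hq.le).mp (hball Y hY)))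
    (s := ‖x - y‖ / 2) (by positivity) (by linarith)
  rw [hse, show z + (1 / 2 : ℝ) • (x - y) = x by rw [hz]; module,
    show z - (1 / 2 : ℝ) • (x - y) = y by rw [hz]; module] at this
  have h5 : (n + 2) * (A * U (x, t)) * (‖x - y‖ / 2) / (q / 2) ≤
      (n + 2) * (A * U (x, t)) * (q / (2 * (n + 2) * A) / 2) / (q / 2) := by gcongr
  have h6 : (n + 2) * (A * U (x, t)) * (q / (2 * (n + 2) * A) / 2) / (q / 2) = U (x, t) / 2 := by
    field_simp
  linarith

set_option maxHeartbeats 2000000 in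
/-- A quantitative Harnack-type bound: a large interior value forces a lower bound on a
half-ball resting on the trace below it. -/
lemma exists_harnack (h : Sol n σ U) {A : ℝ} (hA : 1 ≤ A) : ∃ c : ℝ, 0 < c ∧
    ∀ (x : EuclideanSpace ℝ (Fin n)) (t q : ℝ), 0 < q → q ≤ t / 2 → t ≤ ‖x‖ → ‖x‖ ≤ 1 / 2 →
      0 ≤ U (x, t) → (∀ Y : Pt n, nsq (Y - (x, t)) ≤ q ^ 2 → U Y ≤ A * U (x, t)) →
      ∀ Y : Pt n, 0 ≤ Y.2 → nsq (Y - (x, 0)) ≤ (aspect n σ * t / 4) ^ 2 →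
        c * U (x, t) * ((q / t) ^ 2) ^ spreadExp n σ ≤ U Y := by
  have hn := h.hn
  have hν := h.aspect_pos
  have hν2 := h.aspect_le
  set ν := aspect n σ with hνdef
  set β := spreadExp n σ with hβdef
  have hβe : β = n + 4 / ν := rfl
  have hν4 : 0 < 4 / ν := by positivity
  have hβ0 : 0 < β := by linarith
  set κ₀ : ℝ := (1 / 4) ^ β * ((49 / 64) ^ (-β) - 1) with hκ₀
  have hκ₀p : 0 < κ₀ := by
    have : (1 : ℝ) < (49 / 64) ^ (-β) :=
      Real.one_lt_rpow_of_pos_of_lt_one_of_neg (by norm_num) (by norm_num) (by linarith)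
    exact mul_pos (by positivity) (by linarith)
  set κ₁ : ℝ := (1 - ν + ν ^ 2) ^ (-β) - ((1 - ν / 4) ^ 2) ^ (-β) with hκ₁
  have hνq : 0 < 1 - ν + ν ^ 2 := by nlinarith
  have hκ₁p : 0 < κ₁ := by
    have : ((1 - ν / 4) ^ 2) ^ (-β) < (1 - ν + ν ^ 2) ^ (-β) :=
      Real.rpow_lt_rpow_of_neg hνq (by nlinarith) (by linarith)
    exact sub_pos.mpr this
  refine ⟨κ₀ * κ₁ / 8 * ((1 / (16 * (n + 2) * A)) ^ 2) ^ β, by positivity, ?_⟩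
  intro x t q hq hqt htx hx hM hU Y hY0 hY
  set M := U (x, t) with hMdef
  have ht : 0 < t := by linarith
  set ϱ := q / (2 * (n + 2) * A) with hϱ
  have hϱ0 : 0 < ϱ := by positivity
  have hϱq : ϱ ≤ q / 8 := by
    rw [hϱ]
    gcongr
    nlinarith
  have hdisc : ∀ y : EuclideanSpace ℝ (Fin n), ‖y - x‖ ≤ ϱ → M / 2 ≤ U (y, t) := fun y hy =>
    h.half_le_on_disc hA hq hqt hx (htx.trans hx) hM hU hy
  -- propagation from the disc to a small sphere below it
  have hsph : ∀ X : Pt n, nsq (X - (x, t - ϱ / 4)) = (ϱ / 8) ^ 2 → M / 2 * κ₀ ≤ U X := by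
    intro X hX
    have hX1 : enorm' (X - (x, t - ϱ / 4)) = ϱ / 8 := by
      rw [enorm'_eq, hX, Real.sqrt_sq (by positivity)]
    have hX2 := abs_snd_le (X - (x, t - ϱ / 4))
    rw [hX1] at hX2
    have hX3 := abs_le.mp hX2
    simp only [Prod.snd_sub] at hX3
    have hXn : ‖X.1 - x‖ ^ 2 + (X.2 - (t - ϱ / 4)) ^ 2 = (ϱ / 8) ^ 2 := hX
    have hup : nsq (X - (x, t + ϱ / 2)) ≤ 49 / 64 * ϱ ^ 2 := by
      rw [nsq_mk_sub]; nlinarith only [hXn, hX3.1, hX3.2, hϱ0]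
    have hlow : (ϱ / 2) ^ 2 ≤ nsq (X - (x, t + ϱ / 2)) := by
      rw [nsq_mk_sub]; nlinarith only [hXn, hX3.1, hX3.2, hϱ0]
    have := h.interior_spread (Z := (x, t + ϱ / 2)) (S := (ϱ / 2) ^ 2) (R := ϱ ^ 2) (τ := t)
      (m := M / 2) (A := 1) (β := β) (by positivity) (by positivity) hβ0.le (by linarith)
      (fun Z hZ hZt _ => by
        have h1 := (enorm'_le_iff hϱ0.le).mpr hZ
        have h2 := (abs_snd_le (Z - (x, t + ϱ / 2))).trans h1
        have h3 := abs_le.mp h2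
        simp only [Prod.snd_sub] at h2 h3
        have h4 := enorm'_sub_le Z (x, t + ϱ / 2)
        have h5 := enorm'_le_add ((x, t + ϱ / 2) : Pt n)
        simp only [abs_of_pos (by positivity : 0 < t + ϱ / 2)] at h5
        have h6 : enorm' Z < 2 := by linarith
        have h7 := (enorm'_lt_iff two_pos).mp h6
        exact ⟨by linarith, by linarith, by linarith⟩)
      (fun Z hZ hZt => by
        rw [nsq_mk_sub] at hZ
        have h1 : Z.2 = t := by nlinarith only [sq_nonneg ‖Z.1 - x‖, hZ, hZt, hϱ0]
        have h2 : ‖Z.1 - x‖ ≤ ϱ := by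
          rw [h1] at hZ
          nlinarith only [norm_nonneg (Z.1 - x), hZ, hϱ0]
        have := hdisc Z.1 h2
        rwa [← h1] at this)
      (fun Z hZ _ hZt => by
        rw [nsq_mk_sub] at hZ
        have h2 : ‖Z.1 - x‖ ≤ ϱ := by
          nlinarith only [norm_nonneg (Z.1 - x), sq_nonneg (Z.2 - (t + ϱ / 2)), hZ, hϱ0]
        have := hdisc Z.1 h2
        rwa [← hZt] at this)
      hlow (by nlinarith only [hup, sq_nonneg ϱ]) (by linarith)
    refine le_trans ?_ this
    rw [hκ₀, ← mul_assoc, show (ϱ / 2) ^ 2 = 1 / 4 * ϱ ^ 2 by ring,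
      Real.mul_rpow (by norm_num) (by positivity)]
    have h1 : (49 / 64 : ℝ) ^ (-β) * (ϱ ^ 2) ^ (-β) ≤ nsq (X - (x, t + ϱ / 2)) ^ (-β) := by
      rw [← Real.mul_rpow (by norm_num) (by positivity)]
      exact rpow_le_rpow_neg (lt_of_lt_of_le (by positivity) hlow) hup hβ0.le
    have h2 := rpow_mul_rpow_neg (by positivity : 0 < ϱ ^ 2) β
    calc M / 2 * (1 / 4) ^ β * ((49 / 64) ^ (-β) - 1)
        = M / 2 * ((1 / 4) ^ β * (ϱ ^ 2) ^ β) *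
          ((49 / 64 : ℝ) ^ (-β) * (ϱ ^ 2) ^ (-β) - (ϱ ^ 2) ^ (-β)) := by
            linear_combination (-(M / 2 * (1 / 4) ^ β * ((49 / 64 : ℝ) ^ (-β) - 1))) * h2
      _ ≤ _ := by gcongr
  -- propagation from the small sphere to a wide disc near the trace
  set s := t - ϱ / 4 with hs
  have hs0 : 0 < s := by linarith
  have hst : s ≤ t := by linarith
  have hts : 7 / 8 * t ≤ s := by linarith
  have hwide : ∀ y : EuclideanSpace ℝ (Fin n), ‖y - x‖ ^ 2 ≤ ν * s ^ 2 →
      M / 2 * κ₀ * (((ϱ / 8 / t) ^ 2) ^ β * κ₁) ≤ U (y, ν * s) := by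
    intro y hy
    have hyn : nsq (((y, ν * s) : Pt n) - (x, s)) = ‖y - x‖ ^ 2 + (ν * s - s) ^ 2 := rfl
    have hup : nsq (((y, ν * s) : Pt n) - (x, s)) ≤ (1 - ν + ν ^ 2) * s ^ 2 := by
      rw [hyn]; nlinarith only [hy]
    have hϱs : ϱ / 8 ≤ s / 2 := by linarith
    have hlow : (ϱ / 8) ^ 2 ≤ nsq (((y, ν * s) : Pt n) - (x, s)) := by
      have h1 : (ϱ / 8) ^ 2 ≤ (s / 2) ^ 2 := by gcongr
      have h2 : (s / 2) ^ 2 ≤ ((1 - ν) * s) ^ 2 := by gcongr; nlinarith only [hν2, hs0]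
      rw [hyn]; nlinarith only [sq_nonneg ‖y - x‖, h1, h2]
    have hνs : 0 < (1 - ν / 4) * s := mul_pos (by linarith) hs0
    have := h.interior_spread (Z := (x, s)) (S := (ϱ / 8) ^ 2) (R := ((1 - ν / 4) * s) ^ 2) (τ := 2)
      (m := M / 2 * κ₀) (A := 4 / ν) (β := β) (by positivity) (by positivity) hβ0.le (by linarith)
      (fun Z hZ hZt _ => by
        have h1 := (enorm'_le_iff hνs.le).mpr hZ
        have h2 := (abs_snd_le (Z - (x, s))).trans h1
        have h3 := abs_le.mp h2
        simp only [Prod.snd_sub] at h2 h3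
        have h4 := enorm'_sub_le Z (x, s)
        have h5 := enorm'_le_add ((x, s) : Pt n)
        simp only [abs_of_pos hs0] at h5
        have h6 : enorm' Z < 2 := by nlinarith only [h1, h4, h5, hx, htx, hst, hs0, hν]
        have h7 := (enorm'_lt_iff two_pos).mp h6
        have h8 : ν * s / 4 ≤ Z.2 := by linarith
        have h9 : 4 / ν * (ν * s / 4) ≤ 4 / ν * Z.2 := by gcongr
        have h10 : 4 / ν * (ν * s / 4) = s := by field_simp
        refine ⟨by linarith, lt_of_lt_of_le (by positivity) h8, ?_⟩
        have h11 : (1 - ν / 4) * s ≤ s := by linarith only [mul_pos hν hs0]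
        exact h2.trans (h11.trans (h10.symm.trans_le h9)))
      (fun Z hZ _ => hsph Z hZ)
      (fun Z hZ _ hZt => by
        exfalso
        have h1 := (enorm'_le_iff hνs.le).mpr hZ
        have h2 := (abs_snd_le (Z - (x, s))).trans h1
        have h3 := abs_le.mp h2
        simp only [Prod.snd_sub, hZt] at h3
        linarith only [h3.2, mul_pos hν hs0, hst, htx, hx])
      hlow (hup.trans (by
        linarith only [mul_nonneg (mul_nonneg hν.le (sub_nonneg.2 hν2)) (sq_nonneg s),
          mul_nonneg (sq_nonneg ν) (sq_nonneg s)]))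
      (show ν * s ≤ 2 by linarith only [mul_le_mul_of_nonneg_right hν2 hs0.le, hst, htx, hx])
    refine le_trans ?_ this
    rw [mul_assoc (M / 2 * κ₀) _ (_ - _)]
    refine mul_le_mul_of_nonneg_left ?_ (by positivity)
    have h1 : (1 - ν + ν ^ 2) ^ (-β) * (s ^ 2) ^ (-β) ≤
        nsq (((y, ν * s) : Pt n) - (x, s)) ^ (-β) := by
      rw [← Real.mul_rpow hνq.le (by positivity)]
      exact rpow_le_rpow_neg (lt_of_lt_of_le (by positivity) hlow) hup hβ0.le
    have h2 := rpow_mul_rpow_neg (by positivity : 0 < s ^ 2) β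
    have h3 : ((ϱ / 8 / t) ^ 2) ^ β ≤ ((ϱ / 8 / s) ^ 2) ^ β := by gcongr
    have h4 : ((ϱ / 8 / s) ^ 2) ^ β * (s ^ 2) ^ β = ((ϱ / 8) ^ 2) ^ β := by
      rw [← Real.mul_rpow (by positivity) (by positivity)]
      congr 1
      field_simp
    calc ((ϱ / 8 / t) ^ 2) ^ β * κ₁ ≤ ((ϱ / 8 / s) ^ 2) ^ β * κ₁ := by gcongr
      _ = ((ϱ / 8) ^ 2) ^ β * ((1 - ν + ν ^ 2) ^ (-β) * (s ^ 2) ^ (-β) -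
          (((1 - ν / 4) * s) ^ 2) ^ (-β)) := by
          rw [mul_pow (1 - ν / 4) s 2, Real.mul_rpow (by positivity) (by positivity), ← h4, hκ₁]
          linear_combination (-(((ϱ / 8 / s) ^ 2) ^ β *
            ((1 - ν + ν ^ 2) ^ (-β) - ((1 - ν / 4) ^ 2) ^ (-β)))) * h2
      _ ≤ _ := by gcongr
  have hsq : √ν * √ν = ν := Real.mul_self_sqrt hν.le
  have hsq0 : 0 < √ν := Real.sqrt_pos.mpr hν
  have hνsq : ν ≤ √ν := by nlinarith only [hsq, hsq0, hν2]
  have hsq1 : √ν < 1 := by nlinarith only [hsq, hsq0, hν2]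
  have hYn : enorm' (Y - (x, 0)) ≤ ν * t / 4 := (enorm'_le_iff (by positivity)).mpr hY
  have hY1 := (norm_fst_le _).trans hYn
  have hY2 := (le_abs_self _).trans ((abs_snd_le _).trans hYn)
  simp only [Prod.fst_sub, Prod.snd_sub, sub_zero] at hY1 hY2
  have hνt : ν * (7 / 8 * t) ≤ ν * s := by gcongr
  have hsνs : ν * s ≤ √ν * s := by gcongr
  have hfin := h.disc_to_trace (z := x) (r := √ν * s) (τ := ν * s)
    (m := M / 2 * κ₀ * (((ϱ / 8 / t) ^ 2) ^ β * κ₁)) (by positivity) (by positivity)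
    (by rw [mul_pow, mul_pow, sq √ν, hsq, ← mul_assoc, sq ν]) (by nlinarith)
    (fun Z hZ1 hZ2 => by
      have h1 : ‖Z.1‖ ≤ 1 := by
        have := norm_le_norm_add_norm_sub' Z.1 x
        nlinarith
      have h2 : |Z.2| ≤ 1 := by nlinarith
      have h3 := abs_le.mp h2
      unfold nsq
      nlinarith [norm_nonneg Z.1])
    (fun y hy => hwide y (by
      have := mul_self_le_mul_self (norm_nonneg _) hy
      nlinarith))
    (Y := Y) (by linarith [mul_pos hν ht]) hY0 (by linarith [mul_pos hν ht])
  refine le_trans (le_of_eq ?_) hfin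
  have h1 : ϱ / 8 / t = 1 / (16 * (n + 2) * A) * (q / t) := by
    rw [hϱ]; field_simp; norm_num
  rw [h1, mul_pow, Real.mul_rpow (by positivity) (by positivity)]
  ring

end Sol

end Harnack

section UpperBound

variable {n : ℕ} {σ : ℝ} {U : Pt n → ℝ}

namespace Sol

/-- Positivity of the trace at one point bounds `U` from below up to the singularity. -/
lemma exists_lower_bound (h : Sol n σ U) {x₁ : EuclideanSpace ℝ (Fin n)} (h0 : 0 < ‖x₁‖)
    (h1 : ‖x₁‖ ≤ 1 / 4) (hu : 0 < U (x₁, 0)) :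
    ∃ ε : ℝ, 0 < ε ∧ ∀ Y : Pt n, 0 ≤ Y.2 → Y ≠ 0 → nsq Y ≤ 1 → ε ≤ U Y := by
  have ha0 := h.expA_pos
  set m := U (x₁, 0) / 2 with hm
  have hm0 : 0 < m := by positivity
  have hmem : ((x₁, 0) : Pt n) ∈ {X : Pt n | nsq X ≤ 4 ∧ 0 ≤ X.2 ∧ X ≠ 0} := by
    refine ⟨?_, le_rfl, fun e => h0.ne' (norm_eq_zero.mpr (congrArg Prod.fst e))⟩
    rw [← enorm'_sq, enorm'_trace]; nlinarith
  have hcont : ∀ᶠ Y in 𝓝[{X : Pt n | nsq X ≤ 4 ∧ 0 ≤ X.2 ∧ X ≠ 0}] (x₁, 0), m < U Y :=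
    (h.cont _ hmem).eventually_const_lt (by linarith)
  obtain ⟨δ, hδ, hδU⟩ := Metric.eventually_nhds_iff.mp (eventually_nhdsWithin_iff.mp hcont)
  set s := min (δ / 2) (‖x₁‖ / 2) with hs
  have hs0 : 0 < s := by positivity
  have hsδ : s ≤ δ / 2 := min_le_left _ _
  have hsx : s ≤ ‖x₁‖ / 2 := min_le_right _ _
  have hball : ∀ Y : Pt n, 0 ≤ Y.2 → Y ≠ 0 → nsq (Y - (x₁, 0)) ≤ s ^ 2 → m ≤ U Y := by
    intro Y hY0 hYne hY
    have h2 := (enorm'_le_iff hs0.le).mpr hY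
    have h3 := enorm'_sub_le Y (x₁, 0)
    rw [enorm'_trace] at h3
    have h4 : nsq Y ≤ 2 ^ 2 := (enorm'_le_iff zero_le_two).mp (by linarith)
    refine (hδU ?_ ⟨by linarith, hY0, hYne⟩).le
    rw [dist_eq_norm, Prod.norm_def]
    exact (max_le ((norm_fst_le _).trans h2) ((abs_snd_le _).trans h2)).trans_lt (by linarith)
  have hκ : 0 < (25 / 16 : ℝ) ^ (-expA n σ) - (9 / 4) ^ (-expA n σ) :=
    sub_pos.mpr (Real.rpow_lt_rpow_of_neg (by norm_num) (by norm_num) (by linarith))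
  refine ⟨min m (m * (s ^ 2) ^ expA n σ *
    ((25 / 16 : ℝ) ^ (-expA n σ) - (9 / 4) ^ (-expA n σ))), by positivity, fun Y hY0 hYne hY1 => ?_⟩
  rcases le_total (nsq (Y - (x₁, 0))) (s ^ 2) with hle | hge
  · exact (min_le_left _ _).trans (hball Y hY0 hYne hle)
  have hYn : enorm' Y ≤ 1 := (enorm'_le_iff zero_le_one).mpr (by linarith)
  have h2 : nsq (Y - (x₁, 0)) ≤ (5 / 4) ^ 2 := (enorm'_le_iff (by norm_num)).mp (by
    have := enorm'_sub_le (Y - (x₁, 0)) (-(x₁, 0))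
    rw [enorm'_neg, enorm'_trace, sub_neg_eq_add, sub_add_cancel] at this
    linarith)
  have h3 := h.spread (x₁ := x₁) (S := s ^ 2) (R := 9 / 4) (m := m) (by positivity) hm0.le
    (fun Z hZ => by
      have h4 : enorm' (Z - (x₁, 0)) ≤ 3 / 2 := (enorm'_le_iff (by norm_num)).mpr (by linarith)
      have h5 := enorm'_sub_le Z (x₁, 0)
      rw [enorm'_trace] at h5
      have := (enorm'_lt_iff two_pos).mp (by linarith : enorm' Z < 2)
      linarith)
    (fun Z hZ0 hZne hZ => hball Z hZ0 hZne hZ.le) hY0 hYne hge (by linarith)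
  refine (min_le_right _ _).trans (le_trans ?_ h3)
  have h4 : (25 / 16 : ℝ) ^ (-expA n σ) ≤ nsq (Y - (x₁, 0)) ^ (-expA n σ) :=
    rpow_le_rpow_neg ((by positivity : 0 < s ^ 2).trans_le hge) (by linarith) ha0.le
  gcongr

/-- Selection of a point around which `U` is controlled by its value there. -/
lemma exists_doubling (h : Sol n σ U) {x₀ : EuclideanSpace ℝ (Fin n)} (h0 : 0 < ‖x₀‖)
    (h1 : ‖x₀‖ ≤ 1 / 4) (hu : 0 < U (x₀, 0)) {N : ℝ} (hN : 0 < N) :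
    ∃ (X : Pt n) (r : ℝ), 0 < r ∧ 0 ≤ X.2 ∧ enorm' (X - (x₀, 0)) + 2 * r = ‖x₀‖ / 2 ∧ 0 < U X ∧
      (∀ Y : Pt n, 0 ≤ Y.2 → enorm' (Y - X) ≤ r → U Y ≤ 2 ^ N * U X) ∧
      (‖x₀‖ / 2) ^ N * U (x₀, 0) ≤ (2 * r) ^ N * U X := by
  set d := ‖x₀‖ with hd
  set K : Set (Pt n) := {X | nsq (X - (x₀, 0)) ≤ (d / 2) ^ 2 ∧ 0 ≤ X.2} with hK
  have hKc : IsCompact K := isCompact_of_nsq_sub_le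
    ((isClosed_le (continuous_nsq_sub _) continuous_const).inter
      (isClosed_le continuous_const continuous_snd)) (x₀, 0) fun X hX => hX.1
  have hKs : K ⊆ {X : Pt n | nsq X ≤ 4 ∧ 0 ≤ X.2 ∧ X ≠ 0} := fun X hX => by
    have := nsq_of_near h0 (by linarith) hX.1
    exact ⟨by linarith, hX.2, ne_zero_of_nsq_pos this.1⟩
  have hx0 : ((x₀, 0) : Pt n) ∈ K := ⟨by rw [sub_self]; simp [nsq]; positivity, le_rfl⟩
  have hfc : ContinuousOn (fun X : Pt n => (d / 2 - enorm' (X - (x₀, 0))) ^ N * U X) K := by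
    refine ContinuousOn.mul ?_ (h.cont.mono hKs)
    exact ((continuous_const.sub (continuous_enorm'.comp
      (continuous_id.sub continuous_const))).rpow_const fun _ => Or.inr hN.le).continuousOn
  obtain ⟨X, hX, hmax⟩ := hKc.exists_isMaxOn ⟨_, hx0⟩ hfc
  have hUX : 0 ≤ U X := h.nonneg X (hKs hX).1 hX.2 (hKs hX).2.2
  have hXd : enorm' (X - (x₀, 0)) ≤ d / 2 := (enorm'_le_iff (by positivity)).mpr hX.1
  have h2 : (d / 2) ^ N * U (x₀, 0) ≤ (d / 2 - enorm' (X - (x₀, 0))) ^ N * U X := by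
    have := hmax hx0
    simpa [enorm'] using this
  have h3 : 0 < (d / 2) ^ N * U (x₀, 0) := by positivity
  have h4 : 0 < d / 2 - enorm' (X - (x₀, 0)) := by
    rcases (sub_nonneg.mpr hXd).lt_or_eq with h5 | h5
    · exact h5
    · rw [← h5, Real.zero_rpow hN.ne', zero_mul] at h2
      linarith
  have hUX0 : 0 < U X := hUX.lt_of_ne fun e => by
    rw [← e, mul_zero] at h2
    linarith
  set r := (d / 2 - enorm' (X - (x₀, 0))) / 2 with hr
  have h2r : 2 * r = d / 2 - enorm' (X - (x₀, 0)) := by rw [hr]; ring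
  have hr0 : 0 < r := by linarith
  refine ⟨X, r, hr0, hX.2, by linarith, hUX0, fun Y hY0 hY => ?_, by rwa [h2r]⟩
  have h5 : enorm' (Y - (x₀, 0)) ≤ r + enorm' (X - (x₀, 0)) := by
    have := enorm'_sub_le (Y - (x₀, 0)) (X - (x₀, 0))
    rw [sub_sub_sub_cancel_right] at this
    linarith
  have hYK : Y ∈ K := ⟨(enorm'_le_iff (by positivity)).mp (by linarith), hY0⟩
  have hUY : 0 ≤ U Y := h.nonneg Y (hKs hYK).1 hY0 (hKs hYK).2.2
  have h6 := hmax hYK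
  simp only [Set.mem_ofPred_eq] at h6
  rw [← h2r] at h6
  have h7 : r ^ N ≤ (d / 2 - enorm' (Y - (x₀, 0))) ^ N := by gcongr; linarith
  have h8 : r ^ N * U Y ≤ r ^ N * (2 ^ N * U X) := by
    calc r ^ N * U Y ≤ (d / 2 - enorm' (Y - (x₀, 0))) ^ N * U Y := by gcongr
      _ ≤ (2 * r) ^ N * U X := h6
      _ = _ := by rw [Real.mul_rpow zero_le_two hr0.le]; ring
  exact le_of_mul_le_mul_left h8 (by positivity)

/-- Scale-invariant form of the estimate produced by the Hopf lemma. -/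
lemma mul_rpow_le_of_hopf (h : Sol n σ U) {u r K B : ℝ} (hu : 0 < u) (hr : 0 < r) (hK : 0 < K)
    (hB : K * u ^ expP n σ * r ^ (2 * σ) ≤ B * u) :
    u * r ^ expA n σ ≤ (B / K) ^ (expA n σ / (2 * σ)) := by
  have hσ0 := h.hσ0
  have ha0 := h.expA_pos
  have hap := h.expA_mul_expP
  set a := expA n σ
  set p := expP n σ
  have h1 : u ^ (p - 1) * r ^ (2 * σ) ≤ B / K := by
    rw [le_div_iff₀ hK]
    refine le_of_mul_le_mul_right ?_ hu
    calc u ^ (p - 1) * r ^ (2 * σ) * K * u = K * (u ^ (p - 1) * u) * r ^ (2 * σ) := by ring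
      _ = K * u ^ p * r ^ (2 * σ) := by
        rw [← Real.rpow_add_one hu.ne', sub_add_cancel]
      _ ≤ B * u := hB
  have h2 : (p - 1) * (a / (2 * σ)) = 1 := by
    field_simp
    linarith
  have h3 : 2 * σ * (a / (2 * σ)) = a := by field_simp
  calc u * r ^ a = (u ^ (p - 1) * r ^ (2 * σ)) ^ (a / (2 * σ)) := by
        rw [Real.mul_rpow (by positivity) (by positivity), ← Real.rpow_mul hu.le,
          ← Real.rpow_mul hr.le, h2, h3, Real.rpow_one]
    _ ≤ _ := by gcongr

lemma expA_le_spreadExp (h : Sol n σ U) : expA n σ ≤ spreadExp n σ := by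
  have hν := h.aspect_pos
  have := h.hn
  have := h.hσ0
  have : 0 < 4 / aspect n σ := by positivity
  unfold expA spreadExp
  linarith

lemma spreadExp_pos (h : Sol n σ U) : 0 < spreadExp n σ := h.expA_pos.trans_le h.expA_le_spreadExp

/-- A lower bound on a small half-ball about a trace point spreads along the trace. -/
lemma le_trace_of_le_half_ball (h : Sol n σ U) {x y : EuclideanSpace ℝ (Fin n)} {s d m : ℝ}
    (hs0 : 0 < s) (hsd : s ≤ d) (hm0 : 0 ≤ m) (hx : ‖x‖ + 2 * d < 2)
    (hlow : ∀ Y : Pt n, 0 ≤ Y.2 → nsq (Y - (x, 0)) ≤ s ^ 2 → m ≤ U Y) (hy0 : y ≠ 0)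
    (hyx : ‖y - x‖ ≤ d) :
    m * ((s ^ 2) ^ expA n σ * (d ^ 2) ^ (-expA n σ) * (1 - 4 ^ (-expA n σ))) ≤ U (y, 0) := by
  have ha0 := h.expA_pos
  set a := expA n σ
  have hd : 0 < d := hs0.trans_le hsd
  have hκ0 : (0 : ℝ) ≤ 1 - 4 ^ (-a) :=
    sub_nonneg.mpr (Real.rpow_lt_one_of_one_lt_of_neg (by norm_num) (by linarith)).le
  have hκ1 : (1 : ℝ) - 4 ^ (-a) ≤ 1 := sub_le_self _ (by positivity)
  have hfac : (s ^ 2) ^ a * (d ^ 2) ^ (-a) ≤ 1 := by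
    rw [← rpow_mul_rpow_neg (by positivity : 0 < d ^ 2) a]
    gcongr
  have hyn : nsq (((y, 0) : Pt n) - (x, 0)) = ‖y - x‖ ^ 2 := by simp [nsq]
  rcases le_total (nsq (((y, 0) : Pt n) - (x, 0))) (s ^ 2) with hle | hge
  · exact (mul_le_of_le_one_right hm0 (mul_le_one₀ hfac hκ0 hκ1)).trans (hlow (y, 0) le_rfl hle)
  have h1 := h.spread (x₁ := x) (S := s ^ 2) (R := (2 * d) ^ 2) (m := m) (by positivity) hm0
    (fun Z hZ => by
      have h4 := (enorm'_le_iff (by positivity)).mpr hZ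
      have h5 := enorm'_sub_le Z (x, 0)
      rw [enorm'_trace] at h5
      have := (enorm'_lt_iff two_pos).mp (by linarith : enorm' Z < 2)
      linarith)
    (fun Z hZ0 _ hZ => hlow Z hZ0 hZ.le) (Y := (y, 0)) le_rfl
    (fun e => hy0 (congrArg Prod.fst e)) hge (by rw [hyn]; gcongr; linarith)
  refine le_trans ?_ h1
  have h2 : (d ^ 2) ^ (-a) ≤ nsq (((y, 0) : Pt n) - (x, 0)) ^ (-a) :=
    rpow_le_rpow_neg ((by positivity : 0 < s ^ 2).trans_le hge) (by rw [hyn]; gcongr) ha0.le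
  calc m * ((s ^ 2) ^ a * (d ^ 2) ^ (-a) * (1 - 4 ^ (-a)))
      = m * (s ^ 2) ^ a * ((d ^ 2) ^ (-a) - ((2 * d) ^ 2) ^ (-a)) := by
        rw [mul_pow 2 d 2, Real.mul_rpow (by norm_num) (by positivity)]
        norm_num
        ring
    _ ≤ _ := by gcongr

/-- Bookkeeping of the scales entering `exists_bound_of_interior`. -/
lemma scale_factor_le {a β ν d t r M u : ℝ} (haβ : a ≤ β) (hν : 0 < ν) (ht : 0 < t)
    (htd : t ≤ d) (hr : 0 < r) (hM : 0 < M)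
    (hdoub : (d / 2) ^ (2 * β) * u ≤ (2 * r) ^ (2 * β) * M) :
    (1 / 64) ^ β * ((ν / 4) ^ 2) ^ a * u ≤
      M * ((r / 2 / t) ^ 2) ^ β * (((ν * t / 4) ^ 2) ^ a * (d ^ 2) ^ (-a)) := by
  have hd : 0 < d := ht.trans_le htd
  have h1 : (d ^ 2) ^ a * (d ^ 2) ^ (-a) = 1 := rpow_mul_rpow_neg (by positivity) a
  have h2 : ((ν * t / 4) ^ 2) ^ a * (d ^ 2) ^ (-a) = ((ν / 4) ^ 2) ^ a * ((t / d) ^ 2) ^ a := by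
    have : (ν * t / 4) ^ 2 = (ν / 4) ^ 2 * ((t / d) ^ 2 * d ^ 2) := by field_simp
    rw [this, Real.mul_rpow (by positivity) (by positivity),
      Real.mul_rpow (by positivity) (by positivity)]
    linear_combination (((ν / 4) ^ 2) ^ a * ((t / d) ^ 2) ^ a) * h1
  have h3 : ((t / d) ^ 2) ^ β ≤ ((t / d) ^ 2) ^ a := by
    refine Real.rpow_le_rpow_of_exponent_ge (by positivity) ?_ haβ
    rwa [sq_le_one_iff₀ (by positivity), div_le_one hd]
  have h4 : ((r / 2 / t) ^ 2) ^ β * ((t / d) ^ 2) ^ β = ((r / (2 * d)) ^ 2) ^ β := by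
    rw [← Real.mul_rpow (by positivity) (by positivity)]
    congr 1
    field_simp
  have h5 : (1 / 64) ^ β * u ≤ ((r / (2 * d)) ^ 2) ^ β * M := by
    rw [Real.rpow_mul (by positivity), Real.rpow_mul (by positivity), Real.rpow_two,
      Real.rpow_two] at hdoub
    have h6 : (r / (2 * d)) ^ 2 = 1 / (16 * d ^ 2) * (2 * r) ^ 2 := by field_simp; norm_num
    have h7 : (1 / 64 : ℝ) = 1 / (16 * d ^ 2) * (d / 2) ^ 2 := by field_simp; norm_num
    rw [h6, h7, Real.mul_rpow (by positivity) (by positivity),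
      Real.mul_rpow (by positivity) (by positivity), mul_assoc, mul_assoc]
    gcongr
  calc (1 / 64) ^ β * ((ν / 4) ^ 2) ^ a * u = ((ν / 4) ^ 2) ^ a * ((1 / 64) ^ β * u) := by ring
    _ ≤ ((ν / 4) ^ 2) ^ a * (((r / (2 * d)) ^ 2) ^ β * M) := by gcongr
    _ = M * ((ν / 4) ^ 2) ^ a * (((r / 2 / t) ^ 2) ^ β * ((t / d) ^ 2) ^ β) := by rw [h4]; ring
    _ ≤ M * ((ν / 4) ^ 2) ^ a * (((r / 2 / t) ^ 2) ^ β * ((t / d) ^ 2) ^ a) := by gcongr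
    _ = _ := by rw [h2]; ring

set_option maxHeartbeats 1000000 in
/-- The bound when the selected point is far from the trace. -/
lemma exists_bound_of_interior (h : Sol n σ U) {A : ℝ} (hA : 1 ≤ A) :
    ∃ C : ℝ, ∀ (x₀ x : EuclideanSpace ℝ (Fin n)) (t r : ℝ), 0 < ‖x₀‖ → ‖x₀‖ ≤ 1 / 4 → 0 < r →
      r < t → enorm' ((x, t) - (x₀, 0) : Pt n) + 2 * r = ‖x₀‖ / 2 → 0 < U (x, t) →
      (∀ Y : Pt n, 0 ≤ Y.2 → enorm' (Y - (x, t)) ≤ r → U Y ≤ A * U (x, t)) → 0 < U (x₀, 0) →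
      (‖x₀‖ / 2) ^ (2 * spreadExp n σ) * U (x₀, 0) ≤ (2 * r) ^ (2 * spreadExp n σ) * U (x, t) →
      U (x₀, 0) * ‖x₀‖ ^ expA n σ ≤ C := by
  have ha0 := h.expA_pos
  have hν := h.aspect_pos
  have hν2 := h.aspect_le
  have hβ := h.spreadExp_pos
  have haβ := h.expA_le_spreadExp
  have hH := h.hopfC_pos
  obtain ⟨c, hc, hharn⟩ := h.exists_harnack hA
  set ν := aspect n σ
  set a := expA n σ with ha
  set β := spreadExp n σ with hβdef
  set κ : ℝ := 1 - 4 ^ (-a) with hκ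
  have hκ0 : 0 < κ := sub_pos.mpr (Real.rpow_lt_one_of_one_lt_of_neg (by norm_num) (by linarith))
  set c₁ : ℝ := c * (1 / 64) ^ β * ((ν / 4) ^ 2) ^ a * κ with hc₁
  have hc₁0 : 0 < c₁ := by positivity
  refine ⟨(1 / (hopfC n σ * c₁ ^ expP n σ)) ^ (a / (2 * σ)) * 2 ^ a, ?_⟩
  intro x₀ x t r hd hd4 hr hrt hrd hM hU hu hdoub
  set d := ‖x₀‖ with hddef
  set M := U (x, t) with hMdef
  set u := U (x₀, 0) with hudef
  have ht : 0 < t := hr.trans hrt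
  have hXd : enorm' ((x, t) - (x₀, 0) : Pt n) ≤ d / 2 := by linarith
  have hxx := (norm_fst_le ((x, t) - (x₀, 0) : Pt n)).trans hXd
  simp only [Prod.fst_sub] at hxx
  have htd : t ≤ d / 2 := by
    have := (le_abs_self _).trans ((abs_snd_le ((x, t) - (x₀, 0) : Pt n)).trans hXd)
    simpa using this
  have hx1 : ‖x‖ ≤ 3 / 2 * d := by
    have := norm_le_norm_add_norm_sub' x x₀
    linarith
  have hx2 : d / 2 ≤ ‖x‖ := by
    have := norm_le_norm_add_norm_sub x x₀
    linarith
  have hlow := hharn x t (r / 2) (by positivity) (by linarith) (by linarith) (by linarith) hM.le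
    (fun Y hY => by
      have h1 := (enorm'_le_iff (by positivity)).mpr hY
      have h2 := (abs_le.mp ((abs_snd_le _).trans h1)).1
      simp only [Prod.snd_sub] at h2
      exact hU Y (by linarith) (by linarith))
  set s := ν * t / 4 with hs
  have hs0 : 0 < s := by positivity
  have hsd : s ≤ d := by rw [hs]; nlinarith
  set m := c * M * ((r / 2 / t) ^ 2) ^ β with hm
  have hm0 : 0 < m := by positivity
  have htrace : ∀ y : EuclideanSpace ℝ (Fin n), ‖y - x₀‖ ≤ d / 2 →
      m * ((s ^ 2) ^ a * (d ^ 2) ^ (-a) * κ) ≤ U (y, 0) := by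
    intro y hy
    have hyx : ‖y - x‖ ≤ d := by
      have := norm_sub_le_norm_sub_add_norm_sub y x₀ x
      rw [norm_sub_rev x₀ x] at this
      linarith
    refine h.le_trace_of_le_half_ball hs0 hsd hm0.le (by linarith) hlow ?_ hyx
    rintro rfl
    rw [zero_sub, norm_neg] at hy
    linarith
  have hclow : c₁ * u ≤ m * ((s ^ 2) ^ a * (d ^ 2) ^ (-a) * κ) := by
    have h1 := scale_factor_le haβ hν ht (by linarith : t ≤ d) hr hM hdoub
    calc c₁ * u = c * κ * ((1 / 64) ^ β * ((ν / 4) ^ 2) ^ a * u) := by rw [hc₁]; ring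
      _ ≤ c * κ * (M * ((r / 2 / t) ^ 2) ^ β * ((s ^ 2) ^ a * (d ^ 2) ^ (-a))) := by gcongr
      _ = _ := by rw [hm]; ring
  have hhopf := h.hopf (z := x₀) (r := d / 2) (m := c₁ * u) (by positivity) (by positivity)
    (by linarith)
    (fun Y hY1 hY2 => by
      have h1 := norm_le_norm_add_norm_sub' Y.1 x₀
      have h2 := enorm'_le_add Y
      have := (enorm'_lt_iff two_pos).mp (by linarith : enorm' Y < 2)
      linarith)
    (fun y hy => hclow.trans (htrace y hy))
  have h1 := h.mul_rpow_le_of_hopf (u := u) (r := d / 2) (K := hopfC n σ * c₁ ^ expP n σ) (B := 1)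
    hu (by positivity) (by positivity) (by
      rw [Real.mul_rpow hc₁0.le hu.le] at hhopf
      linarith)
  have h2 : d ^ a = (d / 2) ^ a * 2 ^ a := by
    rw [← Real.mul_rpow (by positivity) (by positivity)]
    congr 1
    ring
  rw [h2, ← mul_assoc]
  gcongr

/-- A value which controls `U` down to the trace is bounded by the critical rate of its height. -/
lemma exists_height_bound (h : Sol n σ U) {A : ℝ} (hA : 1 ≤ A) :
    ∃ T : ℝ, 0 < T ∧ ∀ (x : EuclideanSpace ℝ (Fin n)) (t : ℝ), 0 < t → t ≤ ‖x‖ → ‖x‖ ≤ 1 / 2 →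
      0 < U (x, t) →
      (∀ Y : Pt n, 0 ≤ Y.2 → enorm' (Y - (x, t)) ≤ t → U Y ≤ A * U (x, t)) →
      U (x, t) * t ^ expA n σ ≤ T := by
  have hν := h.aspect_pos
  have hν2 := h.aspect_le
  have hH := h.hopfC_pos
  have hA0 : 0 < A := by linarith
  obtain ⟨c, hc, hharn⟩ := h.exists_harnack hA
  set ν := aspect n σ
  set a := expA n σ with ha
  set β := spreadExp n σ with hβdef
  set c₁ : ℝ := c * ((1 / 2) ^ 2) ^ β with hc₁
  have hc₁0 : 0 < c₁ := by positivity
  refine ⟨(A / (hopfC n σ * c₁ ^ expP n σ)) ^ (a / (2 * σ)) * (4 / ν) ^ a, by positivity, ?_⟩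
  intro x t ht htx hx hM hU
  set M := U (x, t) with hMdef
  have hlow := hharn x t (t / 2) (by positivity) (by linarith) htx hx hM.le
    (fun Y hY => by
      have h1 := (enorm'_le_iff (by positivity)).mpr hY
      have h2 := (abs_le.mp ((abs_snd_le _).trans h1)).1
      simp only [Prod.snd_sub] at h2
      exact hU Y (by linarith) (by linarith))
  have ht2 : t / 2 / t = 1 / 2 := by field_simp
  rw [ht2] at hlow
  set s := ν * t / 4 with hs
  have hs0 : 0 < s := by positivity
  have hst : s ≤ t / 8 := by rw [hs]; nlinarith
  have hux : U (x, 0) ≤ A * M := hU (x, 0) le_rfl (by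
    have : ((x, 0) : Pt n) - (x, t) = (0, -t) := by simp
    rw [this]
    refine (enorm'_le_add _).trans ?_
    simp [abs_of_pos ht])
  have hhopf := h.hopf (z := x) (r := s) (m := c₁ * M) hs0 (by positivity) (by linarith)
    (fun Y hY1 hY2 => by
      have h1 := norm_le_norm_add_norm_sub' Y.1 x
      have h2 := enorm'_le_add Y
      have := (enorm'_lt_iff two_pos).mp (by linarith : enorm' Y < 2)
      linarith)
    (fun y hy => by
      refine le_trans (le_of_eq ?_) (hlow (y, 0) le_rfl ?_)
      · rw [hc₁]; ring
      · have : nsq (((y, 0) : Pt n) - (x, 0)) = ‖y - x‖ ^ 2 := by simp [nsq]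
        rw [this]
        gcongr)
  have h1 := h.mul_rpow_le_of_hopf (u := M) (r := s) (K := hopfC n σ * c₁ ^ expP n σ) (B := A)
    hM hs0 (by positivity) (by
      rw [Real.mul_rpow hc₁0.le hM.le] at hhopf
      linarith)
  have h2 : t ^ a = s ^ a * (4 / ν) ^ a := by
    rw [← Real.mul_rpow (by positivity) (by positivity)]
    congr 1
    rw [hs]
    field_simp
  rw [h2, ← mul_assoc]
  gcongr

set_option maxHeartbeats 1000000 in
/-- Reflection in spheres centred on the trace transplants the value of `U` at `(x, t)` to the
horizontal disc at height `2t`. -/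
lemma le_of_reflection (h : Sol n σ U) {ε : ℝ} (hε : 0 < ε)
    (hUε : ∀ Y : Pt n, 0 ≤ Y.2 → Y ≠ 0 → nsq Y ≤ 1 → ε ≤ U Y) {A r δ : ℝ}
    {x y : EuclideanSpace ℝ (Fin n)} {t : ℝ} (ht : 0 ≤ t) (hr16 : r ≤ 1 / 16)
    (hrx : 4 * r ≤ ‖x‖) (hx : ‖x‖ ≤ 3 / 8) (hM : 0 < U (x, t))
    (hU : ∀ Y : Pt n, 0 ≤ Y.2 → enorm' (Y - (x, t)) ≤ r → U Y ≤ A * U (x, t))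
    (hδ : ‖y - x‖ + t ≤ δ) (hδ0 : 0 < δ) (hδr : 3 * δ ≤ r)
    (hsmall : ((4 * δ) ^ 2) ^ expA n σ * (A * U (x, t)) ≤ ε / 2) :
    2 ^ (-expA n σ) * U (x, t) ≤ U (y, 2 * t) := by
  have ha0 := h.expA_pos
  set a := expA n σ with ha
  set M := U (x, t) with hMdef
  have hyx := norm_nonneg (y - x)
  set q := ‖y - x‖ ^ 2 + t ^ 2 with hq
  rcases (by positivity : 0 ≤ q).eq_or_lt with hq0 | hq0
  · have h1 : ‖y - x‖ = 0 := by nlinarith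
    have h2 : t = 0 := by nlinarith
    rw [sub_eq_zero.mp (norm_eq_zero.mp h1), h2, mul_zero, ← h2]
    refine mul_le_of_le_one_left hM.le ?_
    exact Real.rpow_le_one_of_one_le_of_nonpos one_le_two (by linarith)
  set z := (2 : ℝ) • x - y with hz
  have hzx : ‖z - x‖ = ‖y - x‖ := by
    rw [norm_sub_rev y x]; congr 1; rw [hz]; module
  have hz1 : ‖z‖ ≤ 1 / 2 := by
    have := norm_le_norm_add_norm_sub' z x
    linarith
  have hz2 : 3 * r ≤ ‖z‖ := by
    have := norm_le_norm_add_norm_sub z x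
    linarith
  have hqδ : q ≤ δ ^ 2 := by nlinarith
  set l := √(2 * q) with hl
  have hl2 : l ^ 2 = 2 * q := Real.sq_sqrt (by positivity)
  have hl0 : 0 < l := Real.sqrt_pos.mpr (by positivity)
  have hlδ : l ≤ 2 * δ := Real.sqrt_le_iff.mpr ⟨by positivity, by nlinarith⟩
  have hXz : enorm' (((z, 0) : Pt n) - (x, t)) ≤ δ := by
    refine (enorm'_le_add _).trans ?_
    simp only [Prod.mk_sub_mk, zero_sub, abs_neg, abs_of_nonneg ht]
    linarith
  set Y : Pt n := (y, 2 * t) with hY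
  have hYz : Y - (z, 0) = (2 : ℝ) • (((x, t) : Pt n) - (z, 0)) := by
    refine Prod.ext ?_ ?_
    · simp only [hY, hz, Prod.fst_sub, Prod.smul_fst]; module
    · simp [hY]
  have hXzn : nsq (((x, t) : Pt n) - (z, 0)) = q := by
    simp only [nsq, Prod.fst_sub, Prod.snd_sub, sub_zero, norm_sub_rev x z, hzx, hq]
  have hYn : nsq (Y - (z, 0)) = 2 * l ^ 2 := by
    rw [hYz, nsq_smul, hXzn, hl2]; ring
  have hY1 : ‖Y.1 - x‖ = ‖y - x‖ := rfl
  have hYle : enorm' Y ≤ 1 := by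
    refine (enorm'_le_add _).trans ?_
    have := norm_le_norm_add_norm_sub' y x
    simp only [hY, abs_of_nonneg (by positivity : 0 ≤ 2 * t)]
    linarith
  have hYne : Y ≠ 0 := fun e => by
    have h1 : y = 0 := congrArg Prod.fst e
    rw [h1, zero_sub, norm_neg] at hδ
    linarith
  have hms := h.movingSpheres (x₀ := z) (by linarith) hz1 hε hUε hl0 (by linarith) (Y := Y)
    (fun l' hl'0 hl'l Z hZ0 hZ1 => by
      have hZe : enorm' Z = 1 := by rw [enorm'_eq, hZ1, Real.sqrt_one]
      have h1 : 1 / 2 ≤ enorm' (Z - (z, 0)) := by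
        have := enorm'_sub_le Z (z, 0)
        rw [enorm'_trace] at this
        linarith
      have h2 : 1 / 4 ≤ nsq (Z - (z, 0)) := by
        have := (le_enorm'_iff (by norm_num)).mp h1
        linarith
      have h3 : 0 < nsq (Z - (z, 0)) := by linarith
      have h4 : enorm' (invPt z (l' ^ 2) Z - (z, 0)) ≤ 2 * δ := by
        refine (enorm'_le_iff (by positivity)).mpr ?_
        rw [nsq_invPt_sub h3, div_le_iff₀ h3]
        have h5 : l' ≤ 1 / 2 := by linarith
        have h6 : l' ≤ 2 * δ := by linarith
        have h7 : l' ^ 2 ≤ (2 * δ) ^ 2 := by gcongr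
        have h8 : l' ^ 2 ≤ (1 / 2) ^ 2 := by gcongr
        calc (l' ^ 2) ^ 2 = l' ^ 2 * l' ^ 2 := sq _
          _ ≤ (2 * δ) ^ 2 * nsq (Z - (z, 0)) :=
            mul_le_mul h7 (h8.trans (by linarith)) (by positivity) (by positivity)
      have h5 : U (invPt z (l' ^ 2) Z) ≤ A * M := by
        refine hU _ (invPt_snd_nonneg hZ0) ?_
        have := enorm'_add_le (invPt z (l' ^ 2) Z - (z, 0)) ((z, 0) - (x, t))
        rw [sub_add_sub_cancel] at this
        linarith
      have h6 : nsq (Z - (z, 0)) ^ (-a) ≤ 4 ^ a := by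
        have := rpow_le_rpow_neg (by norm_num) h2 ha0.le
        rwa [Real.rpow_neg (by norm_num : (0 : ℝ) ≤ 1 / 4), ← Real.inv_rpow (by norm_num),
          show (1 / 4 : ℝ)⁻¹ = 4 by norm_num] at this
      have hAM : 0 ≤ A * M := hM.le.trans (hU (x, t) ht (by
        rw [sub_self]; simp [enorm']; linarith))
      refine le_trans ?_ hsmall
      unfold kelvin
      have h7 : (l' ^ 2) ^ a * 4 ^ a ≤ ((4 * δ) ^ 2) ^ a := by
        rw [← Real.mul_rpow (by positivity) (by norm_num)]
        have h8 : l' ≤ 2 * δ := by linarith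
        have h9 : l' ^ 2 ≤ (2 * δ) ^ 2 := by gcongr
        have h10 : (4 * δ) ^ 2 = (2 * δ) ^ 2 * 4 := by ring
        rw [h10]
        gcongr
      calc (l' ^ 2) ^ a * nsq (Z - (z, 0)) ^ (-a) * U (invPt z (l' ^ 2) Z)
          ≤ (l' ^ 2) ^ a * nsq (Z - (z, 0)) ^ (-a) * (A * M) := by gcongr
        _ ≤ (l' ^ 2) ^ a * 4 ^ a * (A * M) := by gcongr
        _ ≤ _ := by gcongr)
    (by simp only [hY]; positivity) hYne
    (by have := (enorm'_le_iff zero_le_one).mp hYle; linarith) (by rw [hYn]; linarith [sq_nonneg l])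
  refine le_trans (le_of_eq ?_) hms
  have hinv : invPt z (l ^ 2) Y = (x, t) := by
    rw [invPt, hYn, Real.rpow_neg_one, hYz, smul_smul]
    have : l ^ 2 * (2 * l ^ 2)⁻¹ * 2 = 1 := by field_simp
    rw [this, one_smul, add_sub_cancel]
  rw [kelvin, hinv, hYn, Real.mul_rpow zero_le_two (by positivity)]
  have := rpow_mul_rpow_neg (by positivity : 0 < l ^ 2) a
  linear_combination (-((2 : ℝ) ^ (-a) * M)) * this

set_option maxHeartbeats 1000000 in
/-- The bound when the selected point is close to the trace. -/
lemma exists_bound_of_near_trace (h : Sol n σ U) {ε A T : ℝ} (hε : 0 < ε)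
    (hUε : ∀ Y : Pt n, 0 ≤ Y.2 → Y ≠ 0 → nsq Y ≤ 1 → ε ≤ U Y) (hA : 1 ≤ A) (hT : 0 < T) :
    ∃ C : ℝ, ∀ (x : EuclideanSpace ℝ (Fin n)) (t r : ℝ), 0 ≤ t → t ≤ r → 0 < r → r ≤ 1 / 16 →
      4 * r ≤ ‖x‖ → ‖x‖ ≤ 3 / 8 → 0 < U (x, t) →
      (∀ Y : Pt n, 0 ≤ Y.2 → enorm' (Y - (x, t)) ≤ r → U Y ≤ A * U (x, t)) →
      U (x, t) * t ^ expA n σ ≤ T → U (x, t) * r ^ expA n σ ≤ C := by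
  have ha0 := h.expA_pos
  have hν := h.aspect_pos
  have hH := h.hopfC_pos
  set ν := aspect n σ with hνdef
  set a := expA n σ with ha
  set c₁ : ℝ := 2 ^ (-a) / 4 with hc₁
  have hc₁0 : 0 < c₁ := by positivity
  set T' : ℝ := (A / (hopfC n σ * c₁ ^ expP n σ)) ^ (a / (2 * σ)) with hT'
  have hT'0 : 0 < T' := by positivity
  set T₀ := T ^ (1 / a) with hT₀
  have hT₀0 : 0 < T₀ := by positivity
  set ϱ₀ := 2 * T' ^ (1 / a) + 2 * T₀ / √ν + 1 with hϱ₀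
  have hϱ₀0 : 0 < ϱ₀ := by positivity
  set D := ϱ₀ + T₀ with hD
  have hD0 : 0 < D := by positivity
  refine ⟨max ((3 * D) ^ a) (2 * ((4 * D) ^ 2) ^ a * A / ε), ?_⟩
  intro x t r ht htr hr hr16 hrx hx hM hU hMt
  by_contra! hcon
  set M := U (x, t) with hMdef
  have hcon1 : (3 * D) ^ a < M * r ^ a := (le_max_left _ _).trans_lt hcon
  have hcon2 : 2 * ((4 * D) ^ 2) ^ a * A / ε < M * r ^ a := (le_max_right _ _).trans_lt hcon
  set l := M ^ (-(1 / a)) with hl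
  have hl0 : 0 < l := by positivity
  have hla : l ^ a = M⁻¹ := by
    rw [hl, ← Real.rpow_mul hM.le, show -(1 / a) * a = -1 by field_simp, Real.rpow_neg_one]
  have hMl : M * l ^ a = 1 := by rw [hla]; field_simp
  have hle : ∀ {b S : ℝ}, 0 ≤ b → 0 ≤ S → M * b ^ a ≤ S ^ a → b ≤ S * l := fun {b S} hb hS h1 => by
    have h2 : b ^ a ≤ (S * l) ^ a := by
      rw [Real.mul_rpow hS hl0.le, hla]
      rw [← div_eq_mul_inv, le_div_iff₀ hM]
      linarith
    exact (Real.rpow_le_rpow_iff hb (by positivity) ha0).mp h2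
  have htl : t ≤ T₀ * l := hle ht hT₀0.le (by
    rw [hT₀, ← Real.rpow_mul hT.le, one_div_mul_cancel ha0.ne', Real.rpow_one]
    exact hMt)
  have hDr : 3 * (D * l) ≤ r := by
    by_contra! hlt
    have h1 : r ^ a ≤ (3 * D * l) ^ a := by gcongr; linarith
    rw [Real.mul_rpow (by positivity) hl0.le] at h1
    have : M * r ^ a ≤ (3 * D) ^ a := by
      calc M * r ^ a ≤ M * ((3 * D) ^ a * l ^ a) := by gcongr
        _ = (3 * D) ^ a * (M * l ^ a) := by ring
        _ = _ := by rw [hMl, mul_one]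
    linarith
  have hsmall : ((4 * (D * l)) ^ 2) ^ a * (A * M) ≤ ε / 2 := by
    have h1 : ((4 * (D * l)) ^ 2) ^ a = ((4 * D) ^ 2) ^ a * (l ^ a * l ^ a) := by
      rw [show (4 * (D * l)) ^ 2 = (4 * D) ^ 2 * (l * l) by ring,
        Real.mul_rpow (by positivity) (by positivity), Real.mul_rpow hl0.le hl0.le]
    have h2 : M * r ^ a ≤ M := by
      refine mul_le_of_le_one_right hM.le (Real.rpow_le_one hr.le (by linarith) ha0.le)
    have h3 : 2 * ((4 * D) ^ 2) ^ a * A < M * ε := by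
      rw [div_lt_iff₀ hε] at hcon2
      nlinarith
    calc ((4 * (D * l)) ^ 2) ^ a * (A * M)
        = ((4 * D) ^ 2) ^ a * A * (l ^ a * (M * l ^ a)) := by rw [h1]; ring
      _ = ((4 * D) ^ 2) ^ a * A / M := by rw [hMl, hla, mul_one, div_eq_mul_inv]
      _ ≤ ε / 2 := by rw [div_le_iff₀ hM]; linarith
  set ϱ := ϱ₀ * l with hϱ
  have hϱ0 : 0 < ϱ := by positivity
  have hϱD : ϱ + T₀ * l = D * l := by rw [hϱ, hD]; ring
  have hT₀l : 0 < T₀ * l := by positivity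
  have hdisc : ∀ y : EuclideanSpace ℝ (Fin n), ‖y - x‖ ≤ ϱ → 2 ^ (-a) * M ≤ U (y, 2 * t) :=
    fun y hy => h.le_of_reflection hε hUε ht hr16 hrx hx hM hU (δ := D * l) (by linarith)
      (by positivity) hDr hsmall
  have hτ : (2 * t) ^ 2 ≤ ν * ϱ ^ 2 := by
    have h1 : 2 * T₀ / √ν ≤ ϱ₀ := by
      have : 0 < T' ^ (1 / a) := by positivity
      linarith
    have hs := Real.sqrt_pos.mpr hν
    rw [div_le_iff₀ hs] at h1
    have h2 : 2 * t ≤ √ν * ϱ := by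
      calc 2 * t ≤ 2 * (T₀ * l) := by linarith
        _ ≤ ϱ₀ * √ν * l := by nlinarith
        _ = _ := by rw [hϱ]; ring
    have h3 : (2 * t) ^ 2 ≤ (√ν * ϱ) ^ 2 := by gcongr
    rwa [mul_pow (√ν), Real.sq_sqrt hν.le] at h3
  have htrace : ∀ y : EuclideanSpace ℝ (Fin n), ‖y - x‖ ≤ ϱ / 2 → c₁ * M ≤ U (y, 0) := by
    intro y hy
    have := h.disc_to_trace (z := x) (r := ϱ) (τ := 2 * t) (m := 2 ^ (-a) * M) hϱ0 (by positivity)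
      hτ (by linarith)
      (fun Y hY1 hY2 => by
        have h1 := norm_le_norm_add_norm_sub' Y.1 x
        have h2 := enorm'_le_add Y
        have := (enorm'_lt_iff two_pos).mp (by linarith : enorm' Y < 2)
        linarith)
      hdisc (Y := (y, 0)) hy le_rfl (by positivity)
    refine le_trans (le_of_eq ?_) this
    rw [hc₁]; ring
  have hux : U (x, 0) ≤ A * M := hU (x, 0) le_rfl (by
    have : ((x, 0) : Pt n) - (x, t) = (0, -t) := by simp
    rw [this]
    refine (enorm'_le_add _).trans ?_
    simpa [abs_of_nonneg ht] using htr)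
  have hhopf := h.hopf (z := x) (r := ϱ / 2) (m := c₁ * M) (by positivity) (by positivity)
    (by linarith)
    (fun Y hY1 hY2 => by
      have h1 := norm_le_norm_add_norm_sub' Y.1 x
      have h2 := enorm'_le_add Y
      have := (enorm'_lt_iff two_pos).mp (by linarith : enorm' Y < 2)
      linarith) htrace
  have h1 := h.mul_rpow_le_of_hopf (u := M) (r := ϱ / 2) (K := hopfC n σ * c₁ ^ expP n σ) (B := A)
    hM (by positivity) (by positivity) (by
      rw [Real.mul_rpow hc₁0.le hM.le] at hhopf
      linarith)
  have h2 : ϱ / 2 ≤ T' ^ (1 / a) * l := hle (by positivity) (by positivity) (by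
    rw [← Real.rpow_mul hT'0.le, one_div_mul_cancel ha0.ne', Real.rpow_one]
    exact h1)
  have h3 : ϱ₀ / 2 * l ≤ T' ^ (1 / a) * l := by rw [hϱ] at h2; linarith
  have h4 : ϱ₀ / 2 ≤ T' ^ (1 / a) := le_of_mul_le_mul_right h3 hl0
  have h5 : 0 < 2 * T₀ / √ν := by have := Real.sqrt_pos.mpr hν; positivity
  linarith

/-- The critical upper bound for the trace near the singularity. -/
theorem exists_upper_bound (h : Sol n σ U) : ∃ C : ℝ, 0 < C ∧
    ∀ x : EuclideanSpace ℝ (Fin n), 0 < ‖x‖ → ‖x‖ < 1 / 4 → U (x, 0) ≤ C * ‖x‖ ^ (-expA n σ) := by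
  have ha0 := h.expA_pos
  have hβ := h.spreadExp_pos
  have haβ := h.expA_le_spreadExp
  by_cases hex : ∃ x₁ : EuclideanSpace ℝ (Fin n), 0 < ‖x₁‖ ∧ ‖x₁‖ ≤ 1 / 4 ∧ 0 < U (x₁, 0)
  swap
  · push Not at hex
    exact ⟨1, one_pos, fun x hx hx4 => (hex x hx hx4.le).trans (by positivity)⟩
  obtain ⟨x₁, hx₁, hx₁4, hu₁⟩ := hex
  obtain ⟨ε, hε, hUε⟩ := h.exists_lower_bound hx₁ hx₁4 hu₁
  set a := expA n σ with ha
  set N := 2 * spreadExp n σ with hN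
  have hN0 : 0 < N := by positivity
  have hA : (1 : ℝ) ≤ 2 ^ N := Real.one_le_rpow one_le_two hN0.le
  obtain ⟨C₁, hC₁⟩ := h.exists_bound_of_interior hA
  obtain ⟨T, hT, hheight⟩ := h.exists_height_bound hA
  obtain ⟨C₂, hC₂⟩ := h.exists_bound_of_near_trace hε hUε hA hT
  set C := max 1 (max C₁ (4 ^ a * C₂)) with hC
  have hC0 : 0 < C := one_pos.trans_le (le_max_left _ _)
  refine ⟨C, hC0, fun x₀ hd hd4 => ?_⟩
  rcases le_or_gt (U (x₀, 0)) 0 with hu | hu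
  · exact hu.trans (by positivity)
  suffices hmain : U (x₀, 0) * ‖x₀‖ ^ a ≤ C by
    rw [Real.rpow_neg hd.le, ← div_eq_mul_inv, le_div_iff₀ (by positivity)]
    exact hmain
  obtain ⟨⟨x, t⟩, r, hr, ht, hrd, hM, hU, hdoub⟩ := h.exists_doubling hd hd4.le hu hN0
  simp only at ht
  rcases lt_or_ge r t with hrt | htr
  · exact (hC₁ x₀ x t r hd hd4.le hr hrt hrd hM hU hu hdoub).trans
      ((le_max_left _ _).trans (le_max_right _ _))
  set d := ‖x₀‖ with hddef
  have he := enorm'_nonneg ((x, t) - (x₀, 0) : Pt n)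
  have hxx : ‖x - x₀‖ ≤ d / 2 - 2 * r := by
    have := norm_fst_le ((x, t) - (x₀, 0) : Pt n)
    simp only [Prod.fst_sub] at this
    linarith
  have hx1 := norm_le_norm_add_norm_sub' x x₀
  have hx2 := norm_le_norm_add_norm_sub x x₀
  have hMt : U (x, t) * t ^ a ≤ T := by
    rcases ht.eq_or_lt with h0 | h0
    · rw [← h0, Real.zero_rpow ha0.ne', mul_zero]
      exact hT.le
    · exact hheight x t h0 (by linarith) (by linarith) hM fun Y hY0 hY => hU Y hY0 (hY.trans htr)
  have hMr := hC₂ x t r ht htr hr (by linarith) (by linarith) (by linarith) hM hU hMt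
  have hrat : U (x₀, 0) ≤ (4 * r / d) ^ a * U (x, t) := by
    have h1 : U (x₀, 0) ≤ (4 * r / d) ^ N * U (x, t) := by
      have h2 : 4 * r / d = 2 * r / (d / 2) := by field_simp; norm_num
      rw [h2, Real.div_rpow (by positivity) (by positivity), div_mul_eq_mul_div,
        le_div_iff₀ (by positivity)]
      linarith
    refine h1.trans ?_
    have h2 : (4 * r / d) ^ N ≤ (4 * r / d) ^ a := by
      refine Real.rpow_le_rpow_of_exponent_ge (by positivity) ?_ (by linarith)
      rw [div_le_one hd]
      linarith
    gcongr
  calc U (x₀, 0) * d ^ a ≤ (4 * r / d) ^ a * U (x, t) * d ^ a := by gcongr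
    _ = 4 ^ a * (U (x, t) * r ^ a) := by
      rw [Real.div_rpow (by positivity) hd.le, Real.mul_rpow (by norm_num) hr.le]
      field_simp
    _ ≤ 4 ^ a * C₂ := by gcongr
    _ ≤ C := (le_max_right _ _).trans (le_max_right _ _)

end Sol

end UpperBound

end FracExt

/-- Upper bound near the singularity:
`limsup_{|x|→0} |x|^{(n-2σ)/2} u(x) < ∞`, i.e. `u(x) ≤ C|x|^{-(n-2σ)/2}` near `0`. -/
theorem stmt_7 (n : ℕ) (hn : 2 ≤ n) (σ : ℝ) (hσ : σ ∈ Set.Ioo (0 : ℝ) 1)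
    (U : Pt n → ℝ) (hU : ExtSol n σ 2 U) :
    ∃ C : ℝ, 0 < C ∧ ∃ r₀ ∈ Set.Ioo (0 : ℝ) 1,
      ∀ x : EuclideanSpace ℝ (Fin n), 0 < ‖x‖ → ‖x‖ < r₀ →
        U (x, 0) ≤ C * ‖x‖ ^ (-(((n : ℝ) - 2 * σ) / 2)) := by
  obtain ⟨C, hC, h⟩ := (FracExt.ExtSol.sol hn hσ hU).exists_upper_bound
  exact ⟨C, hC, 1 / 4, ⟨by norm_num, by norm_num⟩, h⟩
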